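/- arXiv:1505.01996 — 2 statements merged into one kernel-verified Lean document; each statement's English description precedes it below -/
import Mathlib

section
/- The poset Π_{n,s+1} admits an EL-labeling; in particular, its order complex is shellable. -/
open Finset

/-- A vector partition of `[n]` into `s+1` components: a partition `P` of `[n]`
together with `s` labelings of its parts. -/
structure VPart (n s : ℕ) where
  P : Finpartition (Finset.univ : Finset (Fin n))
  w : Fin s → Finset (Fin n) → Finset (Fin n)
  card_w : ∀ i : Fin s, ∀ B ∈ P.parts, (w i B).card = B.card
  part_w : ∀ i : Fin s, ∀ x : Fin n, ∃! B, B ∈ P.parts ∧ x ∈ w i B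
  w_junk : ∀ i B, B ∉ P.parts → w i B = ∅

namespace VPart

variable {n s : ℕ}

@[ext] theorem ext' {x y : VPart n s} (hP : x.P = y.P) (hw : x.w = y.w) : x = y := by
  cases x; cases y; simp_all

/-- componentwise union-refinement order -/
instance : PartialOrder (VPart n s) where
  le x y := x.P ≤ y.P ∧
    ∀ i : Fin s, ∀ B ∈ x.P.parts, ∀ B' ∈ y.P.parts, B ⊆ B' → x.w i B ⊆ y.w i B'
  le_refl x := by
    refine ⟨le_refl _, fun i B hB B' hB' hBB' => ?_⟩
    obtain rfl : B = B' := by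
      obtain ⟨a, ha⟩ := x.P.nonempty_of_mem_parts hB
      exact x.P.eq_of_mem_parts hB hB' ha (hBB' ha)
    exact subset_rfl
  le_trans x y z hxy hyz := by
    refine ⟨le_trans hxy.1 hyz.1, fun i B hB B'' hB'' hBB'' => ?_⟩
    obtain ⟨B', hB', hBB'⟩ := hxy.1 hB
    obtain ⟨B''', hB''', hB'B'''⟩ := hyz.1 hB'
    obtain ⟨a, ha⟩ := x.P.nonempty_of_mem_parts hB
    obtain rfl : B''' = B'' :=
      z.P.eq_of_mem_parts hB''' hB'' (hB'B''' (hBB' ha)) (hBB'' ha)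
    exact subset_trans (hxy.2 i B hB B' hB' hBB') (hyz.2 i B' hB' B''' hB''' hB'B''')
  le_antisymm x y hxy hyx := by
    have hP : x.P = y.P := le_antisymm hxy.1 hyx.1
    refine ext' hP ?_
    funext i B
    by_cases hB : B ∈ x.P.parts
    · exact subset_antisymm (hxy.2 i B hB B (hP ▸ hB) subset_rfl)
        (hyx.2 i B (hP ▸ hB) B hB subset_rfl)
    · rw [x.w_junk i B hB, y.w_junk i B (hP ▸ hB)]

/-- the part of the underlying partition containing `k` -/
def partOf (x : VPart n s) (k : Fin n) : Finset (Fin n) := x.P.part k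

/-- the atom word of `x`: `atomWord x i k` is the element of the `i`-th label of the
part containing `k` whose rank in that label matches the rank of `k` in its part. -/
def atomWord (x : VPart n s) (i : Fin s) (k : Fin n) : Fin n :=
  (((x.w i (x.partOf k)).sort (· ≤ ·)).getD (((x.partOf k).filter (· < k)).card)) k

/-- `x` is an atom: all parts of the underlying partition are singletons. -/
def IsAtomic (x : VPart n s) : Prop := ∀ B ∈ x.P.parts, B.card = 1

/-- strict lexicographic order on atom words, with `i` as the major index
and `k` the minor index. -/
def wordLt (A B : Fin s → Fin n → Fin n) : Prop :=
  ∃ i k, A i k < B i k ∧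
    ∀ i' k', (i' < i ∨ (i' = i ∧ k' < k)) → A i' k' = B i' k'

def wordLe (A B : Fin s → Fin n → Fin n) : Prop := wordLt A B ∨ A = B

end VPart

/-- labels: `ℤ × ℤ × ℤ` with the lexicographic order -/
abbrev Lbl : Type := ℤ ×ₗ ℤ ×ₗ ℤ

/-- the word of edge labels along a list, for an edge labeling `f` -/
def labelWord {A B : Type*} (f : A -> A -> B) : List A -> List B
  | a :: b :: l => f a b :: labelWord f (b :: l)
  | _ => []

/-- `L` is a saturated (covering) chain from `x` to `y`; these are exactly the
maximal chains of the interval `[x,y]`. -/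
def CoverChain {A : Type*} [PartialOrder A] (x y : A) (L : List A) : Prop :=
  L.head? = some x ∧ L.getLast? = some y ∧ L.Chain' (fun a b => a ⋖ b)

/-- A linear order `F 0, F 1, ...` on the facets of a pure simplicial complex is a
shelling order iff for all `j < i` there is `k < i` with `F i ∩ F j ⊆ F i ∩ F k`
and `F i ∩ F k` of cardinality `|F i| - 1`. -/
def IsShelling {A : Type*} {t : ℕ} (F : Fin t -> Finset A) : Prop :=
  ∀ i j : Fin t, j < i -> ∃ k : Fin t, k < i ∧
    (F i : Set A) ∩ (F j : Set A) ⊆ (F i : Set A) ∩ (F k : Set A) ∧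
    ((F i : Set A) ∩ (F k : Set A)).ncard + 1 = (F i).card

section Generic

set_option linter.unusedSectionVars false

variable {α : Type*} [PartialOrder α]

theorem coverChain_iff (x y : α) (L : List α) :
    CoverChain x y L ↔ (x = y ∧ L = [x]) ∨
      ∃ z L', x ⋖ z ∧ L = x :: L' ∧ CoverChain z y L' := by
  constructor
  · rintro ⟨h1, h2, h3⟩
    match L, h1, h2, h3 with
    | [], h1, _, _ => simp at h1
    | [a], h1, h2, _ =>
      left
      simp at h1 h2
      subst h1; subst h2; simp
    | a :: b :: l, h1, h2, h3 =>
      right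
      have h3' : List.IsChain (fun a b => a ⋖ b) (a :: b :: l) := h3
      rw [List.isChain_cons_cons] at h3'
      simp at h1
      subst h1
      refine ⟨b, b :: l, h3'.1, rfl, by simp, by simpa using h2, h3'.2⟩
  · rintro (⟨rfl, rfl⟩ | ⟨z, L', hz, rfl, h1, h2, h3⟩)
    · exact ⟨by simp, by simp, List.IsChain.singleton _⟩
    · match L', h1, h2, h3 with
      | [], h1, _, _ => simp at h1
      | b :: l, h1, h2, h3 =>
        simp at h1
        subst h1
        exact ⟨by simp, by simpa using h2, List.IsChain.cons_cons hz h3⟩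

theorem CoverChain.cons {x z y : α} {L : List α} (h : x ⋖ z) (hL : CoverChain z y L) :
    CoverChain x y (x :: L) := (coverChain_iff _ _ _).2 (Or.inr ⟨z, L, h, rfl, hL⟩)

theorem CoverChain.single (x : α) : CoverChain x x [x] :=
  (coverChain_iff _ _ _).2 (Or.inl ⟨rfl, rfl⟩)

theorem CoverChain.exists_eq {x y : α} {L : List α} (h : CoverChain x y L) :
    ∃ l, L = x :: l := by
  rcases (coverChain_iff _ _ _).1 h with ⟨rfl, rfl⟩ | ⟨z, L', _, rfl, _⟩
  · exact ⟨[], rfl⟩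
  · exact ⟨L', rfl⟩

theorem CoverChain.mem_bounds {x y : α} {L : List α} (h : CoverChain x y L) :
    ∀ a ∈ L, x ≤ a ∧ a ≤ y := by
  induction L generalizing x with
  | nil => simp
  | cons b L ih =>
    rcases (coverChain_iff _ _ _).1 h with ⟨rfl, h2⟩ | ⟨z, L', hz, h2, h3⟩
    · simp at h2; simp [h2]
    · obtain ⟨rfl, rfl⟩ := List.cons.inj h2
      have h4 := ih h3
      obtain ⟨l, hl⟩ := h3.exists_eq
      intro a ha
      rcases List.mem_cons.1 ha with rfl | ha
      · exact ⟨le_rfl, hz.le.trans (h4 z (by simp [hl])).2⟩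
      · exact ⟨hz.le.trans (h4 a ha).1, (h4 a ha).2⟩

theorem CoverChain.le {x y : α} {L : List α} (h : CoverChain x y L) : x ≤ y := by
  obtain ⟨l, rfl⟩ := h.exists_eq
  exact (h.mem_bounds x (by simp)).2

theorem CoverChain.right_mem {x y : α} {L : List α} (h : CoverChain x y L) : y ∈ L :=
  List.mem_of_getLast? h.2.1

theorem CoverChain.eq_single {x : α} {L : List α} (h : CoverChain x x L) : L = [x] := by
  rcases (coverChain_iff _ _ _).1 h with ⟨_, h2⟩ | ⟨z, L', hz, h2, h3⟩
  · exact h2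
  · exact absurd hz.lt (not_lt_of_ge h3.le)

theorem labelWord_cons {B : Type*} (lab : α → α → B) {x z y : α} {L : List α}
    (hL : CoverChain z y L) : labelWord lab (x :: L) = lab x z :: labelWord lab L := by
  obtain ⟨l, rfl⟩ := hL.exists_eq
  rfl

/-- local criterion for EL-labelings -/
theorem el_of_local [Finite α] (lab : α → α → Lbl) (C : α → α → α)
    (hC : ∀ x y, x < y → x ⋖ C x y ∧ C x y ≤ y)
    (ha : ∀ x y z, x ⋖ z → z ≤ y → z ≠ C x y → lab x (C x y) < lab x z)
    (hb : ∀ x y z, x ⋖ z → z < y → (lab x z < lab z (C z y) ↔ z = C x y)) :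
    ∀ x y : α, x ≤ y → ∃ L, CoverChain x y L ∧
          (labelWord lab L).IsChain (fun a b => a < b) ∧
          (∀ M, CoverChain x y M -> (labelWord lab M).IsChain (fun a b => a < b) -> M = L) ∧
          (∀ M, CoverChain x y M -> M ≠ L ->
            List.Lex (fun a b => a < b) (labelWord lab L) (labelWord lab M)) ∧
          (x < y → ∃ L', L = x :: L' ∧ CoverChain (C x y) y L') := by
  intro x
  induction x using (Finite.to_wellFoundedGT (α := α)).wf.induction with
  | _ x ih =>
  intro y hxy
  rcases hxy.eq_or_lt with rfl | hlt
  · refine ⟨[x], CoverChain.single x, List.IsChain.nil, fun M hM _ => hM.eq_single,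
      fun M hM hne => absurd hM.eq_single hne, fun h => absurd h (lt_irrefl _)⟩
  obtain ⟨hc1, hc2⟩ := hC x y hlt
  obtain ⟨L', h1, h2, h3, h4, h5⟩ := ih (C x y) hc1.lt y hc2
  have key : ∀ z M, x ⋖ z → z < y → CoverChain z y M →
      (∃ M', M = z :: M' ∧ CoverChain (C z y) y M') →
      labelWord lab (x :: M) = lab x z :: lab z (C z y) :: (labelWord lab M).tail := by
    rintro z M hz hzy hM ⟨M', rfl, hM'⟩
    rw [labelWord_cons lab hM, labelWord_cons lab hM']
    rfl
  have key2 : ∀ z M, z < y → CoverChain z y M →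
      (∃ M', M = z :: M' ∧ CoverChain (C z y) y M') →
      labelWord lab M = lab z (C z y) :: (labelWord lab M).tail := by
    rintro z M hzy hM ⟨M', rfl, hM'⟩
    rw [labelWord_cons lab hM']
    rfl
  refine ⟨x :: L', h1.cons hc1, ?_, ?_, ?_, fun _ => ⟨L', rfl, h1⟩⟩
  · rcases hc2.eq_or_lt with he | hcy
    · rw [he] at h1 hc1
      rw [h1.eq_single]
      exact List.IsChain.singleton _
    · rw [key _ _ hc1 hcy h1 (h5 hcy), List.isChain_cons_cons]
      refine ⟨(hb x y _ hc1 hcy).2 rfl, ?_⟩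
      rw [← key2 _ _ hcy h1 (h5 hcy)]
      exact h2
  · intro M hM hMi
    rcases (coverChain_iff _ _ _).1 hM with ⟨rfl, _⟩ | ⟨z, M', hz, rfl, hM'⟩
    · exact absurd hlt (lt_irrefl _)
    have hM'i : (labelWord lab M').IsChain (fun a b => a < b) := by
      rw [labelWord_cons lab hM'] at hMi
      exact hMi.tail
    have hzc : z = C x y := by
      rcases hM'.le.eq_or_lt with rfl | hzy
      · by_contra hne
        exact hz.2 hc1.lt (lt_of_le_of_ne hc2 (Ne.symm hne))
      · obtain ⟨N, k1, k2, k3, k4, k5⟩ := ih z hz.lt y hM'.le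
        have : M' = N := k3 M' hM' hM'i
        subst this
        rw [key _ _ hz hzy hM' (k5 hzy), List.isChain_cons_cons] at hMi
        exact (hb x y z hz hzy).1 hMi.1
    subst hzc
    rw [h3 M' hM' hM'i]
  · intro M hM hne
    rcases (coverChain_iff _ _ _).1 hM with ⟨rfl, _⟩ | ⟨z, M', hz, rfl, hM'⟩
    · exact absurd hlt (lt_irrefl _)
    rw [labelWord_cons lab h1, labelWord_cons lab hM']
    by_cases hzc : z = C x y
    · subst hzc
      exact List.Lex.cons (h4 M' hM' (fun h => hne (by rw [h])))
    · exact List.Lex.rel (ha x y z hz hM'.le hzc)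

theorem CoverChain.length {h : α → ℕ} (hh : ∀ a b, a ⋖ b → h b = h a + 1)
    {x y : α} {L : List α} (hL : CoverChain x y L) : L.length + h x = h y + 1 := by
  induction L generalizing x with
  | nil => obtain ⟨l, h⟩ := hL.exists_eq; simp at h
  | cons b L ih =>
    rcases (coverChain_iff _ _ _).1 hL with ⟨rfl, h2⟩ | ⟨z, L', hz, h2, h3⟩
    · simp at h2; simp [h2]; omega
    · obtain ⟨rfl, rfl⟩ := List.cons.inj h2
      have := ih h3
      have := hh _ _ hz
      simp; omega

theorem CoverChain.mem_of_comparable {x y c : α} {L : List α} (h : CoverChain x y L)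
    (hx : x ≤ c) (hy : c ≤ y) (hc : ∀ a ∈ L, a ≤ c ∨ c ≤ a) : c ∈ L := by
  induction L generalizing x with
  | nil => obtain ⟨l, h⟩ := h.exists_eq; simp at h
  | cons b L ih =>
    rcases (coverChain_iff _ _ _).1 h with ⟨rfl, h2⟩ | ⟨z, L', hz, h2, h3⟩
    · simp [h2, le_antisymm hx hy]
    · obtain ⟨rfl, rfl⟩ := List.cons.inj h2
      obtain ⟨l, hl⟩ := h3.exists_eq
      by_cases hzc : z ≤ c
      · exact List.mem_cons_of_mem _ (ih h3 hzc (fun a ha => hc a (List.mem_cons_of_mem _ ha)))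
      · have hcz : c < z := by
          rcases hc z (by simp [hl]) with h | h
          · exact absurd h hzc
          · exact lt_of_le_of_ne h (fun e => hzc e.ge)
        rcases hx.eq_or_lt with rfl | hlt
        · simp
        · exact absurd hcz (hz.2 hlt)

theorem CoverChain.pairwise {x y : α} {L : List α} (h : CoverChain x y L) :
    L.Pairwise (· < ·) := by
  induction L generalizing x with
  | nil => simp
  | cons b L ih =>
    rcases (coverChain_iff _ _ _).1 h with ⟨rfl, h2⟩ | ⟨z, L', hz, h2, h3⟩
    · simp [h2]
    · obtain ⟨rfl, rfl⟩ := List.cons.inj h2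
      rw [List.pairwise_cons]
      exact ⟨fun a ha => hz.lt.trans_le (h3.mem_bounds a ha).1, ih h3⟩

theorem CoverChain.nodup {x y : α} {L : List α} (h : CoverChain x y L) : L.Nodup :=
  h.pairwise.imp (fun h => h.ne)

theorem CoverChain.append {x z y : α} {L M : List α} (hL : CoverChain x z L)
    (hM : CoverChain z y (z :: M)) : CoverChain x y (L ++ M) := by
  induction L generalizing x with
  | nil => obtain ⟨l, h⟩ := hL.exists_eq; simp at h
  | cons b L ih =>
    rcases (coverChain_iff _ _ _).1 hL with ⟨rfl, h2⟩ | ⟨w, L', hz, h2, h3⟩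
    · rw [h2]; exact hM
    · obtain ⟨rfl, rfl⟩ := List.cons.inj h2
      exact (ih h3).cons hz

theorem CoverChain.split {x y d : α} {L1 L2 : List α}
    (h : CoverChain x y (L1 ++ d :: L2)) :
    CoverChain x d (L1 ++ [d]) ∧ CoverChain d y (d :: L2) := by
  induction L1 generalizing x with
  | nil =>
    obtain ⟨l, hl⟩ := h.exists_eq
    obtain ⟨rfl, rfl⟩ := List.cons.inj hl
    exact ⟨CoverChain.single _, h⟩
  | cons b L ih =>
    rcases (coverChain_iff _ _ _).1 h with ⟨rfl, h2⟩ | ⟨w, L', hz, h2, h3⟩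
    · simp at h2
    · obtain ⟨rfl, rfl⟩ := List.cons.inj h2
      exact ⟨(ih h3).1.cons hz, (ih h3).2⟩

theorem labelWord_append {B : Type*} (lab : α → α → B) (d : α) (L1 L2 : List α) :
    labelWord lab (L1 ++ d :: L2) = labelWord lab (L1 ++ [d]) ++ labelWord lab (d :: L2) := by
  induction L1 with
  | nil => simp [labelWord]
  | cons a L ih =>
    cases L with
    | nil => simp [labelWord]
    | cons b L => simp only [List.cons_append, labelWord] at ih ⊢; rw [ih]

theorem labelWord_length {B : Type*} (lab : α → α → B) (L : List α) :
    (labelWord lab L).length = L.length - 1 := by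
  induction L with
  | nil => simp [labelWord]
  | cons a L ih =>
    cases L with
    | nil => simp [labelWord]
    | cons b L => simp only [labelWord, List.length_cons] at ih ⊢; omega

theorem lex_append {B : Type*} {r : B → B → Prop} {a b c d : List B}
    (h : List.Lex r a b) (hl : a.length = b.length) : List.Lex r (a ++ c) (b ++ d) := by
  induction h with
  | nil => simp at hl
  | rel h => exact List.Lex.rel h
  | cons h ih => exact List.Lex.cons (ih (by simpa using hl))

theorem lex_append_left {B : Type*} {r : B → B → Prop} (a : List B) {c d : List B}
    (h : List.Lex r c d) : List.Lex r (a ++ c) (a ++ d) := by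
  induction a with
  | nil => exact h
  | cons x a ih => exact List.Lex.cons ih

theorem exists_descent {B : Type*} {r : B → B → Prop} (lab : α → α → B) (L : List α)
    (h : ¬ (labelWord lab L).IsChain r) :
    ∃ L1 a e b L2, L = L1 ++ a :: e :: b :: L2 ∧ ¬ r (lab a e) (lab e b) := by
  induction L with
  | nil => exact absurd List.IsChain.nil h
  | cons a L ih =>
    match L, ih, h with
    | [], _, h => exact absurd List.IsChain.nil h
    | [b], _, h => exact absurd (List.IsChain.singleton _) h
    | b :: c :: L, ih, h =>
      by_cases h1 : r (lab a b) (lab b c)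
      · by_cases h2 : (labelWord lab (b :: c :: L)).IsChain r
        · exact absurd (List.IsChain.cons_cons h1 h2) h
        · obtain ⟨L1, x, e, y, L2, h3, h4⟩ := ih h2
          exact ⟨a :: L1, x, e, y, L2, by rw [h3]; rfl, h4⟩
      · exact ⟨[], a, b, c, L, rfl, h1⟩

/-- splitting a list at the first element satisfying a predicate -/
theorem exists_first {β : Type*} (p : β → Prop) (L : List β) (h : ∃ a ∈ L, p a) :
    ∃ L1 d L2, L = L1 ++ d :: L2 ∧ p d ∧ ∀ a ∈ L1, ¬ p a := by
  induction L with
  | nil => simp at h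
  | cons a L ih =>
    by_cases ha : p a
    · exact ⟨[], a, L, rfl, ha, by simp⟩
    · obtain ⟨L1, d, L2, h1, h2, h3⟩ := ih (by
        obtain ⟨b, hb, hpb⟩ := h
        rcases List.mem_cons.1 hb with rfl | hb
        · exact absurd hpb ha
        · exact ⟨b, hb, hpb⟩)
      refine ⟨a :: L1, d, L2, by rw [h1]; rfl, h2, ?_⟩
      intro b hb
      rcases List.mem_cons.1 hb with rfl | hb
      · exact ha
      · exact h3 b hb

def IsEL (lab : α → α → Lbl) : Prop :=
  ∀ x y : α, x ≤ y -> ∃ L, CoverChain x y L ∧ (labelWord lab L).IsChain (fun a b => a < b) ∧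
          (∀ M, CoverChain x y M -> (labelWord lab M).IsChain (fun a b => a < b) -> M = L) ∧
          (∀ M, CoverChain x y M -> M ≠ L ->
            List.Lex (fun a b => a < b) (labelWord lab L) (labelWord lab M))

theorem exchange {lab : α → α → Lbl} (hel : IsEL lab) {h : α → ℕ}
    (hh : ∀ a b, a ⋖ b → h b = h a + 1) (L : List α) : ∀ (M : List α) (x y : α)
    (_ : CoverChain x y L) (_ : CoverChain x y M) (_ : L ≠ M)
    (_ : ¬ List.Lex (fun a b => a < b) (labelWord lab L) (labelWord lab M)),
    ∃ K e, CoverChain x y K ∧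
      List.Lex (fun a b => a < b) (labelWord lab K) (labelWord lab L) ∧
      e ∈ L ∧ e ∉ M ∧ e ∉ K ∧ ∀ a ∈ L, a ≠ e → a ∈ K := by
  induction L with
  | nil => intro M x y hL; obtain ⟨l, h⟩ := hL.exists_eq; simp at h
  | cons b L ih =>
  intro M x y hL hM hne hlex
  rcases (coverChain_iff _ _ _).1 hL with ⟨rfl, h2⟩ | ⟨z, L', hz, h2, h3⟩
  · exact absurd (h2.trans hM.eq_single.symm) hne
  obtain ⟨rfl, rfl⟩ := List.cons.inj h2
  rcases (coverChain_iff _ _ _).1 hM with ⟨rfl, _⟩ | ⟨z', M', hz', rfl, h3'⟩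
  · exact absurd (hz.lt.trans_le h3.le) (lt_irrefl _)
  by_cases hzz : z = z'
  · subst hzz
    rw [labelWord_cons lab h3, labelWord_cons lab h3'] at hlex
    obtain ⟨K, e, k1, k2, k3, k4, k5, k6⟩ := ih M' z y h3 h3' (fun e => hne (by rw [e]))
      (fun h => hlex (List.Lex.cons h))
    have hbe : b ≠ e := by
      rintro rfl
      exact absurd (h3.mem_bounds b k3).1 (not_le_of_gt hz.lt)
    refine ⟨b :: K, e, k1.cons hz, ?_, List.mem_cons_of_mem _ k3, ?_, ?_, ?_⟩
    · rw [labelWord_cons lab h3, labelWord_cons lab k1]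
      exact List.Lex.cons k2
    · simp [k4, hbe.symm]
    · simp [k5, hbe.symm]
    · intro a ha hae
      rcases List.mem_cons.1 ha with rfl | ha
      · simp
      · exact List.mem_cons_of_mem _ (k6 a ha hae)
  · obtain ⟨L1, d, L2, rfl, hd, hL1⟩ := exists_first (fun a => a ∈ M') L
      ⟨y, h3.right_mem, h3'.right_mem⟩
    obtain ⟨M1, M2, rfl⟩ := List.append_of_mem hd
    have sL : CoverChain b y ((b :: L1) ++ d :: L2) := hL
    have sM : CoverChain b y ((b :: M1) ++ d :: M2) := hM
    obtain ⟨sL1, sL2⟩ := sL.split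
    obtain ⟨sM1, sM2⟩ := sM.split
    obtain ⟨N, n1, n2, n3, n4⟩ := hel b d sL1.le
    have hdesc : ¬ (labelWord lab ((b :: L1) ++ [d])).IsChain (fun a b => a < b) := by
      intro hinc
      have e := n3 _ sL1 hinc
      subst e
      by_cases hMN : (b :: M1) ++ [d] = (b :: L1) ++ [d]
      · have : M1 = L1 := by simpa using hMN
        subst this
        apply hzz
        obtain ⟨l, hl⟩ := h3.exists_eq
        obtain ⟨l', hl'⟩ := h3'.exists_eq
        cases M1 with
        | nil =>
          simp at hl hl'
          exact hl.1.symm.trans hl'.1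
        | cons c M1 =>
          simp at hl hl'
          exact hl.1.symm.trans hl'.1
      · apply hlex
        have := n4 _ sM1 hMN
        have e1 := labelWord_append lab d (b :: L1) L2
        have e2 := labelWord_append lab d (b :: M1) M2
        simp only [List.cons_append] at e1 e2
        rw [e1, e2]
        refine lex_append this ?_
        rw [labelWord_length, labelWord_length]
        have := sL1.length hh
        have := sM1.length hh
        simp only [List.cons_append] at *
        omega
    obtain ⟨A1, p, e, q, A2, hA, hpq⟩ := exists_descent lab _ hdesc
    have hfull : b :: (L1 ++ d :: L2) = A1 ++ p :: ([e] ++ q :: (A2 ++ L2)) := by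
      have : ((b :: L1) ++ [d]) ++ L2 = (A1 ++ p :: e :: q :: A2) ++ L2 := by rw [hA]
      simpa using this
    have hL' := hL
    rw [hfull] at hL'
    obtain ⟨t1, t2⟩ := hL'.split
    have t2' : CoverChain p y ((p :: [e]) ++ q :: (A2 ++ L2)) := t2
    obtain ⟨t3, t4⟩ := t2'.split
    obtain ⟨N', m1, m2, m3, m4⟩ := hel p q t3.le
    have hlen3 := t3.length hh
    have hlenN := m1.length hh
    have hne3 : (p :: [e]) ++ [q] ≠ N' := by
      rintro rfl
      apply hpq
      have : List.IsChain (fun a b : Lbl => a < b) [lab p e, lab e q] := m2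
      exact (List.isChain_cons_cons.1 this).1
    have hN'lex := m4 _ t3 hne3
    obtain ⟨f, hf⟩ : ∃ f, N' = [p, f, q] := by
      obtain ⟨l, rfl⟩ := m1.exists_eq
      have hq := m1.2.1
      match l, hlenN, hq with
      | [], hl, _ => simp at hl hlen3; omega
      | [a], hl, _ => simp at hl hlen3; omega
      | [f, g], hl, hq => simp at hq; exact ⟨f, by rw [hq]⟩
      | f :: g :: k :: l, hl, _ => simp at hl hlen3; omega
    subst hf
    have hnd := hL'.nodup
    have hpw := hL'.pairwise
    have hef : e ≠ f := by rintro rfl; exact hne3 rfl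
    have mq : CoverChain p y ([p, f, q] ++ (A2 ++ L2)) := m1.append t4
    refine ⟨A1 ++ p :: ([f] ++ q :: (A2 ++ L2)), e, ?_, ?_, ?_, ?_, ?_, ?_⟩
    · have := t1.append (M := [f] ++ q :: (A2 ++ L2)) mq
      simpa using this
    · rw [hfull, labelWord_append lab p A1 ([f] ++ q :: (A2 ++ L2)),
        labelWord_append lab p A1 ([e] ++ q :: (A2 ++ L2))]
      apply lex_append_left
      have e1 := labelWord_append lab q [p, f] (A2 ++ L2)
      have e2 := labelWord_append lab q [p, e] (A2 ++ L2)
      simp only [List.cons_append, List.nil_append] at e1 e2 ⊢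
      rw [e1, e2]
      exact lex_append hN'lex (by simp [labelWord])
    · rw [hfull]; simp
    ·
      have heL : e ∈ (b :: L1) ++ [d] := by rw [hA]; simp
      have hnd1 := sL1.pairwise
      have heb : b ≠ e := by
        have : b ≤ p := (t1.mem_bounds p (by simp)).1
        have h2 : p < e := by
          have := t3.pairwise
          simp at this; exact this.1.1
        exact (this.trans_lt h2).ne
      have hed : e ≠ d := by
        have h2 : e < q := by
          have := t3.pairwise
          simp at this; exact this.2
        have : q ≤ d := (sL1.mem_bounds q (by rw [hA]; simp)).2
        exact (h2.trans_le this).ne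
      simp [heb.symm, hed] at heL
      have := hL1 e heL
      intro h
      rcases List.mem_cons.1 h with h | h
      · exact heb h.symm
      · exact this h
    · have : e ∉ A1 ∧ e ≠ p ∧ e ≠ q ∧ e ∉ A2 ++ L2 := by
        simp only [List.nodup_append, List.nodup_cons, List.cons_append, List.nil_append] at hnd
        refine ⟨fun h => hnd.2.2 e h e (by simp) rfl, ?_, ?_, ?_⟩
        · rintro rfl; exact hnd.2.1.1 (by simp)
        · rintro rfl; exact hnd.2.1.2.1 (by simp)
        · intro h; exact hnd.2.1.2.1 (by simp at h; simp [h])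
      simp only [List.mem_append, List.mem_cons, List.cons_append, List.nil_append] at this ⊢
      tauto
    · intro a ha hae
      rw [hfull] at ha
      simp only [List.mem_append, List.mem_cons, List.cons_append, List.nil_append] at ha ⊢
      tauto

theorem CoverChain.isMaxChain [OrderBot α] [OrderTop α] {L : List α}
    (h : CoverChain ⊥ ⊤ L) : IsMaxChain (fun a b => a ≤ b) {a | a ∈ L} := by
  refine ⟨?_, ?_⟩
  · intro a ha b hb hab
    have := h.pairwise
    have : Std.Symm (fun a b : α => a ≤ b ∨ b ≤ a) := ⟨fun _ _ h => h.symm⟩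
    have h2 := List.Pairwise.forall_of_forall (R := fun a b : α => a ≤ b ∨ b ≤ a)
      (fun a _ => Or.inl le_rfl)
      (h.pairwise.imp (fun h => Or.inl h.le))
    exact h2 ha hb
  · intro t ht hst
    refine Set.Subset.antisymm hst ?_
    intro c hc
    refine h.mem_of_comparable bot_le le_top ?_
    intro a ha
    by_cases hac : a = c
    · exact Or.inl hac.le
    · exact ht (hst ha) hc hac

theorem exists_coverChain_of_isMaxChain [Finite α] [OrderBot α] [OrderTop α] {S : Set α}
    (h : IsMaxChain (fun a b => a ≤ b) S) : ∃ L, CoverChain ⊥ ⊤ L ∧ {a | a ∈ L} = S := by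
  have hmem : ∀ c, (∀ a ∈ S, a ≤ c ∨ c ≤ a) → c ∈ S := by
    intro c hc
    have h1 : IsChain (fun a b : α => a ≤ b) (insert c S) := by
      apply h.1.insert
      intro b hb _
      exact (hc b hb).symm
    rw [h.2 h1 (Set.subset_insert _ _)]
    exact Set.mem_insert _ _
  have htop : ⊤ ∈ S := hmem ⊤ (fun a _ => Or.inl le_top)
  have hbot : ⊥ ∈ S := hmem ⊥ (fun a _ => Or.inr bot_le)
  have htot : ∀ a ∈ S, ∀ b ∈ S, a ≤ b ∨ b ≤ a := by
    intro a ha b hb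
    by_cases hab : a = b
    · exact Or.inl hab.le
    · exact h.1 ha hb hab
  have key : ∀ a ∈ S, ∃ L, CoverChain a ⊤ L ∧ ∀ b ∈ L, b ∈ S := by
    intro a
    induction a using (Finite.to_wellFoundedGT (α := α)).wf.induction with
    | _ a ih =>
    intro ha
    by_cases hat : a = ⊤
    · subst hat
      exact ⟨[⊤], CoverChain.single _, by simpa using htop⟩
    · obtain ⟨b, hb⟩ := Set.Finite.exists_minimal (s := {b | b ∈ S ∧ a < b})
        (Set.toFinite _) ⟨⊤, htop, lt_top_iff_ne_top.2 hat⟩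
      have hab : a ⋖ b := by
        refine ⟨hb.1.2, ?_⟩
        intro c hac hcb
        have hcS : c ∈ S := by
          apply hmem
          intro d hd
          rcases htot a ha d hd with h1 | h1
          · rcases h1.eq_or_lt with rfl | h1
            · exact Or.inl hac.le
            · rcases htot b hb.1.1 d hd with h2 | h2
              · exact Or.inr (hcb.le.trans h2)
              · exact Or.inr (hcb.le.trans (hb.2 ⟨hd, h1⟩ h2))
          · exact Or.inl (h1.trans hac.le)
        exact absurd (hb.2 ⟨hcS, hac⟩ hcb.le) (not_le_of_gt hcb)
      obtain ⟨L, hL, hLS⟩ := ih b hab.lt hb.1.1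
      refine ⟨a :: L, hL.cons hab, ?_⟩
      intro c hc
      rcases List.mem_cons.1 hc with rfl | hc
      · exact ha
      · exact hLS c hc
  obtain ⟨L, hL, hLS⟩ := key ⊥ hbot
  exact ⟨L, hL, hL.isMaxChain.2 h.1 hLS⟩

theorem CoverChain.ext_mem {x y : α} {L M : List α} (hL : CoverChain x y L)
    (hM : CoverChain x y M) (h : ∀ a, a ∈ L ↔ a ∈ M) : L = M := by
  have hp : L.Perm M := (List.perm_ext_iff_of_nodup hL.nodup hM.nodup).2 h
  exact hp.eq_of_pairwise (le := fun a b => a < b)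
    (fun a b _ _ h1 h2 => absurd (h1.trans h2) (lt_irrefl _)) hL.pairwise hM.pairwise

theorem shelling_of_el [Finite α] [OrderBot α] [OrderTop α] {lab : α → α → Lbl}
    (hel : IsEL lab) {h : α → ℕ} (hh : ∀ a b, a ⋖ b → h b = h a + 1) :
    ∃ (t : ℕ) (F : Fin t -> Finset α),
      (∀ i, IsMaxChain (fun a b => a ≤ b) (F i : Set α)) ∧
      (∀ S : Finset α, IsMaxChain (fun a b => a ≤ b) (S : Set α) -> ∃ i, F i = S) ∧
      Function.Injective F ∧ IsShelling F := by
  classical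
  have : Fintype α := Fintype.ofFinite α
  let T := {S : Finset α // IsMaxChain (fun a b => a ≤ b) (S : Set α)}
  have hT : ∀ S : T, ∃ L, CoverChain ⊥ ⊤ L ∧ {a | a ∈ L} = (S.1 : Set α) :=
    fun S => exists_coverChain_of_isMaxChain S.2
  choose G hG1 hG2 using hT
  let e : T ≃ Fin (Fintype.card T) := Fintype.equivFin T
  let key : Fin (Fintype.card T) → List Lbl := fun i => labelWord lab (G (e.symm i))
  let σ := Tuple.sort key
  have hmono : Monotone (key ∘ σ) := Tuple.monotone_sort key
  refine ⟨Fintype.card T, fun i => (e.symm (σ i)).1, fun i => (e.symm (σ i)).2, ?_, ?_, ?_⟩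
  · intro S hS
    exact ⟨σ.symm (e ⟨S, hS⟩), by simp⟩
  · intro i j hij
    exact σ.injective (e.symm.injective (Subtype.ext hij))
  · intro i j hji
    have hmemG : ∀ (S : T) a, a ∈ S.1 ↔ a ∈ G S := by
      intro S a
      have := Set.ext_iff.1 (hG2 S) a
      exact this.symm
    have hne : G (e.symm (σ i)) ≠ G (e.symm (σ j)) := by
      intro h
      have : e.symm (σ i) = e.symm (σ j) := by
        apply Subtype.ext
        ext a
        rw [hmemG, hmemG, h]
      exact hji.ne (σ.injective (e.symm.injective this)).symm
    have hnl : ¬ List.Lex (fun a b => a < b) (labelWord lab (G (e.symm (σ i))))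
        (labelWord lab (G (e.symm (σ j)))) := by
      intro h
      have h1 : key (σ i) < key (σ j) := h
      exact absurd (hmono hji.le) (not_le_of_gt h1)
    obtain ⟨K, f, k1, k2, k3, k4, k5, k6⟩ := exchange hel hh _ _ _ _ (hG1 _) (hG1 _) hne hnl
    let KT : T := ⟨K.toFinset, by simpa using k1.isMaxChain⟩
    have hKT : G KT = K := by
      apply (hG1 KT).ext_mem k1
      intro a
      rw [← hmemG]
      simp [KT]
    have hki : key (e KT) < key (σ i) := by
      show List.Lex _ _ _
      simpa [key, hKT] using k2
    refine ⟨σ.symm (e KT), ?_, ?_, ?_⟩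
    · by_contra hcon
      have h1 : key (σ i) ≤ key (σ (σ.symm (e KT))) := hmono (not_lt.1 hcon)
      rw [Equiv.apply_symm_apply] at h1
      exact absurd h1 (not_le_of_gt hki)
    · simp only [Equiv.apply_symm_apply, Equiv.symm_apply_apply]
      rintro a ⟨ha1, ha2⟩
      refine ⟨ha1, ?_⟩
      have ha1' := (hmemG _ a).1 ha1
      have ha2' := (hmemG _ a).1 ha2
      have : a ∈ K := k6 a ha1' (by rintro rfl; exact k4 ha2')
      simpa [KT] using this
    · simp only [Equiv.apply_symm_apply, Equiv.symm_apply_apply]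
      have hfm : f ∈ (e.symm (σ i)).1 := (hmemG _ f).2 k3
      have : (((e.symm (σ i)).1 : Set α) ∩ (KT.1 : Set α)) =
          (((e.symm (σ i)).1.erase f : Finset α) : Set α) := by
        ext a
        simp only [Set.mem_inter_iff, Finset.mem_coe, Finset.mem_erase]
        constructor
        · rintro ⟨h1, h2⟩
          refine ⟨?_, h1⟩
          rintro rfl
          exact k5 (by simpa [KT] using h2)
        · rintro ⟨h1, h2⟩
          refine ⟨h2, ?_⟩
          have : a ∈ K := k6 a ((hmemG _ a).1 h2) h1
          simpa [KT] using this
      rw [this, Set.ncard_coe_finset]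
      exact Finset.card_erase_add_one hfm

end Generic

section Ranks

open Classical in
/-- rank of an element in a finite linear order -/
noncomputable def rk {β : Type*} [LinearOrder β] [Fintype β] (a : β) : ℤ :=
  ((Finset.univ.filter (fun b => b < a)).card : ℤ)

theorem rk_strictMono {β : Type*} [LinearOrder β] [Fintype β] {a b : β} (h : a < b) :
    rk a < rk b := by
  classical
  unfold rk
  rw [Nat.cast_lt]
  apply Finset.card_lt_card
  rw [Finset.ssubset_iff_of_subset]
  · exact ⟨a, by simpa using h, by simp⟩
  · intro c hc
    simp only [Finset.mem_filter, Finset.mem_univ, true_and] at hc ⊢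
    exact hc.trans h

theorem lbl_lt {a b c a' b' c' : ℤ} :
    (toLex (a, toLex (b, c)) : Lbl) < toLex (a', toLex (b', c')) ↔
      a < a' ∨ (a = a' ∧ (b < b' ∨ (b = b' ∧ c < c'))) := by
  simp [Prod.Lex.lt_iff]

variable {ι β : Type*} [LinearOrder ι] [WellFoundedLT ι] [LinearOrder β]

/-- `p` is the first position where `a` and `b` differ -/
def FD (a b : Lex (ι → β)) (p : ι) : Prop :=
  (∀ q < p, ofLex a q = ofLex b q) ∧ ofLex a p ≠ ofLex b p

theorem lex_lt_iff (a b : Lex (ι → β)) :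
    a < b ↔ ∃ p, (∀ q < p, ofLex a q = ofLex b q) ∧ ofLex a p < ofLex b p := Iff.rfl

theorem FD.unique {a b : Lex (ι → β)} {p q : ι} (hp : FD a b p) (hq : FD a b q) : p = q := by
  rcases lt_trichotomy p q with h | h | h
  · exact absurd (hq.1 p h) hp.2
  · exact h
  · exact absurd (hp.1 q h) hq.2

theorem FD.exists {a b : Lex (ι → β)} (h : a ≠ b) : ∃ p, FD a b p := by
  rcases lt_or_gt_of_ne h with h | h
  · obtain ⟨p, h1, h2⟩ := (lex_lt_iff _ _).1 h
    exact ⟨p, h1, h2.ne⟩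
  · obtain ⟨p, h1, h2⟩ := (lex_lt_iff _ _).1 h
    exact ⟨p, fun q hq => (h1 q hq).symm, h2.ne'⟩

theorem FD.ne {a b : Lex (ι → β)} {p : ι} (h : FD a b p) : a ≠ b := by
  rintro rfl; exact h.2 rfl

theorem lex_apply_le {a b : Lex (ι → β)} {p : ι} (h : a ≤ b)
    (hp : ∀ q < p, ofLex a q = ofLex b q) : ofLex a p ≤ ofLex b p := by
  rcases h.eq_or_lt with rfl | h
  · exact le_rfl
  obtain ⟨q, h1, h2⟩ := (lex_lt_iff _ _).1 h
  rcases lt_trichotomy p q with h | h | h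
  · exact (h1 p h).le
  · subst h; exact h2.le
  · exact absurd (hp q h) h2.ne

theorem sandwich {a b c : Lex (ι → β)} (hab : a ≤ b) (hbc : b ≤ c) (r : ι)
    (hac : ∀ q ≤ r, ofLex a q = ofLex c q) : ∀ q ≤ r, ofLex a q = ofLex b q := by
  intro q
  induction q using (inferInstance : WellFoundedLT ι).wf.induction with
  | _ q ih =>
  intro hq
  have h1 : ∀ q' < q, ofLex a q' = ofLex b q' := fun q' h => ih q' h (h.le.trans hq)
  have h2 := lex_apply_le hab h1
  have h3 : ofLex b q ≤ ofLex c q :=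
    lex_apply_le hbc (fun q' h => by rw [← h1 q' h, hac q' (h.le.trans hq)])
  rw [← hac q hq] at h3
  exact le_antisymm h2 h3

theorem sandwich_lt {a b c : Lex (ι → β)} (hab : a ≤ b) (hbc : b ≤ c) (r : ι)
    (hac : ∀ q < r, ofLex a q = ofLex c q) : ∀ q < r, ofLex a q = ofLex b q :=
  fun q hq => sandwich hab hbc q (fun q' h => hac q' (lt_of_le_of_lt h hq)) q le_rfl

end Ranks

namespace VPart

variable {n s : ℕ}

abbrev Wd (n s : ℕ) : Type := Lex (Fin s ×ₗ Fin n → Fin n)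

def ev (f : Wd n s) (i : Fin s) (k : Fin n) : Fin n := ofLex f (toLex (i, k))

def InW (x : VPart n s) (f : Wd n s) : Prop :=
  ∀ i, Function.Injective (ev f i) ∧ ∀ k, ev f i k ∈ x.w i (x.P.part k)

def R (x : VPart n s) (k l : Fin n) : Prop := x.P.part k = x.P.part l

theorem R.refl (x : VPart n s) (k : Fin n) : R x k k := rfl
theorem R.symm {x : VPart n s} {k l : Fin n} (h : R x k l) : R x l k := Eq.symm h
theorem R.trans {x : VPart n s} {k l m : Fin n} (h : R x k l) (h' : R x l m) : R x k m :=
  Eq.trans h h'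

theorem mem_part_iff (x : VPart n s) (k l : Fin n) : l ∈ x.P.part k ↔ R x k l := by
  rw [Finpartition.mem_part_iff_part_eq_part _ (Finset.mem_univ _) (Finset.mem_univ _)]
  exact eq_comm

theorem part_mem' (x : VPart n s) (k : Fin n) : x.P.part k ∈ x.P.parts :=
  x.P.part_mem.2 (Finset.mem_univ _)

theorem P_le_iff {x y : VPart n s} : x.P ≤ y.P ↔ ∀ k l, R x k l → R y k l := by
  constructor
  · intro h k l hkl
    obtain ⟨B, hB, hB'⟩ := h (part_mem' x k)
    have h1 : k ∈ B := hB' ((mem_part_iff x k k).2 rfl)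
    have h2 : l ∈ B := hB' ((mem_part_iff x k l).2 hkl)
    show y.P.part k = y.P.part l
    rw [y.P.part_eq_of_mem hB h1, y.P.part_eq_of_mem hB h2]
  · intro h B hB
    obtain ⟨k, hk⟩ := x.P.nonempty_of_mem_parts hB
    refine ⟨y.P.part k, part_mem' y k, ?_⟩
    rw [← x.P.part_eq_of_mem hB hk]
    intro l hl
    exact (mem_part_iff y k l).2 (h k l ((mem_part_iff x k l).1 hl))

theorem exists_inW (x : VPart n s) : ∃ f, InW x f := by
  let g : Fin s → Fin n → Fin n := fun i k =>
    (Finset.equivOfCardEq (x.card_w i _ (part_mem' x k)).symm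
      ⟨k, (mem_part_iff x k k).2 rfl⟩ : x.w i (x.P.part k)).1
  have hg : ∀ i k, g i k ∈ x.w i (x.P.part k) := fun i k => Subtype.mem _
  have hinj : ∀ i B (hB : B ∈ x.P.parts) k l (hk : k ∈ B) (hl : l ∈ B),
      (Finset.equivOfCardEq (x.card_w i B hB).symm ⟨k, hk⟩).1 =
      (Finset.equivOfCardEq (x.card_w i B hB).symm ⟨l, hl⟩).1 → k = l := by
    intro i B hB k l hk hl h
    have := (Finset.equivOfCardEq (x.card_w i B hB).symm).injective (Subtype.ext h)
    simpa using this
  have hval : ∀ i k B (hB : B ∈ x.P.parts) (hk : k ∈ B),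
      g i k = (Finset.equivOfCardEq (x.card_w i B hB).symm ⟨k, hk⟩).1 := by
    intro i k B hB hk
    have : x.P.part k = B := x.P.part_eq_of_mem hB hk
    subst this
    rfl
  refine ⟨toLex (fun p => g (ofLex p).1 (ofLex p).2), fun i => ⟨?_, fun k => hg i k⟩⟩
  intro k l hkl
  have hkl' : g i k = g i l := hkl
  have hp : x.P.part k = x.P.part l := by
    refine (x.part_w i (g i k)).unique ⟨part_mem' x k, hg i k⟩ ⟨part_mem' x l, ?_⟩
    rw [hkl']; exact hg i l
  rw [hval i k _ (part_mem' x k) ((mem_part_iff x k k).2 rfl),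
    hval i l _ (part_mem' x k) ((mem_part_iff x k l).2 hp)] at hkl'
  exact hinj i _ (part_mem' x k) k l ((mem_part_iff x k k).2 rfl) ((mem_part_iff x k l).2 hp) hkl'

theorem exists_min_inW (x : VPart n s) : ∃ f, InW x f ∧ ∀ g, InW x g → f ≤ g := by
  obtain ⟨f, hf, h⟩ := Set.exists_min_image {f | InW x f} id (Set.toFinite _) (exists_inW x)
  exact ⟨f, hf, h⟩

/-- the lexicographically least word below `x` -/
noncomputable def A (x : VPart n s) : Wd n s := (exists_min_inW x).choose

theorem inW_A (x : VPart n s) : InW x (A x) := (exists_min_inW x).choose_spec.1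
theorem A_le {x : VPart n s} {g : Wd n s} (h : InW x g) : A x ≤ g :=
  (exists_min_inW x).choose_spec.2 g h

theorem InW.image_eq {x : VPart n s} {f : Wd n s} (h : InW x f) (i : Fin s)
    {B : Finset (Fin n)} (hB : B ∈ x.P.parts) : B.image (ev f i) = x.w i B := by
  apply Finset.eq_of_subset_of_card_le
  · intro u hu
    obtain ⟨k, hk, rfl⟩ := Finset.mem_image.1 hu
    have := (h i).2 k
    rwa [x.P.part_eq_of_mem hB hk] at this
  · rw [Finset.card_image_of_injective _ (h i).1, x.card_w i B hB]

theorem InW.mem_iff {x : VPart n s} {f : Wd n s} (h : InW x f) (i : Fin s) (k l : Fin n) :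
    ev f i l ∈ x.w i (x.P.part k) ↔ R x k l := by
  rw [← h.image_eq i (part_mem' x k), Finset.mem_image, ← mem_part_iff]
  constructor
  · rintro ⟨m, hm, he⟩
    rwa [← (h i).1 he]
  · intro hl
    exact ⟨l, hl, rfl⟩

theorem le_iff {x y : VPart n s} {f : Wd n s} (h : InW x f) :
    x ≤ y ↔ (∀ k l, R x k l → R y k l) ∧ InW y f := by
  constructor
  · intro hxy
    have hR := P_le_iff.1 hxy.1
    refine ⟨hR, fun i => ⟨(h i).1, fun k => ?_⟩⟩
    refine hxy.2 i _ (part_mem' x k) _ (part_mem' y k) ?_ ((h i).2 k)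
    intro l hl
    exact (mem_part_iff y k l).2 (hR k l ((mem_part_iff x k l).1 hl))
  · rintro ⟨hR, hf⟩
    refine ⟨P_le_iff.2 hR, fun i B hB B' hB' hBB' => ?_⟩
    rw [← h.image_eq i hB, ← hf.image_eq i hB']
    exact Finset.image_subset_image hBB'

theorem InW.mono {x y : VPart n s} {f : Wd n s} (h : InW x f) (hxy : x ≤ y) : InW y f :=
  ((le_iff h).1 hxy).2

theorem R.mono {x y : VPart n s} {k l : Fin n} (h : R x k l) (hxy : x ≤ y) : R y k l :=
  P_le_iff.1 hxy.1 k l h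

theorem A_anti {x y : VPart n s} (h : x ≤ y) : A y ≤ A x := A_le ((inW_A x).mono h)

open Classical in
/-- the vector partition with underlying partition `r` and word `f` -/
noncomputable def mkS (f : Wd n s) (hf : ∀ i, Function.Injective (ev f i))
    (r : Setoid (Fin n)) : VPart n s where
  P := Finpartition.ofSetoid r
  w i B := if B ∈ (Finpartition.ofSetoid r).parts then B.image (ev f i) else ∅
  card_w i B hB := by
    rw [if_pos hB, Finset.card_image_of_injective _ (hf i)]
  part_w i u := by
    obtain ⟨k, rfl⟩ := (Finite.injective_iff_surjective.1 (hf i)) u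
    refine ⟨(Finpartition.ofSetoid r).part k, ⟨?_, ?_⟩, ?_⟩
    · exact (Finpartition.ofSetoid r).part_mem.2 (Finset.mem_univ _)
    · rw [if_pos ((Finpartition.ofSetoid r).part_mem.2 (Finset.mem_univ _))]
      exact Finset.mem_image_of_mem _ ((Finpartition.ofSetoid r).mem_part (Finset.mem_univ _))
    · rintro B ⟨hB, hk⟩
      rw [if_pos hB] at hk
      obtain ⟨l, hl, he⟩ := Finset.mem_image.1 hk
      rw [hf i he] at hl
      exact ((Finpartition.ofSetoid r).part_eq_of_mem hB hl).symm
  w_junk i B hB := if_neg hB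

theorem R_mkS (f : Wd n s) (hf) (r : Setoid (Fin n)) (k l : Fin n) :
    R (mkS f hf r) k l ↔ r k l := by
  classical
  rw [← mem_part_iff]
  exact Finpartition.mem_part_ofSetoid_iff_rel

theorem inW_mkS (f : Wd n s) (hf) (r : Setoid (Fin n)) : InW (mkS f hf r) f := by
  classical
  refine fun i => ⟨hf i, fun k => ?_⟩
  have h := part_mem' (mkS f hf r) k
  have : (mkS f hf r).w i ((mkS f hf r).P.part k) =
    ((mkS f hf r).P.part k).image (ev f i) := if_pos h
  rw [this]
  exact Finset.mem_image_of_mem _ ((mem_part_iff _ _ _).2 rfl)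

def mergeSetoid (x : VPart n s) (k l : Fin n) : Setoid (Fin n) where
  r a b := R x a b ∨ ((R x k a ∨ R x l a) ∧ (R x k b ∨ R x l b))
  iseqv := by
    refine ⟨fun a => Or.inl rfl, ?_, ?_⟩
    · rintro a b (h | h)
      · exact Or.inl h.symm
      · exact Or.inr ⟨h.2, h.1⟩
    · rintro a b c (h | ⟨h1, h2⟩) (h' | ⟨h1', h2'⟩)
      · exact Or.inl (h.trans h')
      · refine Or.inr ⟨?_, h2'⟩
        exact h1'.imp (fun t => t.trans h.symm) (fun t => t.trans h.symm)
      · refine Or.inr ⟨h1, ?_⟩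
        exact h2.imp (fun t => t.trans h') (fun t => t.trans h')
      · exact Or.inr ⟨h1, h2'⟩

noncomputable def merge (x : VPart n s) (k l : Fin n) : VPart n s :=
  mkS (A x) (fun i => (inW_A x i).1) (mergeSetoid x k l)

theorem R_merge {x : VPart n s} {k l a b : Fin n} : R (merge x k l) a b ↔
    R x a b ∨ ((R x k a ∨ R x l a) ∧ (R x k b ∨ R x l b)) := R_mkS _ _ _ _ _

theorem le_merge (x : VPart n s) (k l : Fin n) : x ≤ merge x k l :=
  (le_iff (inW_A x)).2 ⟨fun _ _ h => R_merge.2 (Or.inl h), inW_mkS _ _ _⟩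

theorem merge_le {x y : VPart n s} {k l : Fin n} (hxy : x ≤ y) (h : R y k l) :
    merge x k l ≤ y := by
  refine (le_iff (inW_mkS _ _ _)).2 ⟨?_, (inW_A x).mono hxy⟩
  intro a b hab
  rcases R_merge.1 hab with h1 | ⟨h1, h2⟩
  · exact h1.mono hxy
  · have ha : R y k a := by
      rcases h1 with h1 | h1
      · exact h1.mono hxy
      · exact h.trans (h1.mono hxy)
    have hb : R y k b := by
      rcases h2 with h1 | h1
      · exact h1.mono hxy
      · exact h.trans (h1.mono hxy)
    exact ha.symm.trans hb

theorem R_merge_self (x : VPart n s) (k l : Fin n) : R (merge x k l) k l :=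
  R_merge.2 (Or.inr ⟨Or.inl rfl, Or.inr rfl⟩)

theorem exists_R_of_lt {x y : VPart n s} (h : x < y) : ∃ k l, R y k l ∧ ¬ R x k l := by
  by_contra hcon
  push Not at hcon
  refine absurd ((le_iff ((inW_A x).mono h.le)).2 ⟨hcon, inW_A x⟩) (not_le_of_gt h)

theorem merge_covBy {x : VPart n s} {k l : Fin n} (h : ¬ R x k l) : x ⋖ merge x k l := by
  refine ⟨lt_of_le_of_ne (le_merge x k l) (fun e => h ?_), ?_⟩
  · rw [e]; exact R_merge_self x k l
  · intro z hxz hz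
    obtain ⟨a, b, h1, h2⟩ := exists_R_of_lt hxz
    have h3 := h1.mono hz.le
    rcases R_merge.1 h3 with h4 | ⟨h4, h5⟩
    · exact h2 h4
    have : R z k l := by
      rcases h4 with h4 | h4 <;> rcases h5 with h5 | h5
      · exact absurd (h4.symm.trans h5) h2
      · exact ((h4.mono hxz.le).trans h1).trans (h5.mono hxz.le).symm
      · exact ((h5.mono hxz.le).trans h1.symm).trans (h4.mono hxz.le).symm
      · exact absurd (h4.symm.trans h5) h2
    exact absurd (merge_le hxz.le this) (not_le_of_gt hz)

theorem covBy_eq_merge {x z : VPart n s} {k l : Fin n} (hz : x ⋖ z) (h : ¬ R x k l) :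
    z = merge x k l ↔ R z k l := by
  constructor
  · rintro rfl; exact R_merge_self x k l
  · intro hR
    have h1 := merge_le hz.le hR
    by_contra hne
    exact hz.2 (merge_covBy h).lt (lt_of_le_of_ne h1 (Ne.symm hne))

/-! ### block minima -/

open Classical in
/-- elements that are not the minimum of their block -/
noncomputable def N (x : VPart n s) : Finset (Fin n) :=
  Finset.univ.filter (fun k => ∃ l, R x k l ∧ l < k)

theorem mem_N {x : VPart n s} {k : Fin n} : k ∈ N x ↔ ∃ l, R x k l ∧ l < k := by
  classical
  simp [N]

theorem N_mono {x y : VPart n s} (h : x ≤ y) : N x ⊆ N y := by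
  intro k hk
  obtain ⟨l, h1, h2⟩ := mem_N.1 hk
  exact mem_N.2 ⟨l, h1.mono h, h2⟩

theorem exists_blockMin (x : VPart n s) (k : Fin n) : ∃ m, R x k m ∧ m ∉ N x ∧ m ≤ k := by
  obtain ⟨m, hm, h⟩ := Set.exists_min_image {m | R x k m} id (Set.toFinite _) ⟨k, rfl⟩
  refine ⟨m, hm, ?_, h k rfl⟩
  intro hN
  obtain ⟨l, h1, h2⟩ := mem_N.1 hN
  exact absurd (h l (R.trans hm h1)) (not_le_of_gt h2)

theorem blockMin_unique {x : VPart n s} {k l : Fin n} (h : R x k l) (hk : k ∉ N x)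
    (hl : l ∉ N x) : k = l := by
  rcases lt_trichotomy k l with h1 | h1 | h1
  · exact absurd (mem_N.2 ⟨k, h.symm, h1⟩) hl
  · exact h1
  · exact absurd (mem_N.2 ⟨l, h, h1⟩) hk

theorem N_merge {x : VPart n s} {k l : Fin n} (hk : k ∉ N x) (hl : l ∉ N x) (hkl : k < l) :
    N (merge x k l) = insert l (N x) := by
  ext a
  rw [Finset.mem_insert]
  constructor
  · intro ha
    obtain ⟨b, h1, h2⟩ := mem_N.1 ha
    by_contra hcon
    push Not at hcon
    obtain ⟨hal, haN⟩ := hcon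
    rcases R_merge.1 h1 with h3 | ⟨h3, h4⟩
    · exact haN (mem_N.2 ⟨b, h3, h2⟩)
    · rcases h3 with h3 | h3
      · have := blockMin_unique h3 hk haN
        subst this
        rcases h4 with h4 | h4
        · exact haN (mem_N.2 ⟨b, h4, h2⟩)
        · exact hl (mem_N.2 ⟨b, h4, h2.trans hkl⟩)
      · exact hal (blockMin_unique h3 hl haN).symm
  · rintro (rfl | ha)
    · exact mem_N.2 ⟨k, (R_merge_self x k a).symm, hkl⟩
    · exact N_mono (le_merge x k l) ha

theorem merge_comm' (x : VPart n s) (k l : Fin n) (h : ¬ R x k l) :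
    merge x k l = merge x l k :=
  (covBy_eq_merge (merge_covBy h) (fun h' => h h'.symm)).2 (R_merge_self x k l).symm

theorem N_covBy {x z : VPart n s} (h : x ⋖ z) : ∃ m, m ∉ N x ∧ N z = insert m (N x) := by
  obtain ⟨k, l, h1, h2⟩ := exists_R_of_lt h.lt
  obtain ⟨k', hk1, hk2, -⟩ := exists_blockMin x k
  obtain ⟨l', hl1, hl2, -⟩ := exists_blockMin x l
  have h3 : ¬ R x k' l' := fun h' => h2 ((hk1.trans h').trans hl1.symm)
  have h4 : R z k' l' := ((hk1.mono h.le).symm.trans h1).trans (hl1.mono h.le)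
  have h5 := (covBy_eq_merge h h3).2 h4
  rcases lt_trichotomy k' l' with h6 | h6 | h6
  · exact ⟨l', hl2, by rw [h5, N_merge hk2 hl2 h6]⟩
  · exact absurd (by rw [h6]; exact rfl) h3
  · exact ⟨k', hk2, by rw [h5, merge_comm' x k' l' h3, N_merge hl2 hk2 h6]⟩

theorem N_lt {x y : VPart n s} (h : x < y) : (N y \ N x).Nonempty := by
  obtain ⟨k, l, h1, h2⟩ := exists_R_of_lt h
  obtain ⟨m, h3, h4⟩ := N_covBy (merge_covBy h2)
  refine ⟨m, Finset.mem_sdiff.2 ⟨N_mono (merge_le h.le h1) ?_, h3⟩⟩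
  rw [h4]; exact Finset.mem_insert_self _ _

/-- step in an interval with constant word -/
theorem step_min {x y : VPart n s} (hxy : x < y) :
    ∃ c, x ⋖ c ∧ c ≤ y ∧ ∀ z, x ⋖ z → z ≤ y →
      (z = c ↔ (N y \ N x).min' (N_lt hxy) ∈ N z) := by
  set m := (N y \ N x).min' (N_lt hxy) with hm
  have hm1 : m ∈ N y \ N x := Finset.min'_mem _ _
  have hm2 : ∀ a ∈ N y \ N x, m ≤ a := fun a ha => Finset.min'_le _ _ ha
  rw [Finset.mem_sdiff] at hm1
  obtain ⟨m', h1, h2, h3⟩ := exists_blockMin y m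
  have hlt : m' < m := lt_of_le_of_ne h3 (by rintro h; rw [h] at h2; exact h2 hm1.1)
  have hR : ¬ R x m m' := fun h => hm1.2 (mem_N.2 ⟨m', h, hlt⟩)
  refine ⟨merge x m m', merge_covBy hR, merge_le hxy.le h1, ?_⟩
  intro z hz hzy
  rw [covBy_eq_merge hz hR]
  constructor
  · intro h; exact mem_N.2 ⟨m', h, hlt⟩
  · intro h
    obtain ⟨b, hb1, hb2, hb3⟩ := exists_blockMin z m
    have hbx : b ∉ N x := fun h => hb2 (N_mono hz.le h)
    have hbm : b < m := lt_of_le_of_ne hb3 (by rintro h'; rw [h'] at hb2; exact hb2 h)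
    have hby : b ∉ N y := fun h' =>
      absurd (hm2 b (Finset.mem_sdiff.2 ⟨h', hbx⟩)) (not_le_of_gt hbm)
    have : b = m' := blockMin_unique ((hb1.mono hzy).symm.trans h1) hby h2
    rw [← this]; exact hb1

/-! ### changing the word -/

def swapW (f : Wd n s) (i : Fin s) (k l : Fin n) : Wd n s :=
  toLex (fun p => if (ofLex p).1 = i then ev f i (Equiv.swap k l (ofLex p).2) else ofLex f p)

theorem ev_swapW (f : Wd n s) (i j : Fin s) (k l m : Fin n) :
    ev (swapW f i k l) j m = if j = i then ev f i (Equiv.swap k l m) else ev f j m := rfl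

theorem inW_swapW {x : VPart n s} {f : Wd n s} (hf : InW x f) (i : Fin s) {k l : Fin n}
    (h : R x k l) : InW x (swapW f i k l) := by
  intro j
  by_cases hj : j = i
  · subst hj
    have : ev (swapW f j k l) j = fun m => ev f j (Equiv.swap k l m) := by
      funext m; rw [ev_swapW, if_pos rfl]
    rw [this]
    refine ⟨fun a b hab => (Equiv.swap k l).injective ((hf j).1 hab), fun m => ?_⟩
    show ev f j (Equiv.swap k l m) ∈ _
    rw [hf.mem_iff]
    by_cases h1 : m = k
    · subst h1; rw [Equiv.swap_apply_left]; exact h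
    by_cases h2 : m = l
    · subst h2; rw [Equiv.swap_apply_right]; exact h.symm
    rw [Equiv.swap_apply_of_ne_of_ne h1 h2]
    exact rfl
  · have : ev (swapW f i k l) j = ev f j := by
      funext m; rw [ev_swapW, if_neg hj]
    rw [this]
    exact hf j

theorem step_word {x y : VPart n s} (hxy : x ≤ y) {p} (hp : FD (A x) (A y) p) :
    ∃ c, x ⋖ c ∧ c ≤ y ∧ ∀ z, x ⋖ z → z ≤ y →
      (z = c ↔ ofLex (A z) p = ofLex (A y) p) := by
  obtain ⟨i, k, rfl⟩ : ∃ i k, p = toLex (i, k) := ⟨(ofLex p).1, (ofLex p).2, rfl⟩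
  obtain ⟨l, hl⟩ := Finite.injective_iff_surjective.1 (inW_A x i).1 (ev (A y) i k)
  have hkl : k < l := by
    rcases lt_trichotomy l k with h | h | h
    · have h1 : ev (A x) i l = ev (A y) i l :=
        hp.1 (toLex (i, l)) (by simp [Prod.Lex.lt_iff, h])
      rw [h1] at hl
      exact absurd ((inW_A y i).1 hl) h.ne
    · subst h
      exact absurd hl hp.2
    · exact h
  have hiff : ∀ z, x ≤ z → z ≤ y →
      (R z k l ↔ ofLex (A z) (toLex (i, k)) = ofLex (A y) (toLex (i, k))) := by
    intro z hxz hzy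
    constructor
    · intro hR
      have hg := inW_swapW ((inW_A x).mono hxz) i hR
      refine (sandwich (A_anti hzy) (A_le hg) (toLex (i, k)) ?_ _ le_rfl).symm
      intro q hq
      obtain ⟨i', k', rfl⟩ : ∃ i k, q = toLex (i, k) := ⟨(ofLex q).1, (ofLex q).2, rfl⟩
      show _ = ev (swapW (A x) i k l) i' k'
      rw [ev_swapW]
      rcases hq.eq_or_lt with he | hlt
      · have he' : i' = i ∧ k' = k := by simpa using he
        obtain ⟨rfl, rfl⟩ := he'
        rw [if_pos rfl, Equiv.swap_apply_left, hl]
        rfl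
      · rw [← hp.1 _ hlt]
        split_ifs with hi
        · subst hi
          have hk' : k' < k := by simpa [Prod.Lex.lt_iff] using hlt
          rw [Equiv.swap_apply_of_ne_of_ne hk'.ne (hk'.trans hkl).ne]
          rfl
        · rfl
    · intro he
      have h1 := ((inW_A x).mono hxz i).2 l
      rw [hl] at h1
      have h2 : ev (A y) i k = ev (A z) i k := he.symm
      rw [h2, (inW_A z).mem_iff] at h1
      exact h1.symm
  have hnR : ¬ R x k l := fun h => hp.2 ((hiff x le_rfl hxy).1 h)
  have hyR : R y k l := (hiff y hxy le_rfl).2 rfl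
  refine ⟨merge x k l, merge_covBy hnR, merge_le hxy hyR, ?_⟩
  intro z hz hzy
  rw [covBy_eq_merge hz hnR, hiff z hz.le hzy]

/-! ### the labeling -/

open Classical in
noncomputable def mn (x z : VPart n s) : ℤ :=
  if h : (N z \ N x).Nonempty then (((N z \ N x).min' h : Fin n) : ℕ) else 0

open Classical in
noncomputable def labV (x z : VPart n s) : Lbl :=
  if h : ∃ p, FD (A x) (A z) p then
    toLex (-1, toLex (rk h.choose, ((ofLex (A z) h.choose : Fin n) : ℕ)))
  else toLex (1, toLex (mn x z, 0))

theorem labV_fd {x z : VPart n s} {p} (h : FD (A x) (A z) p) :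
    labV x z =
      (toLex ((-1 : ℤ), toLex (rk p, (((ofLex (A z) p : Fin n) : ℕ) : ℤ))) : Lbl) := by
  have h' : ∃ p, FD (A x) (A z) p := ⟨p, h⟩
  unfold labV
  rw [dif_pos h', h'.choose_spec.unique h]

theorem labV_eq {x z : VPart n s} (h : A x = A z) :
    labV x z = toLex (1, toLex (mn x z, 0)) := by
  unfold labV
  rw [dif_neg]
  rintro ⟨p, hp⟩
  exact hp.ne h

theorem exists_step {x y : VPart n s} (hxy : x < y) :
    ∃ c, x ⋖ c ∧ c ≤ y ∧
      (∀ p, FD (A x) (A y) p → ∀ z, x ⋖ z → z ≤ y →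
        (z = c ↔ ofLex (A z) p = ofLex (A y) p)) ∧
      (A x = A y → ∀ z, x ⋖ z → z ≤ y → (z = c ↔ (N y \ N x).min' (N_lt hxy) ∈ N z)) := by
  by_cases h : A x = A y
  · obtain ⟨c, h1, h2, h3⟩ := step_min hxy
    exact ⟨c, h1, h2, fun p hp => absurd h hp.ne, fun _ => h3⟩
  · obtain ⟨p, hp⟩ := FD.exists h
    obtain ⟨c, h1, h2, h3⟩ := step_word hxy.le hp
    refine ⟨c, h1, h2, fun q hq => ?_, fun h' => absurd h' h⟩
    rw [hq.unique hp]; exact h3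

open Classical in
noncomputable def stepV (x y : VPart n s) : VPart n s :=
  if h : x < y then (exists_step h).choose else y

theorem stepV_spec {x y : VPart n s} (hxy : x < y) :
    x ⋖ stepV x y ∧ stepV x y ≤ y ∧
      (∀ p, FD (A x) (A y) p → ∀ z, x ⋖ z → z ≤ y →
        (z = stepV x y ↔ ofLex (A z) p = ofLex (A y) p)) ∧
      (A x = A y → ∀ z, x ⋖ z → z ≤ y →
        (z = stepV x y ↔ (N y \ N x).min' (N_lt hxy) ∈ N z)) := by
  unfold stepV
  rw [dif_pos hxy]
  exact (exists_step hxy).choose_spec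

/-- facts about a word in an interval, before the first difference -/
theorem sandwich_before {x y z : VPart n s} {p} (hp : FD (A x) (A y) p) (hxz : x ≤ z) (hzy : z ≤ y) :
    ∀ q < p, ofLex (A y) q = ofLex (A z) q :=
  sandwich_lt (A_anti hzy) (A_anti hxz) p (fun q hq => (hp.1 q hq).symm)

theorem labV_step_fd {x y : VPart n s} (hxy : x < y) {p} (hp : FD (A x) (A y) p) :
    labV x (stepV x y) =
      (toLex ((-1 : ℤ), toLex (rk p, (((ofLex (A y) p : Fin n) : ℕ) : ℤ))) : Lbl) := by
  obtain ⟨h1, h2, h3, -⟩ := stepV_spec hxy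
  have h4 := (h3 p hp _ h1 h2).1 rfl
  have hfd : FD (A x) (A (stepV x y)) p := by
    refine ⟨fun q hq => ?_, ?_⟩
    · rw [hp.1 q hq, sandwich_before hp h1.le h2 q hq]
    · rw [h4]; exact hp.2
  rw [labV_fd hfd, h4]

theorem A_between {x y z : VPart n s} (h : A x = A y) (hxz : x ≤ z) (hzy : z ≤ y) :
    A z = A y := le_antisymm (h ▸ A_anti hxz) (A_anti hzy)

theorem mn_covBy {x z : VPart n s} (h : x ⋖ z) {m : Fin n} (h1 : m ∈ N z) (h2 : m ∉ N x) :
    mn x z = ((m : ℕ) : ℤ) := by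
  obtain ⟨a, h3, h4⟩ := N_covBy h
  have ha : ∀ b, b ∈ N z → b ∉ N x → b = a := by
    intro b hb hb'
    rw [h4, Finset.mem_insert] at hb
    exact hb.resolve_right hb'
  have hne : (N z \ N x).Nonempty := N_lt h.lt
  unfold mn
  rw [dif_pos hne]
  have := Finset.mem_sdiff.1 (Finset.min'_mem _ hne)
  rw [ha _ this.1 this.2, ha m h1 h2]

theorem labV_step_eq {x y : VPart n s} (hxy : x < y) (h : A x = A y) :
    labV x (stepV x y) =
      (toLex ((1 : ℤ), toLex (((((N y \ N x).min' (N_lt hxy) : Fin n) : ℕ) : ℤ), (0 : ℤ))) : Lbl) := by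
  obtain ⟨h1, h2, -, h3⟩ := stepV_spec hxy
  have h4 := (h3 h _ h1 h2).1 rfl
  have h5 := (Finset.mem_sdiff.1 (Finset.min'_mem _ (N_lt hxy))).2
  rw [labV_eq (h.trans (A_between h h1.le h2).symm), mn_covBy h1 h4 h5]

/-- the label of a non-distinguished edge exceeds the label of the distinguished edge -/
theorem labV_lt {x y z : VPart n s} (hz : x ⋖ z) (hzy : z ≤ y) (hne : z ≠ stepV x y) :
    labV x (stepV x y) < labV x z := by
  have hxy : x < y := hz.lt.trans_le hzy
  obtain ⟨h1, h2, h3, h3'⟩ := stepV_spec hxy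
  by_cases h : A x = A y
  · rw [labV_step_eq hxy h, labV_eq (h.trans (A_between h hz.le hzy).symm), lbl_lt]
    right
    refine ⟨rfl, Or.inl ?_⟩
    obtain ⟨m, hm1, hm2⟩ := N_covBy hz
    have hmz : m ∈ N z := by rw [hm2]; exact Finset.mem_insert_self _ _
    rw [mn_covBy hz hmz hm1]
    have hle := Finset.min'_le (N y \ N x) m (Finset.mem_sdiff.2 ⟨N_mono hzy hmz, hm1⟩)
    have hne' : (N y \ N x).min' (N_lt hxy) ≠ m := by
      intro he
      exact hne ((h3' h z hz hzy).2 (by rw [he]; exact hmz))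
    have := lt_of_le_of_ne hle hne'
    exact_mod_cast this
  · obtain ⟨p, hp⟩ := FD.exists h
    rw [labV_step_fd hxy hp]
    have hpre := sandwich_before hp hz.le hzy
    by_cases h4 : A x = A z
    · rw [labV_eq h4, lbl_lt]; left; norm_num
    · obtain ⟨q, hq⟩ := FD.exists h4
      rw [labV_fd hq, lbl_lt]
      right
      refine ⟨rfl, ?_⟩
      rcases lt_trichotomy q p with h5 | h5 | h5
      · exact absurd (by rw [hp.1 q h5, hpre q h5]) hq.2
      · subst h5
        right
        refine ⟨rfl, ?_⟩
        have h6 := lex_apply_le (A_anti hzy) hpre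
        have h7 : ofLex (A y) q ≠ ofLex (A z) q := fun he => hne ((h3 q hp z hz hzy).2 he.symm)
        have := lt_of_le_of_ne h6 h7
        exact_mod_cast this
      · left; exact rk_strictMono h5

theorem labV_incr_iff {x y z : VPart n s} (hz : x ⋖ z) (hzy : z < y) :
    labV x z < labV z (stepV z y) ↔ z = stepV x y := by
  have hxy : x < y := hz.lt.trans hzy
  obtain ⟨h1, h2, h3, h3'⟩ := stepV_spec hxy
  by_cases h : A x = A y
  · have hAz := A_between h hz.le hzy.le
    rw [labV_step_eq hzy hAz]
    constructor
    · intro hlt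
      by_contra hne
      have hm : (N y \ N x).min' (N_lt hxy) ∉ N z := fun h' => hne ((h3' h z hz hzy.le).2 h')
      have hmm := Finset.mem_sdiff.1 (Finset.min'_mem _ (N_lt hxy))
      have hle := Finset.min'_le (N y \ N z) _ (Finset.mem_sdiff.2 ⟨hmm.1, hm⟩)
      have hlt' := (labV_lt hz hzy.le hne).trans hlt
      rw [labV_step_eq hxy h, lbl_lt] at hlt'
      have hle' : ((((N y \ N z).min' (N_lt hzy) : Fin n) : ℕ) : ℤ) ≤
        (((N y \ N x).min' (N_lt hxy) : Fin n) : ℕ) := by exact_mod_cast hle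
      omega
    · intro he
      have hm := (h3' h z hz hzy.le).1 he
      have hmm := Finset.mem_sdiff.1 (Finset.min'_mem _ (N_lt hxy))
      rw [labV_eq (h.trans hAz.symm), mn_covBy hz hm hmm.2, lbl_lt]
      right
      refine ⟨rfl, Or.inl ?_⟩
      have hb := Finset.mem_sdiff.1 (Finset.min'_mem _ (N_lt hzy))
      have hle := Finset.min'_le (N y \ N x) _
        (Finset.mem_sdiff.2 ⟨hb.1, fun h' => hb.2 (N_mono hz.le h')⟩)
      have := lt_of_le_of_ne hle (fun he' => hb.2 (he' ▸ hm))
      exact_mod_cast this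
  · obtain ⟨p, hp⟩ := FD.exists h
    have hpre := sandwich_before hp hz.le hzy.le
    have hxz : ∀ q < p, ofLex (A x) q = ofLex (A z) q := fun q hq => by
      rw [hp.1 q hq, hpre q hq]
    constructor
    · intro hlt
      by_contra hne
      have h7 : ofLex (A z) p ≠ ofLex (A y) p := fun he => hne ((h3 p hp z hz hzy.le).2 he)
      have hfd : FD (A z) (A y) p := ⟨fun q hq => (hpre q hq).symm, h7⟩
      have hlt' := (labV_lt hz hzy.le hne).trans hlt
      rw [labV_step_fd hzy hfd, labV_step_fd hxy hp] at hlt'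
      exact lt_irrefl _ hlt'
    · intro he
      have h7 := (h3 p hp z hz hzy.le).1 he
      have hfd : FD (A x) (A z) p := ⟨hxz, by rw [h7]; exact hp.2⟩
      rw [labV_fd hfd]
      by_cases h8 : A z = A y
      · rw [labV_step_eq hzy h8, lbl_lt]; left; norm_num
      · obtain ⟨q, hq⟩ := FD.exists h8
        rw [labV_step_fd hzy hq, lbl_lt]
        right
        refine ⟨rfl, Or.inl (rk_strictMono ?_)⟩
        rcases lt_trichotomy q p with h5 | h5 | h5
        · exact absurd (hpre q h5).symm hq.2
        · subst h5; exact absurd h7 hq.2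
        · exact h5

/-! ### atoms, the top element and finiteness -/

noncomputable def atom (y : VPart n s) : VPart n s :=
  mkS (A y) (fun i => (inW_A y i).1) ⊥

theorem R_atom {y : VPart n s} {k l : Fin n} : R (atom y) k l ↔ k = l := R_mkS _ _ _ _ _

theorem atom_le (y : VPart n s) : atom y ≤ y := by
  refine (le_iff (inW_mkS _ _ _)).2 ⟨?_, inW_A y⟩
  intro k l h
  rw [R_atom.1 h]; exact rfl

theorem inW_atom {y : VPart n s} {g : Wd n s} (h : InW (atom y) g) : g = A y := by
  have h1 : InW (atom y) (A y) := inW_mkS _ _ _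
  have : ofLex g = ofLex (A y) := by
    funext p
    obtain ⟨i, k, rfl⟩ : ∃ i k, p = toLex (i, k) := ⟨(ofLex p).1, (ofLex p).2, rfl⟩
    have h2 := (h i).2 k
    rw [← h1.image_eq i (part_mem' _ k)] at h2
    obtain ⟨l, hl, he⟩ := Finset.mem_image.1 h2
    rw [mem_part_iff, R_atom] at hl
    subst hl
    exact he.symm
  exact this

theorem A_atom (y : VPart n s) : A (atom y) = A y := inW_atom (inW_A _)

theorem isMin_atom (y : VPart n s) : IsMin (atom y) := by
  intro z hz
  have h1 := inW_atom ((inW_A z).mono hz)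
  refine (le_iff (inW_mkS _ _ _)).2 ⟨?_, h1 ▸ inW_A z⟩
  intro k l h
  rw [R_atom.1 h]; exact rfl

theorem eq_atom_of_isMin {z : VPart n s} (h : IsMin z) : z = atom z :=
  le_antisymm (h (atom_le z)) (atom_le z)

theorem atom_congr {y z : VPart n s} (h : A y = A z) : atom y = atom z := by
  unfold atom
  congr

theorem N_isMin {z : VPart n s} (h : IsMin z) : N z = ∅ := by
  rw [Finset.eq_empty_iff_forall_notMem]
  intro k hk
  obtain ⟨l, h1, h2⟩ := mem_N.1 hk
  rw [eq_atom_of_isMin h, R_atom] at h1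
  exact h2.ne h1.symm

instance : Finite (VPart n s) :=
  Finite.of_injective (fun x : VPart n s => (x.P, x.w)) (fun x y h => by
    simp only [Prod.mk.injEq] at h
    exact ext' h.1 h.2)

noncomputable def topV (n s : ℕ) : VPart n s :=
  mkS (toLex (fun p => (ofLex p).2)) (fun _ _ _ h => h) ⊤

theorem le_topV (x : VPart n s) : x ≤ topV n s := by
  have hR : ∀ k l, R (topV n s) k l := fun k l => (R_mkS _ _ _ _ _).2 trivial
  refine (le_iff (inW_A x)).2 ⟨fun k l _ => hR k l, fun i => ⟨(inW_A x i).1, fun k => ?_⟩⟩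
  have h1 : InW (topV n s) (toLex (fun p => (ofLex p).2)) := inW_mkS _ _ _
  exact (h1.mem_iff i k (ev (A x) i k)).2 (hR _ _)

/-! ### the labeling of the poset with bottom -/

noncomputable def labB (x z : WithBot (VPart n s)) : Lbl :=
  WithBot.recBotCoe (C := fun _ => Lbl)
    (WithBot.recBotCoe (C := fun _ => Lbl) (toLex (0, toLex (0, 0)))
      (fun z => toLex (0, toLex (rk (A z), 0))) z)
    (fun x => WithBot.recBotCoe (C := fun _ => Lbl) (toLex (0, toLex (0, 0)))
      (fun z => labV x z) z) x

noncomputable def stepB (x y : WithBot (VPart n s)) : WithBot (VPart n s) :=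
  WithBot.recBotCoe (C := fun _ => WithBot (VPart n s)) ⊥
    (fun y => WithBot.recBotCoe (C := fun _ => WithBot (VPart n s))
      ((atom y : VPart n s) : WithBot (VPart n s))
      (fun x => ((stepV x y : VPart n s) : WithBot (VPart n s))) x) y

theorem labB_bot (z : VPart n s) :
    labB ⊥ (z : WithBot (VPart n s)) = toLex (0, toLex (rk (A z), 0)) := rfl
theorem labB_coe (x z : VPart n s) :
    labB (x : WithBot (VPart n s)) (z : WithBot (VPart n s)) = labV x z := rfl
theorem stepB_bot (y : VPart n s) :
    stepB ⊥ (y : WithBot (VPart n s)) = ((atom y : VPart n s) : WithBot (VPart n s)) := rfl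
theorem stepB_coe (x y : VPart n s) :
    stepB (x : WithBot (VPart n s)) (y : WithBot (VPart n s)) =
      ((stepV x y : VPart n s) : WithBot (VPart n s)) := rfl

noncomputable def htB (x : WithBot (VPart n s)) : ℕ :=
  WithBot.recBotCoe (C := fun _ => ℕ) 0 (fun x => (N x).card + 1) x

theorem htB_covBy (a b : WithBot (VPart n s)) (h : a ⋖ b) : htB b = htB a + 1 := by
  induction b using WithBot.recBotCoe with
  | bot => exact absurd h.lt not_lt_bot
  | coe b =>
  induction a using WithBot.recBotCoe with
  | bot =>
    have := N_isMin (WithBot.bot_covBy_coe.1 h)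
    show (N b).card + 1 = 0 + 1
    rw [this]; rfl
  | coe a =>
    obtain ⟨m, h1, h2⟩ := N_covBy (WithBot.coe_covBy_coe.1 h)
    show (N b).card + 1 = (N a).card + 1 + 1
    rw [h2, Finset.card_insert_of_notMem h1]

theorem isEL_labB : IsEL (labB (n := n) (s := s)) := by
  intro x y hxy
  have := el_of_local (labB (n := n) (s := s)) stepB ?_ ?_ ?_ x y hxy
  · obtain ⟨L, h1, h2, h3, h4, -⟩ := this
    exact ⟨L, h1, h2, h3, h4⟩
  · intro x y hxy
    induction y using WithBot.recBotCoe with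
    | bot => exact absurd hxy not_lt_bot
    | coe y =>
    induction x using WithBot.recBotCoe with
    | bot =>
      rw [stepB_bot]
      exact ⟨WithBot.bot_covBy_coe.2 (isMin_atom y), WithBot.coe_le_coe.2 (atom_le y)⟩
    | coe x =>
      rw [stepB_coe]
      obtain ⟨h1, h2, -⟩ := stepV_spec (WithBot.coe_lt_coe.1 hxy)
      exact ⟨WithBot.coe_covBy_coe.2 h1, WithBot.coe_le_coe.2 h2⟩
  · intro x y z hz hzy hne
    induction z using WithBot.recBotCoe with
    | bot => exact absurd hz.lt not_lt_bot
    | coe z =>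
    induction y using WithBot.recBotCoe with
    | bot => exact absurd (hz.lt.trans_le hzy) not_lt_bot
    | coe y =>
    have hzy' := WithBot.coe_le_coe.1 hzy
    induction x using WithBot.recBotCoe with
    | bot =>
      have hmin := WithBot.bot_covBy_coe.1 hz
      rw [stepB_bot] at hne ⊢
      rw [labB_bot, labB_bot, A_atom, lbl_lt]
      right
      refine ⟨rfl, Or.inl (rk_strictMono (lt_of_le_of_ne (A_anti hzy') ?_))⟩
      intro he
      apply hne
      rw [atom_congr he, ← eq_atom_of_isMin hmin]
    | coe x =>
      rw [stepB_coe] at hne ⊢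
      rw [labB_coe, labB_coe]
      exact labV_lt (WithBot.coe_covBy_coe.1 hz) hzy' (fun h => hne (by rw [h]))
  · intro x y z hz hzy
    induction z using WithBot.recBotCoe with
    | bot => exact absurd hz.lt not_lt_bot
    | coe z =>
    induction y using WithBot.recBotCoe with
    | bot => exact absurd hzy not_lt_bot
    | coe y =>
    have hzy' := WithBot.coe_lt_coe.1 hzy
    induction x using WithBot.recBotCoe with
    | bot =>
      have hmin := WithBot.bot_covBy_coe.1 hz
      rw [stepB_coe, stepB_bot, labB_bot, labB_coe, WithBot.coe_inj]
      by_cases h : A z = A y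
      · rw [labV_step_eq hzy' h, lbl_lt]
        constructor
        · intro _
          rw [eq_atom_of_isMin hmin]; exact atom_congr h
        · intro _; left; norm_num
      · obtain ⟨p, hp⟩ := FD.exists h
        rw [labV_step_fd hzy' hp, lbl_lt]
        constructor
        · intro h'; omega
        · intro h'
          exact absurd (by rw [h', A_atom]) h
    | coe x =>
      rw [stepB_coe, stepB_coe, labB_coe, labB_coe, WithBot.coe_inj]
      exact labV_incr_iff (WithBot.coe_covBy_coe.1 hz) hzy'

end VPart

/-- `Π_{n,s+1}` admits an EL-labeling; in particular its order complex
is shellable (there is a shelling order of its maximal chains). -/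
theorem statement6 (n s : ℕ) :
    (∃ lab : WithBot (VPart n s) -> WithBot (VPart n s) -> Lbl,
      ∀ x y : WithBot (VPart n s), x ≤ y ->
        ∃ L, CoverChain x y L ∧ (labelWord lab L).Chain' (fun a b => a < b) ∧
          (∀ M, CoverChain x y M -> (labelWord lab M).Chain' (fun a b => a < b) -> M = L) ∧
          (∀ M, CoverChain x y M -> M ≠ L ->
            List.Lex (fun a b => a < b) (labelWord lab L) (labelWord lab M))) ∧
    ∃ (t : ℕ) (F : Fin t -> Finset (WithBot (VPart n s))),
      (∀ i, IsMaxChain (fun a b => a ≤ b) (F i : Set (WithBot (VPart n s)))) ∧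
      (∀ S : Finset (WithBot (VPart n s)),
        IsMaxChain (fun a b => a ≤ b) (S : Set (WithBot (VPart n s))) -> ∃ i, F i = S) ∧
      Function.Injective F ∧ IsShelling F := by
  letI : OrderTop (VPart n s) := { top := VPart.topV n s, le_top := VPart.le_topV }
  exact ⟨⟨VPart.labB, VPart.isEL_labB⟩, shelling_of_el VPart.isEL_labB VPart.htB_covBy⟩
end

section
/- The order complex of the proper part of Π_{n,s+1} (the poset of vector partitions of [n] into s+1 components with 0̂ and the top element removed) is homotopy equivalent to a wedge of spheres, all of dimension n−2. -/
open Finset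

/-- the faces of the order complex of a poset: the finite chains -/
def orderComplex (A : Type*) [Preorder A] : Set (Finset A) :=
  {F | IsChain (fun a b => a ≤ b) (F : Set A)}

/-- the geometric realization of an abstract simplicial complex `K` on vertex set `V` -/
def realization {V : Type*} (K : Set (Finset V)) : Type _ :=
  {f : V -> ℝ // (∀ v, 0 ≤ f v) ∧
    ∃ F ∈ K, (∀ v, f v ≠ 0 ↔ v ∈ F) ∧ ∑ v ∈ F, f v = 1}

instance {V : Type*} (K : Set (Finset V)) : TopologicalSpace (realization K) :=
  instTopologicalSpaceSubtype

/-- the `m`-sphere -/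
abbrev Sph (m : ℕ) := Metric.sphere (0 : EuclideanSpace ℝ (Fin (m + 1))) 1

noncomputable def basePt (m : ℕ) : Sph m :=
  ⟨EuclideanSpace.single 0 1, by simp⟩

/-- `p` is a point to be identified to the wedge base point -/
def isBase {N m : ℕ} : Unit ⊕ (Fin N × Sph m) -> Prop
  | .inl _ => True
  | .inr x => x.2 = basePt m

def wedgeSetoid (N m : ℕ) : Setoid (Unit ⊕ (Fin N × Sph m)) where
  r p q := p = q ∨ (isBase p ∧ isBase q)
  iseqv := ⟨fun _ => Or.inl rfl,
    fun h => by rcases h with h | h; exact Or.inl h.symm; exact Or.inr ⟨h.2, h.1⟩,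
    fun h h' => by
      rcases h with rfl | h
      · exact h'
      · rcases h' with rfl | h'
        · exact Or.inr h
        · exact Or.inr ⟨h.1, h'.2⟩⟩

/-- the wedge of `N` spheres of dimension `m` (a single point when `N = 0`) -/
def Wedge (N m : ℕ) : Type := Quotient (wedgeSetoid N m)

noncomputable instance (N m : ℕ) : TopologicalSpace (Wedge N m) := instTopologicalSpaceQuotient

section Topo

set_option linter.unusedSectionVars false

variable {V : Type*} [Fintype V] [DecidableEq V]

/-- the support of a function, as a finset -/
noncomputable def fsupp (f : V → ℝ) : Finset V := by
  classical exact Finset.univ.filter (fun v => f v ≠ 0)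

theorem mem_fsupp {f : V → ℝ} {v : V} : v ∈ fsupp f ↔ f v ≠ 0 := by
  simp [fsupp]

theorem realization_iff (K : Set (Finset V)) (f : V → ℝ) :
    ((∀ v, 0 ≤ f v) ∧ ∃ F ∈ K, (∀ v, f v ≠ 0 ↔ v ∈ F) ∧ ∑ v ∈ F, f v = 1) ↔
    ((∀ v, 0 ≤ f v) ∧ fsupp f ∈ K ∧ ∑ v, f v = 1) := by
  constructor
  · rintro ⟨h0, F, hF, hs, h1⟩
    have : fsupp f = F := by ext v; rw [mem_fsupp, hs]
    refine ⟨h0, this ▸ hF, ?_⟩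
    rw [← h1]
    symm
    apply Finset.sum_subset (Finset.subset_univ _)
    intro v _ hv
    by_contra h
    exact hv ((hs v).1 h)
  · rintro ⟨h0, hF, h1⟩
    refine ⟨h0, _, hF, fun v => mem_fsupp.symm, ?_⟩
    rw [← h1]
    apply Finset.sum_subset (Finset.subset_univ _)
    intro v _ hv
    by_contra h
    exact hv (mem_fsupp.2 h)

/-- construct a point of the realization -/
def mkR (K : Set (Finset V)) (f : V → ℝ) (h0 : ∀ v, 0 ≤ f v) (hs : fsupp f ∈ K)
    (h1 : ∑ v, f v = 1) : realization K :=
  ⟨f, (realization_iff K f).2 ⟨h0, hs, h1⟩⟩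

theorem realization.nonneg {K : Set (Finset V)} (f : realization K) (v : V) : 0 ≤ f.1 v :=
  f.2.1 v
theorem realization.supp {K : Set (Finset V)} (f : realization K) : fsupp f.1 ∈ K :=
  ((realization_iff K f.1).1 f.2).2.1
theorem realization.sum {K : Set (Finset V)} (f : realization K) : ∑ v, f.1 v = 1 :=
  ((realization_iff K f.1).1 f.2).2.2

/-- closed under taking faces -/
def DownCl (K : Set (Finset V)) : Prop := ∀ σ ∈ K, ∀ τ, τ ⊆ σ → τ ∈ K

/-- one elementary collapse (the empty face is allowed as the free face) -/
def CStep (K L : Set (Finset V)) : Prop :=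
  ∃ (σ : Finset V) (v : V), v ∉ σ ∧ σ ∈ K ∧ insert v σ ∈ K ∧
    (∀ τ ∈ K, σ ⊆ τ → τ = σ ∨ τ = insert v σ) ∧ L = K \ {σ, insert v σ}

def Coll (K L : Set (Finset V)) : Prop := Relation.ReflTransGen CStep K L

theorem CStep.downCl {K L : Set (Finset V)} (h : CStep K L) (hK : DownCl K) : DownCl L := by
  obtain ⟨σ, v, hv, hσ, hvσ, hfree, rfl⟩ := h
  intro τ hτ ρ hρ
  refine ⟨hK τ hτ.1 ρ hρ, ?_⟩
  rintro (h | h)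
  · subst h
    exact hτ.2 (hfree τ hτ.1 hρ)
  · have h' : ρ = insert v σ := h
    subst h'
    exact hτ.2 (hfree τ hτ.1 ((Finset.subset_insert _ _).trans hρ))

/-- pointwise minimum over a finset -/
noncomputable def fmin (σ : Finset V) (hσ : σ.Nonempty) (f : V → ℝ) : ℝ := σ.inf' hσ f

theorem continuous_fmin (σ : Finset V) (hσ : σ.Nonempty) : Continuous (fmin σ hσ) := by
  unfold fmin
  apply Continuous.finset_inf'_apply
  intro i _
  exact continuous_apply i

/-- The collapsing map at time `t`. -/
noncomputable def cmap (σ : Finset V) (hσ : σ.Nonempty) (v : V) (t : ℝ) (f : V → ℝ) : V → ℝ :=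
  fun u => f u + t * fmin σ hσ f * ((if u = v then (σ.card : ℝ) else 0) - (if u ∈ σ then 1 else 0))

theorem cmap_props {K : Set (Finset V)} (hK : DownCl K) {σ : Finset V} (hσ : σ.Nonempty) {v : V}
    (hv : v ∉ σ) (hvσ : insert v σ ∈ K)
    (hfree : ∀ τ ∈ K, σ ⊆ τ → τ = σ ∨ τ = insert v σ)
    (f : realization K) (t : ℝ) (ht0 : 0 ≤ t) (ht1 : t ≤ 1) :
    (∀ u, 0 ≤ cmap σ hσ v t f.1 u) ∧ fsupp (cmap σ hσ v t f.1) ∈ K ∧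
      ∑ u, cmap σ hσ v t f.1 u = 1 := by
  have hm0 : 0 ≤ fmin σ hσ f.1 := Finset.le_inf' _ _ (fun u _ => f.nonneg u)
  have hmle : ∀ u ∈ σ, fmin σ hσ f.1 ≤ f.1 u := fun u hu => Finset.inf'_le _ hu
  refine ⟨?_, ?_, ?_⟩
  · intro u
    unfold cmap
    have h1 := f.nonneg u
    by_cases hu : u ∈ σ
    · have huv : u ≠ v := by rintro rfl; exact hv hu
      have := hmle u hu
      simp only [huv, hu, if_true, if_false]
      nlinarith
    · simp only [hu, if_false, sub_zero]
      split_ifs <;> positivity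
  · by_cases h0 : fmin σ hσ f.1 = 0
    · have : cmap σ hσ v t f.1 = f.1 := by
        funext u; simp [cmap, h0]
      rw [this]; exact f.supp
    · have hpos : 0 < fmin σ hσ f.1 := lt_of_le_of_ne hm0 (Ne.symm h0)
      have hsub : σ ⊆ fsupp f.1 := by
        intro u hu
        rw [mem_fsupp]
        exact (lt_of_lt_of_le hpos (hmle u hu)).ne'
      apply hK _ hvσ
      intro u hu
      rw [mem_fsupp] at hu
      by_contra hc
      rw [Finset.mem_insert, not_or] at hc
      apply hu
      have hfu : f.1 u = 0 := by
        by_contra h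
        have h2 : u ∈ fsupp f.1 := mem_fsupp.2 h
        rcases hfree _ f.supp hsub with h3 | h3
        · rw [h3] at h2; exact hc.2 h2
        · rw [h3, Finset.mem_insert] at h2; exact h2.elim hc.1 hc.2
      simp [cmap, hc.1, hc.2, hfu]
  · unfold cmap
    rw [Finset.sum_add_distrib, f.sum, ← Finset.mul_sum, Finset.sum_sub_distrib]
    simp

theorem cmap_one_supp {K : Set (Finset V)} {σ : Finset V} (hσ : σ.Nonempty) {v : V}
    (hv : v ∉ σ)
    (f : realization K) :
    ¬ (σ ⊆ fsupp (cmap σ hσ v 1 f.1)) := by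
  intro hsub
  obtain ⟨u, hu, hmu⟩ := Finset.exists_mem_eq_inf' hσ f.1
  have h := hsub hu
  rw [mem_fsupp] at h
  apply h
  have huv : u ≠ v := by rintro rfl; exact hv hu
  have hmu' : fmin σ hσ f.1 = f.1 u := hmu
  simp [cmap, huv, hu, hmu']

theorem cmap_eq_self (σ : Finset V) (hσ : σ.Nonempty) (v : V) (t : ℝ) (f : V → ℝ)
    (h : fmin σ hσ f = 0) : cmap σ hσ v t f = f := by
  funext u; simp [cmap, h]

theorem continuous_cmap (σ : Finset V) (hσ : σ.Nonempty) (v : V) :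
    Continuous (fun p : ℝ × (V → ℝ) => cmap σ hσ v p.1 p.2) := by
  apply continuous_pi
  intro u
  have := continuous_fmin σ hσ
  unfold cmap
  fun_prop

theorem continuous_val (K : Set (Finset V)) : Continuous (fun f : realization K => f.1) :=
  continuous_subtype_val

theorem CStep.homotopyEquiv {K L : Set (Finset V)} (hK : DownCl K) {σ : Finset V}
    (hσ : σ.Nonempty) {v : V}
    (hv : v ∉ σ) (hvσ : insert v σ ∈ K)
    (hfree : ∀ τ ∈ K, σ ⊆ τ → τ = σ ∨ τ = insert v σ) (hL : L = K \ {σ, insert v σ}) :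
    Nonempty (ContinuousMap.HomotopyEquiv (realization K) (realization L)) := by
  have hLmem : ∀ τ ∈ K, ¬ σ ⊆ τ → τ ∈ L := by
    intro τ hτ hn
    rw [hL]
    refine ⟨hτ, ?_⟩
    rintro (h | h)
    · exact hn (h ▸ subset_rfl)
    · have h' : τ = insert v σ := h
      exact hn (h' ▸ Finset.subset_insert _ _)
  have hLsub : ∀ τ ∈ L, τ ∈ K ∧ ¬ (τ = σ ∨ τ = insert v σ) := by
    intro τ hτ
    rw [hL] at hτ
    exact hτ
  let r : C(realization K, realization L) :=
    ⟨fun f => mkR L (cmap σ hσ v 1 f.1)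
      (cmap_props hK hσ hv hvσ hfree f 1 zero_le_one le_rfl).1
      (hLmem _ (cmap_props hK hσ hv hvσ hfree f 1 zero_le_one le_rfl).2.1 (cmap_one_supp hσ hv f))
      (cmap_props hK hσ hv hvσ hfree f 1 zero_le_one le_rfl).2.2, by
      apply Continuous.subtype_mk
      exact (continuous_cmap σ hσ v).comp (continuous_const.prodMk (continuous_val K))⟩
  let i : C(realization L, realization K) :=
    ⟨fun f => mkR K f.1 f.nonneg (hLsub _ f.supp).1 f.sum, by
      apply Continuous.subtype_mk
      exact continuous_val L⟩
  refine ⟨⟨r, i, ?_, ?_⟩⟩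
  · symm
    refine ⟨⟨fun p => mkR K (cmap σ hσ v p.1 p.2.1)
      (cmap_props hK hσ hv hvσ hfree p.2 p.1 p.1.2.1 p.1.2.2).1
      (cmap_props hK hσ hv hvσ hfree p.2 p.1 p.1.2.1 p.1.2.2).2.1
      (cmap_props hK hσ hv hvσ hfree p.2 p.1 p.1.2.1 p.1.2.2).2.2, ?_⟩, ?_, ?_⟩
    · apply Continuous.subtype_mk
      exact (continuous_cmap σ hσ v).comp
        ((continuous_subtype_val.comp continuous_fst).prodMk
          ((continuous_val K).comp continuous_snd))
    · intro f
      apply Subtype.ext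
      funext u
      simp [mkR, cmap]
    · intro f
      rfl
  · have : r.comp i = ContinuousMap.id _ := by
      ext f
      apply Subtype.ext
      apply cmap_eq_self
      by_contra h
      have h2 := f.supp
      have hm0 : 0 ≤ fmin σ hσ f.1 := Finset.le_inf' _ _ (fun u _ => f.nonneg u)
      have hpos : 0 < fmin σ hσ f.1 := lt_of_le_of_ne hm0 (Ne.symm h)
      have hsub : σ ⊆ fsupp f.1 := by
        intro u hu
        rw [mem_fsupp]
        exact (lt_of_lt_of_le hpos (Finset.inf'_le _ hu)).ne'
      exact (hLsub _ h2).2 (hfree _ (hLsub _ h2).1 hsub)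
    rw [this]

/-- A complex that collapses to nothing is contractible. -/
theorem Coll.contractible {K : Set (Finset V)} (h : Coll K ∅) (hK : DownCl K)
    (hne : ∅ ∈ K) : ContractibleSpace (realization K) := by
  unfold Coll at h
  induction h using Relation.ReflTransGen.head_induction_on with
  | refl => exact absurd hne (Set.notMem_empty _)
  | @head K L hstep _ ih =>
    have hL := hstep.downCl hK
    obtain ⟨σ, v, hv, hσ, hvσ, hfree, hLe⟩ := hstep
    rcases σ.eq_empty_or_nonempty with rfl | hne'
    · -- a point
      have hsupp : ∀ f : realization K, f.1 = Pi.single v 1 := by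
        intro f
        have h1 : fsupp f.1 ⊆ {v} := by
          rcases hfree _ f.supp (Finset.empty_subset _) with h | h <;> rw [h] <;> simp
        have h2 : ∀ u, u ≠ v → f.1 u = 0 := by
          intro u hu
          by_contra h
          exact hu (Finset.mem_singleton.1 (h1 (mem_fsupp.2 h)))
        have h3 : f.1 v = 1 := by
          refine Eq.trans ?_ f.sum
          symm
          apply Finset.sum_eq_single
          · intro u _ hu; exact h2 u hu
          · simp
        funext u
        by_cases hu : u = v
        · subst hu; simp [h3]
        · simp [hu, h2 u hu]
      have : Subsingleton (realization K) :=
        ⟨fun f g => Subtype.ext ((hsupp f).trans (hsupp g).symm)⟩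
      have hn : Nonempty (realization K) := by
        refine ⟨mkR K (Pi.single v 1) ?_ ?_ ?_⟩
        · intro u
          by_cases hu : u = v
          · subst hu; simp
          · simp [hu]
        · convert hvσ using 1
          ext u
          rw [mem_fsupp]
          by_cases hu : u = v
          · subst hu; simp
          · simp [hu]
        · simp
      obtain ⟨x⟩ := hn
      have : Unique (realization K) := ⟨⟨x⟩, fun y => Subsingleton.elim _ _⟩
      infer_instance
    · have hLne : ∅ ∈ L := by
        rw [hLe]
        refine ⟨hne, ?_⟩
        rintro (h | h)
        · exact hne'.ne_empty h.symm
        · have h' : ∅ = insert v σ := h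
          exact (Finset.insert_ne_empty v σ) h'.symm
      have := ih hL hLne
      obtain ⟨e⟩ := CStep.homotopyEquiv hK hne' hv hvσ hfree hLe
      exact e.contractibleSpace

end Topo
section Comb

set_option linter.unusedSectionVars false

variable {V : Type*} [Fintype V] [DecidableEq V]

theorem Coll.trans {K L M : Set (Finset V)} (h1 : Coll K L) (h2 : Coll L M) : Coll K M :=
  Relation.ReflTransGen.trans h1 h2

/-- If `K \ L` is closed under toggling `u`, then `K` collapses to `L`. -/
theorem coll_of_toggle (u : V) (L : Set (Finset V)) (hL : DownCl L) :
    ∀ (N : ℕ) (K : Set (Finset V)), (K \ L).ncard ≤ N → L ⊆ K →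
      (∀ σ ∈ K \ L, insert u σ ∈ K \ L ∧ σ.erase u ∈ K \ L) → Coll K L := by
  intro N
  induction N with
  | zero =>
    intro K hN hLK _
    have : K \ L = ∅ := (Set.ncard_eq_zero (Set.toFinite _)).1 (Nat.le_zero.1 hN)
    have : K = L := subset_antisymm (Set.sdiff_eq_empty.1 this) hLK
    rw [this]
    exact Relation.ReflTransGen.refl
  | succ N ih =>
    intro K hN hLK htog
    rcases (K \ L).eq_empty_or_nonempty with h | hne
    · have : K = L := subset_antisymm (Set.sdiff_eq_empty.1 h) hLK
      rw [this]
      exact Relation.ReflTransGen.refl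
    · obtain ⟨σ, hσ, hmax⟩ := Set.exists_max_image (K \ L) Finset.card (Set.toFinite _) hne
      have huσ : u ∈ σ := by
        by_contra h
        have := hmax _ (htog σ hσ).1
        rw [Finset.card_insert_of_notMem h] at this
        omega
      have hσ' := (htog σ hσ).2
      have hins : insert u (σ.erase u) = σ := Finset.insert_erase huσ
      have hfree : ∀ τ ∈ K, σ.erase u ⊆ τ → τ = σ.erase u ∨ τ = insert u (σ.erase u) := by
        intro τ hτ hsub
        have hτL : τ ∈ K \ L := ⟨hτ, fun h => hσ'.2 (hL τ h _ hsub)⟩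
        have h1 := hmax _ (htog τ hτL).1
        have h2 : σ ⊆ insert u τ := by
          rw [← hins]; exact Finset.insert_subset_insert u hsub
        have h3 : σ = insert u τ := Finset.eq_of_subset_of_card_le h2 h1
        by_cases hu : u ∈ τ
        · right
          rw [hins, h3, Finset.insert_eq_of_mem hu]
        · left
          rw [h3, Finset.erase_insert hu]
      have hstep : CStep K (K \ {σ.erase u, insert u (σ.erase u)}) :=
        ⟨σ.erase u, u, Finset.notMem_erase u σ, hσ'.1, by rw [hins]; exact hσ.1, hfree, rfl⟩
      refine Relation.ReflTransGen.head hstep (ih _ ?_ ?_ ?_)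
      · rw [hins]
        have hlt : ((K \ {σ.erase u, σ}) \ L).ncard < (K \ L).ncard := by
          apply Set.ncard_lt_ncard _ (Set.toFinite _)
          refine ⟨fun x hx => ⟨hx.1.1, hx.2⟩, fun h => ?_⟩
          exact (h hσ).1.2 (Or.inr rfl)
        omega
      · intro τ hτ
        refine ⟨hLK hτ, ?_⟩
        rw [hins]
        rintro (h | h)
        · exact hσ'.2 (h ▸ hτ)
        · have h' : τ = σ := h
          exact hσ.2 (h' ▸ hτ)
      · rw [hins]
        rintro τ ⟨⟨hτK, hτn⟩, hτL⟩
        have hτ1 : τ ≠ σ.erase u := fun h => hτn (Or.inl h)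
        have hτ2 : τ ≠ σ := fun h => hτn (Or.inr h)
        have ht := htog τ ⟨hτK, hτL⟩
        refine ⟨⟨⟨ht.1.1, ?_⟩, ht.1.2⟩, ⟨⟨ht.2.1, ?_⟩, ht.2.2⟩⟩
        · rintro (h | h)
          · have h' : insert u τ = σ.erase u := h
            exact Finset.notMem_erase u σ (h' ▸ Finset.mem_insert_self u τ)
          · have h' : insert u τ = σ := h
            by_cases hu : u ∈ τ
            · exact hτ2 (by rw [← h', Finset.insert_eq_of_mem hu])
            · exact hτ1 (by rw [← h', Finset.erase_insert hu])
        · rintro (h | h)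
          · have h' : τ.erase u = σ.erase u := h
            by_cases hu : u ∈ τ
            · exact hτ2 (by rw [← Finset.insert_erase hu, h', hins])
            · exact hτ1 (by rw [← h', Finset.erase_eq_of_notMem hu])
          · have h' : τ.erase u = σ := h
            exact Finset.notMem_erase u τ (h' ▸ huσ)

/-- A collapse induces a collapse after coning with `u`. -/
theorem coll_join (u : V) (M A B : Set (Finset V)) (hM : ∀ τ ∈ M, u ∉ τ)
    (hA : ∀ τ ∈ A, u ∉ τ) (h : Coll A B) :
    Coll (M ∪ (insert u) '' A) (M ∪ (insert u) '' B) := by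
  unfold Coll at h
  induction h using Relation.ReflTransGen.head_induction_on with
  | refl => exact Relation.ReflTransGen.refl
  | @head A D hstep _ ih =>
    obtain ⟨σ, v, hv, hσ, hvσ, hfree, hD⟩ := hstep
    have hDA : D ⊆ A := by rw [hD]; exact Set.sdiff_subset
    refine Relation.ReflTransGen.head ?_ (ih (fun τ hτ => hA τ (hDA hτ)))
    have huσ := hA _ hσ
    have hins := hA _ hvσ
    rw [Finset.mem_insert, not_or] at hins
    have hinj : ∀ τ ∈ A, ∀ ρ ∈ A, insert u τ = insert u ρ → τ = ρ := by
      intro τ hτ ρ hρ he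
      rw [← Finset.erase_insert (hA τ hτ), he, Finset.erase_insert (hA ρ hρ)]
    refine ⟨insert u σ, v, ?_, Or.inr ⟨σ, hσ, rfl⟩, ?_, ?_, ?_⟩
    · rw [Finset.mem_insert, not_or]; exact ⟨Ne.symm hins.1, hv⟩
    · rw [Finset.insert_comm]; exact Or.inr ⟨_, hvσ, rfl⟩
    · rintro τ (hτ | ⟨ρ, hρ, rfl⟩) hsub
      · exact absurd (hsub (Finset.mem_insert_self u σ)) (hM τ hτ)
      · have h1 : σ ⊆ ρ := by
          intro x hx
          have := hsub (Finset.mem_insert_of_mem hx)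
          rw [Finset.mem_insert] at this
          rcases this with rfl | h
          · exact absurd hx huσ
          · exact h
        rcases hfree ρ hρ h1 with rfl | rfl
        · left; rfl
        · right; rw [Finset.insert_comm]
    · rw [hD]
      ext τ
      constructor
      · rintro (hτ | ⟨ρ, hρ, rfl⟩)
        · refine ⟨Or.inl hτ, ?_⟩
          rintro (h | h)
          · have h' : τ = insert u σ := h
            exact hM τ hτ (h' ▸ Finset.mem_insert_self _ _)
          · have h' : τ = insert v (insert u σ) := h
            exact hM τ hτ (h' ▸ Finset.mem_insert_of_mem (Finset.mem_insert_self _ _))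
        · refine ⟨Or.inr ⟨ρ, hρ.1, rfl⟩, ?_⟩
          rintro (h | h)
          · exact hρ.2 (Or.inl (hinj ρ hρ.1 σ hσ h))
          · have h' : insert u ρ = insert v (insert u σ) := h
            rw [Finset.insert_comm] at h'
            exact hρ.2 (Or.inr (hinj ρ hρ.1 _ hvσ h'))
      · rintro ⟨hτ | ⟨ρ, hρ, rfl⟩, hn⟩
        · exact Or.inl hτ
        · refine Or.inr ⟨ρ, ⟨hρ, ?_⟩, rfl⟩
          rintro (h | h)
          · have h' : ρ = σ := h
            exact hn (Or.inl (by rw [h']))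
          · have h' : ρ = insert v σ := h
            exact hn (Or.inr (by rw [h', Finset.insert_comm]; rfl))

variable [PartialOrder V]

/-- chains inside `U` -/
def Ch (U : Set V) : Set (Finset V) :=
  {c | IsChain (fun a b => a ≤ b) (c : Set V) ∧ (c : Set V) ⊆ U}

theorem Ch_downCl (U : Set V) : DownCl (Ch U) := by
  intro σ hσ τ hτ
  exact ⟨hσ.1.mono (by exact_mod_cast hτ), subset_trans (by exact_mod_cast hτ) hσ.2⟩

theorem empty_mem_Ch (U : Set V) : ∅ ∈ Ch U := by simp [Ch]

/-- `U` is obtained from a collapsible complex by adding facets of cardinality `e`. -/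
def Good (e : ℕ) (U : Set V) : Prop :=
  (∀ c ∈ Ch U, c.card ≤ e) ∧
  ∃ C : Set (Finset V), (∀ c ∈ C, c ∈ Ch U ∧ c.card = e) ∧ Coll (Ch U \ C) ∅

theorem diff_downCl {e : ℕ} {U : Set V} (h1 : ∀ c ∈ Ch U, c.card ≤ e) {C : Set (Finset V)}
    (hC : ∀ c ∈ C, c ∈ Ch U ∧ c.card = e) : DownCl (Ch U \ C) := by
  rintro σ ⟨hσ, hσC⟩ τ hτ
  refine ⟨Ch_downCl U σ hσ τ hτ, fun h => ?_⟩
  have h2 := (hC τ h).2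
  have : τ = σ := Finset.eq_of_subset_of_card_le hτ (by rw [h2]; exact h1 σ hσ)
  exact hσC (this ▸ h)

theorem good_empty : Good 0 (∅ : Set V) := by
  have h : ∀ c ∈ Ch (∅ : Set V), c = ∅ := by
    intro c hc
    have := Set.subset_empty_iff.1 hc.2
    exact_mod_cast this
  refine ⟨fun c hc => by rw [h c hc]; simp, {∅}, ?_, ?_⟩
  · rintro c hc
    have : c = ∅ := hc
    subst this
    exact ⟨empty_mem_Ch _, rfl⟩
  · have : Ch (∅ : Set V) \ {∅} = ∅ := by
      ext c
      simp only [Set.mem_sdiff, Set.mem_singleton_iff, Set.mem_empty_iff_false, iff_false, not_and,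
        not_not]
      exact h c
    rw [this]
    exact Relation.ReflTransGen.refl

theorem chain_insert {u : V} {c : Finset V} (hc : IsChain (fun a b => a ≤ b) (c : Set V))
    (h : ∀ x ∈ c, u ≤ x) : IsChain (fun a b => a ≤ b) ((insert u c : Finset V) : Set V) := by
  rw [Finset.coe_insert]
  exact hc.insert (fun b hb _ => Or.inl (h b hb))

theorem chain_erase {u : V} {c : Finset V} (hc : IsChain (fun a b => a ≤ b) (c : Set V)) :
    IsChain (fun a b => a ≤ b) ((c.erase u : Finset V) : Set V) := by
  exact hc.mono (by exact_mod_cast Finset.erase_subset u c)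

theorem good_Ici (e : ℕ) (u : V) (hb : ∀ c ∈ Ch (Set.Ici u), c.card ≤ e) :
    Good e (Set.Ici u) := by
  refine ⟨hb, ∅, by simp, ?_⟩
  rw [Set.sdiff_empty]
  refine coll_of_toggle u ∅ (fun σ hσ => absurd hσ (Set.notMem_empty _)) _ _ le_rfl
    (Set.empty_subset _) ?_
  rintro σ ⟨hσ, -⟩
  refine ⟨⟨⟨chain_insert hσ.1 (fun x hx => hσ.2 hx), ?_⟩, Set.notMem_empty _⟩,
    ⟨Ch_downCl _ σ hσ _ (Finset.erase_subset _ _), Set.notMem_empty _⟩⟩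
  intro x hx
  rw [Finset.coe_insert] at hx
  rcases hx with rfl | hx
  · exact le_rfl
  · exact hσ.2 hx

theorem good_step (e : ℕ) (U : Set V) (u : V) (hU : IsUpperSet U) (hu : u ∉ U)
    (hgU : Good (e + 1) U) (hgV : Good e (U ∩ Set.Ioi u))
    (hb : ∀ c ∈ Ch (Set.Ici u), c.card ≤ e + 1) : Good (e + 1) (U ∪ Set.Ici u) := by
  obtain ⟨hUb, C, hC, hCc⟩ := hgU
  obtain ⟨hVb, C', hC', hCc'⟩ := hgV
  have hsplit : ∀ c ∈ Ch (U ∪ Set.Ici u), c ∈ Ch U ∨ c ∈ Ch (Set.Ici u) := by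
    intro c hc
    by_cases h : (c : Set V) ⊆ U
    · exact Or.inl ⟨hc.1, h⟩
    · right
      refine ⟨hc.1, ?_⟩
      obtain ⟨x, hx, hxU⟩ := Set.not_subset.1 h
      have hxu : u ≤ x := (hc.2 hx).resolve_left hxU
      intro y hy
      rcases hc.2 hy with hyU | hyu
      · rcases hc.1.total hx hy with hle | hle
        · exact le_trans hxu hle
        · exact absurd (hU hle hyU) hxU
      · exact hyu
  have hUsub : Ch U ⊆ Ch (U ∪ Set.Ici u) := fun c hc => ⟨hc.1, hc.2.trans Set.subset_union_left⟩
  have hIsub : Ch (Set.Ici u) ⊆ Ch (U ∪ Set.Ici u) :=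
    fun c hc => ⟨hc.1, hc.2.trans Set.subset_union_right⟩
  have huU : ∀ c ∈ Ch U, u ∉ c := fun c hc h => hu (hc.2 h)
  have huV : ∀ c ∈ Ch (U ∩ Set.Ioi u), u ∉ c := fun c hc h => hu (hc.2 h).1
  have hins : ∀ c ∈ Ch (Set.Ici u), insert u c ∈ Ch (Set.Ici u) := by
    intro c hc
    refine ⟨chain_insert hc.1 (fun x hx => hc.2 hx), ?_⟩
    intro x hx
    rw [Finset.coe_insert] at hx
    rcases hx with rfl | hx
    · exact le_rfl
    · exact hc.2 hx
  have hinsV : ∀ c ∈ Ch (U ∩ Set.Ioi u), insert u c ∈ Ch (Set.Ici u) := fun c hc =>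
    hins c ⟨hc.1, fun x hx => le_of_lt (hc.2 hx).2⟩
  have hbound : ∀ c ∈ Ch (U ∪ Set.Ici u), c.card ≤ e + 1 := by
    intro c hc
    rcases hsplit c hc with h | h
    · exact hUb c h
    · exact hb c h
  set C'' : Set (Finset V) := C ∪ (insert u) '' C' with hC''
  refine ⟨hbound, C'', ?_, ?_⟩
  · rintro c (hc | ⟨c, hc, rfl⟩)
    · exact ⟨hUsub (hC c hc).1, (hC c hc).2⟩
    · refine ⟨hIsub (hinsV c (hC' c hc).1), ?_⟩
      rw [Finset.card_insert_of_notMem (huV c (hC' c hc).1), (hC' c hc).2]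
  · have hM : ∀ τ ∈ Ch U \ C, u ∉ τ := fun τ hτ => huU τ hτ.1
    have hA : ∀ τ ∈ Ch (U ∩ Set.Ioi u) \ C', u ∉ τ := fun τ hτ => huV τ hτ.1
    have hj := coll_join u (Ch U \ C) _ _ hM hA hCc'
    rw [Set.image_empty, Set.union_empty] at hj
    refine Coll.trans ?_ (hj.trans hCc)
    have hVcap : ∀ c, c ∈ Ch (Set.Ici u) → ((c.erase u : Finset V) : Set V) ⊆ U →
        c.erase u ∈ Ch (U ∩ Set.Ioi u) := by
      intro c hc hcU
      refine ⟨chain_erase hc.1, fun x hx => ⟨hcU hx, ?_⟩⟩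
      have hx' : x ∈ c.erase u := hx
      rw [Finset.mem_erase] at hx'
      exact lt_of_le_of_ne (hc.2 hx'.2) (Ne.symm hx'.1)
    have hdiff : ∀ c, c ∈ (Ch (U ∪ Set.Ici u) \ C'') \
        (Ch U \ C ∪ insert u '' (Ch (U ∩ Set.Ioi u) \ C')) ↔
        (c ∈ Ch (Set.Ici u) ∧ ¬ ((c.erase u : Finset V) : Set V) ⊆ U) := by
      intro c
      constructor
      · rintro ⟨⟨hc, hcn⟩, hcn2⟩
        have hcU : c ∉ Ch U := by
          intro h
          exact hcn2 (Or.inl ⟨h, fun h' => hcn (Or.inl h')⟩)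
        have hcI := (hsplit c hc).resolve_left hcU
        refine ⟨hcI, fun h => ?_⟩
        have hV := hVcap c hcI h
        by_cases huc : u ∈ c
        · apply hcn2
          refine Or.inr ⟨c.erase u, ⟨hV, fun h' => ?_⟩, Finset.insert_erase huc⟩
          exact hcn (Or.inr ⟨_, h', Finset.insert_erase huc⟩)
        · rw [Finset.erase_eq_of_notMem huc] at h
          exact hcU ⟨hc.1, h⟩
      · rintro ⟨hc, hn⟩
        have hcU : c ∉ Ch U := fun h =>
          hn (subset_trans (by exact_mod_cast Finset.erase_subset u c) h.2)
        have hcV : ∀ d ∈ Ch (U ∩ Set.Ioi u), insert u d ≠ c := by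
          rintro d hd rfl
          apply hn
          rw [Finset.erase_insert (huV d hd)]
          exact fun x hx => (hd.2 hx).1
        refine ⟨⟨hIsub hc, ?_⟩, ?_⟩
        · rintro (h | ⟨d, hd, h⟩)
          · exact hcU (hC c h).1
          · exact hcV d (hC' d hd).1 h
        · rintro (h | ⟨d, hd, h⟩)
          · exact hcU h.1
          · exact hcV d hd.1 h
    refine coll_of_toggle u _ ?_ _ _ le_rfl ?_ ?_
    · rintro σ (hσ | ⟨d, hd, rfl⟩) τ hτ
      · exact Or.inl (diff_downCl hUb hC σ hσ τ hτ)
      · by_cases huτ : u ∈ τ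
        · right
          refine ⟨τ.erase u, diff_downCl hVb hC' d hd _ ?_, Finset.insert_erase huτ⟩
          rw [← Finset.erase_insert (hA d hd)]
          exact Finset.erase_subset_erase u hτ
        · left
          have hsub : τ ⊆ d := by
            intro x hx
            rcases Finset.mem_insert.1 (hτ hx) with rfl | h
            · exact absurd hx huτ
            · exact h
          have hτV := Ch_downCl _ d hd.1 τ hsub
          refine ⟨⟨hτV.1, fun x hx => (hτV.2 hx).1⟩, fun h => ?_⟩
          have h1 := (hC τ h).2
          have h2 := hVb τ hτV
          omega
    · rintro c (hc | ⟨d, hd, rfl⟩)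
      · refine ⟨hUsub hc.1, ?_⟩
        rintro (h | ⟨d, hd, h⟩)
        · exact hc.2 h
        · exact hM c hc (h ▸ Finset.mem_insert_self u d)
      · refine ⟨hIsub (hinsV d hd.1), ?_⟩
        rintro (h | ⟨d', hd', h⟩)
        · exact huU _ (hC _ h).1 (Finset.mem_insert_self u d)
        · have : d' = d := by
            rw [← Finset.erase_insert (huV d' (hC' d' hd').1), h, Finset.erase_insert (hA d hd)]
          exact hd.2 (this ▸ hd')
    · intro σ hσ
      rw [hdiff] at hσ
      rw [hdiff, hdiff]
      refine ⟨⟨hins σ hσ.1, ?_⟩, ⟨Ch_downCl _ σ hσ.1 _ (Finset.erase_subset _ _), ?_⟩⟩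
      · rw [Finset.erase_insert_eq_erase]; exact hσ.2
      · rw [Finset.erase_idem]; exact hσ.2

end Comb
section Abstract

set_option linter.unusedSectionVars false

variable {P : Type*} [PartialOrder P] [Fintype P] [DecidableEq P]

/-- elements of the proper part above some element of `Z` -/
def upG (p : P → Prop) (Z : Set P) : Set {x : P // p x} := {x | ∃ z ∈ Z, z ≤ x.1}

theorem upG_upper (p : P → Prop) (Z : Set P) : IsUpperSet (upG p Z) := by
  rintro x y hxy ⟨z, hz, hzx⟩
  exact ⟨z, hz, hzx.trans hxy⟩

theorem upG_insert (p : P → Prop) (Z : Set P) (z : P) (hz : p z) :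
    upG p (insert z Z) = upG p Z ∪ Set.Ici ⟨z, hz⟩ := by
  ext x
  constructor
  · rintro ⟨y, rfl | hy, hyx⟩
    · exact Or.inr hyx
    · exact Or.inl ⟨y, hy, hyx⟩
  · rintro (⟨y, hy, hyx⟩ | h)
    · exact ⟨y, Or.inr hy, hyx⟩
    · exact ⟨z, Or.inl rfl, h⟩

theorem chain_bound (p : P → Prop) (r : P → ℕ) (hr : ∀ x y, x < y → r y < r x)
    (hp : ∀ x, p x ↔ 2 ≤ r x) (u : {x : P // p x}) (k : ℕ) (hu : r u.1 ≤ k + 1) :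
    ∀ c ∈ Ch (Set.Ici u), c.card ≤ k := by
  intro c hc
  have hinj : Set.InjOn (fun x : {x : P // p x} => r x.1) c := by
    intro x hx y hy hxy
    by_contra hne
    rcases hc.1.total hx hy with h | h
    · have := hr _ _ (show x.1 < y.1 from lt_of_le_of_ne h (fun e => hne (Subtype.ext e)))
      simp only at hxy
      omega
    · have := hr _ _ (show y.1 < x.1 from lt_of_le_of_ne h (fun e => hne (Subtype.ext e.symm)))
      simp only at hxy
      omega
  have hmaps : ∀ x ∈ c, r x.1 ∈ Finset.Icc 2 (k + 1) := by
    intro x hx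
    rw [Finset.mem_Icc]
    refine ⟨(hp _).1 x.2, ?_⟩
    have hux : u ≤ x := hc.2 hx
    rcases eq_or_lt_of_le hux with h | h
    · rw [← h]; exact hu
    · have := hr _ _ (show u.1 < x.1 from h)
      omega
  have := Finset.card_le_card_of_injOn _ hmaps hinj
  simpa using this

theorem good_covers (p : P → Prop) (r : P → ℕ) (hr : ∀ x y, x < y → r y < r x)
    (hp : ∀ x, p x ↔ 2 ≤ r x) (T : P) (hT : ∀ x, x ≤ T)
    (hB : ∀ a z z' x, a < z → a < z' → r z + 1 = r a → r z' + 1 = r a → z ≠ z' → z ≤ x →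
      z' ≤ x → ∃ j, z' < j ∧ r j + 1 = r z' ∧ z ≤ j ∧ j ≤ x) :
    ∀ (k : ℕ) (a : P), r a = k + 2 → ∀ Z : Finset P, Z.Nonempty →
      (∀ z ∈ Z, a < z ∧ r z + 1 = r a) → Good k (upG p (Z : Set P)) := by
  have : Fintype {x : P // p x} := Fintype.ofFinite _
  have hr' : ∀ x y, x ≤ y → r y ≤ r x := by
    intro x y h
    rcases eq_or_lt_of_le h with rfl | h
    · exact le_rfl
    · exact (hr _ _ h).le
  intro k
  induction k with
  | zero =>
    intro a ha Z _ hZ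
    have : upG p (Z : Set P) = ∅ := by
      ext x
      simp only [Set.mem_empty_iff_false, iff_false]
      rintro ⟨z, hz, hzx⟩
      have h1 := (hZ z hz).2
      have h2 := hr' _ _ hzx
      have h3 := (hp _).1 x.2
      omega
    rw [this]
    exact good_empty
  | succ k ih =>
    intro a ha Z hZne
    induction hZne using Finset.Nonempty.cons_induction with
    | singleton z =>
      intro hZ
      have hz := hZ z (Finset.mem_singleton_self z)
      have hpz : p z := (hp z).2 (by omega)
      have : upG p ((({z} : Finset P)) : Set P) = Set.Ici ⟨z, hpz⟩ := by
        rw [Finset.coe_singleton, ← insert_empty_eq, upG_insert p _ z hpz]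
        have : upG p (∅ : Set P) = ∅ := by
          ext x; simp [upG]
        rw [this, Set.empty_union]
      rw [this]
      exact good_Ici _ _ (chain_bound p r hr hp _ _ (by show r z ≤ _; omega))
    | cons z Z hzZ hZne ihZ =>
      intro hZ
      have hz := hZ z (Finset.mem_cons_self z Z)
      have hZ' : ∀ z ∈ Z, a < z ∧ r z + 1 = r a := fun y hy => hZ y (Finset.mem_cons_of_mem hy)
      have hpz : p z := (hp z).2 (by omega)
      rw [Finset.coe_cons, upG_insert p _ z hpz]
      apply good_step
      · exact upG_upper _ _
      · rintro ⟨y, hy, hyz⟩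
        have hyz' : y ≤ z := hyz
        rcases eq_or_lt_of_le hyz' with h | h
        · exact hzZ (h ▸ hy)
        · have h1 := hr _ _ h
          have h2 := (hZ' y hy).2
          omega
      · exact ihZ hZ'
      · classical
        have heq : upG p (Z : Set P) ∩ Set.Ioi ⟨z, hpz⟩ =
            upG p ((Finset.univ.filter (fun j => z < j ∧ r j + 1 = r z ∧ ∃ y ∈ Z, y ≤ j) :
              Finset P) : Set P) := by
          ext x
          constructor
          · rintro ⟨⟨y, hy, hyx⟩, hzx⟩
            have hzx' : z < x.1 := hzx
            have hyz : y ≠ z := by rintro rfl; exact hzZ hy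
            obtain ⟨j, hj1, hj2, hj3, hj4⟩ := hB a y z x.1 (hZ' y hy).1 hz.1 (hZ' y hy).2 hz.2 hyz
              hyx hzx'.le
            exact ⟨j, by simpa using ⟨hj1, hj2, y, hy, hj3⟩, hj4⟩
          · rintro ⟨j, hj, hjx⟩
            rw [Finset.mem_coe, Finset.mem_filter] at hj
            obtain ⟨-, hj1, hj2, y, hy, hyj⟩ := hj
            exact ⟨⟨y, hy, hyj.trans hjx⟩, lt_of_lt_of_le hj1 hjx⟩
        rw [heq]
        apply ih z (by omega)
        · obtain ⟨y, hy⟩ := hZne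
          have hyz : y ≠ z := by rintro rfl; exact hzZ hy
          obtain ⟨j, hj1, hj2, hj3, hj4⟩ := hB a y z T (hZ' y hy).1 hz.1 (hZ' y hy).2 hz.2 hyz
              (hT _) (hT _)
          exact ⟨j, by simpa using ⟨hj1, hj2, y, hy, hj3⟩⟩
        · intro j hj
          rw [Finset.mem_filter] at hj
          exact ⟨hj.2.1, hj.2.2.1⟩
      · exact chain_bound p r hr hp _ _ (by show r z ≤ _; omega)

theorem good_univ (p : P → Prop) (r : P → ℕ) (hr : ∀ x y, x < y → r y < r x)
    (hp : ∀ x, p x ↔ 2 ≤ r x) (T : P) (hT : ∀ x, x ≤ T)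
    (hB : ∀ a z z' x, a < z → a < z' → r z + 1 = r a → r z' + 1 = r a → z ≠ z' → z ≤ x →
      z' ≤ x → ∃ j, z' < j ∧ r j + 1 = r z' ∧ z ≤ j ∧ j ≤ x)
    (k : ℕ) {I α : Type*} [Fintype I] [DecidableEq I] [LinearOrder α] (key : I → α)
    (hkey : Function.Injective key) (at' : I → P) (hat : Function.Injective at')
    (hatr : ∀ i, r (at' i) = k + 2)
    (hC : ∀ i j y, key i < key j → at' i ≤ y → at' j ≤ y →
      ∃ l z, key l < key j ∧ at' j < z ∧ r z + 1 = k + 2 ∧ at' l ≤ z ∧ z ≤ y)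
    (hD : ∀ x, ∃ i, at' i ≤ x) :
    Good (k + 1) (Set.univ : Set {x : P // p x}) := by
  have : Fintype {x : P // p x} := Fintype.ofFinite _
  have hpa : ∀ i, p (at' i) := fun i => (hp _).2 (by rw [hatr]; omega)
  have main : ∀ S : Finset I, (∀ i j, key i < key j → j ∈ S → i ∈ S) → S.Nonempty →
      Good (k + 1) (upG p (at' '' (S : Set I))) := by
    intro S
    induction S using Finset.induction_on_max_value key with
    | empty => intro _ h; exact absurd h (by simp)
    | insert a S haS hmax ih =>
      intro hlow _
      have hlow' : ∀ i j, key i < key j → j ∈ S → i ∈ S := by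
        intro i j hij hj
        rcases Finset.mem_insert.1 (hlow i j hij (Finset.mem_insert_of_mem hj)) with rfl | h
        · exact absurd hij (not_lt.2 (hmax j hj))
        · exact h
      have hlt : ∀ i ∈ S, key i < key a := by
        intro i hi
        refine lt_of_le_of_ne (hmax i hi) (fun h => haS ?_)
        rw [← hkey h]; exact hi
      have hmem : ∀ i, key i < key a → i ∈ S := by
        intro i hi
        rcases Finset.mem_insert.1 (hlow i a hi (Finset.mem_insert_self _ _)) with rfl | h
        · exact absurd hi (lt_irrefl _)
        · exact h
      rw [Finset.coe_insert, Set.image_insert_eq, upG_insert p _ _ (hpa a)]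
      have hbd : ∀ c ∈ Ch (Set.Ici (⟨at' a, hpa a⟩ : {x : P // p x})), c.card ≤ k + 1 :=
        chain_bound p r hr hp _ _ (by show r (at' a) ≤ _; rw [hatr])
      rcases S.eq_empty_or_nonempty with rfl | hSne
      · have : upG p (at' '' ((∅ : Finset I) : Set I)) = ∅ := by
          ext x; simp [upG]
        rw [this, Set.empty_union]
        exact good_Ici _ _ hbd
      · apply good_step
        · exact upG_upper _ _
        · rintro ⟨y, ⟨i, hi, rfl⟩, hyz⟩
          have hyz' : at' i ≤ at' a := hyz
          rcases eq_or_lt_of_le hyz' with h | h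
          · exact haS (hat h ▸ hi)
          · have h1 := hr _ _ h
            rw [hatr, hatr] at h1
            omega
        · exact ih hlow' hSne
        · classical
          have heq : upG p (at' '' (S : Set I)) ∩ Set.Ioi ⟨at' a, hpa a⟩ =
            upG p ((Finset.univ.filter (fun j => at' a < j ∧ r j + 1 = k + 2 ∧
              ∃ i ∈ S, at' i ≤ j) : Finset P) : Set P) := by
            ext x
            constructor
            · rintro ⟨⟨y, ⟨i, hi, rfl⟩, hyx⟩, hzx⟩
              have hzx' : at' a < x.1 := hzx
              obtain ⟨l, z, hl, hz1, hz2, hz3, hz4⟩ := hC i a x.1 (hlt i hi) hyx hzx'.le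
              exact ⟨z, by simpa using ⟨hz1, by omega, l, hmem l hl, hz3⟩, hz4⟩
            · rintro ⟨j, hj, hjx⟩
              rw [Finset.mem_coe, Finset.mem_filter] at hj
              obtain ⟨-, hj1, hj2, i, hi, hij⟩ := hj
              exact ⟨⟨_, ⟨i, hi, rfl⟩, hij.trans hjx⟩, lt_of_lt_of_le hj1 hjx⟩
          rw [heq]
          apply good_covers p r hr hp T hT hB k (at' a) (hatr a)
          · obtain ⟨i, hi⟩ := hSne
            obtain ⟨l, z, hl, hz1, hz2, hz3, hz4⟩ := hC i a T (hlt i hi) (hT _) (hT _)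
            exact ⟨z, by simpa using ⟨hz1, by omega, l, hmem l hl, hz3⟩⟩
          · intro j hj
            rw [Finset.mem_filter] at hj
            exact ⟨hj.2.1, by rw [hatr]; exact hj.2.2.1⟩
        · exact hbd
  have huniv : upG p (at' '' ((Finset.univ : Finset I) : Set I)) = Set.univ := by
    ext x
    simp only [Set.mem_univ, iff_true]
    obtain ⟨i, hi⟩ := hD x.1
    exact ⟨_, ⟨i, by simp, rfl⟩, hi⟩
  rw [← huniv]
  apply main _ (fun _ _ _ _ => Finset.mem_univ _)
  obtain ⟨i, _⟩ := hD T
  exact ⟨i, Finset.mem_univ _⟩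

end Abstract
section FinpartitionMerge

variable {n : ℕ}

theorem fp_merge (P : Finpartition (Finset.univ : Finset (Fin n))) (A B : Finset (Fin n))
    (hA : A ∈ P.parts) (hB : B ∈ P.parts) (hAB : A ≠ B) :
    ∃ M : Finpartition (Finset.univ : Finset (Fin n)), P ≤ M ∧
      M.parts.card + 1 = P.parts.card ∧ A ∪ B ∈ M.parts ∧
      ∀ Q, P ≤ Q → (∃ C ∈ Q.parts, A ⊆ C ∧ B ⊆ C) → M ≤ Q := by
  have hnot : ∀ C ∈ P.parts, ∀ a ∈ C, a ∈ A ∪ B → C = A ∨ C = B := by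
    intro C hC a haC ha
    rcases Finset.mem_union.1 ha with h | h
    · exact Or.inl (P.eq_of_mem_parts hC hA haC h)
    · exact Or.inr (P.eq_of_mem_parts hC hB haC h)
  have hmem : ∀ C, C ∈ insert (A ∪ B) ((P.parts.erase A).erase B) ↔
      C = A ∪ B ∨ (C ≠ B ∧ C ≠ A ∧ C ∈ P.parts) := by
    intro C; simp only [Finset.mem_insert, Finset.mem_erase]
  let M : Finpartition (Finset.univ : Finset (Fin n)) :=
    Finpartition.ofExistsUnique (insert (A ∪ B) ((P.parts.erase A).erase B))
      (fun _ _ => Finset.subset_univ _) (by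
        intro a _
        by_cases ha : a ∈ A ∪ B
        · refine ⟨A ∪ B, ⟨(hmem _).2 (Or.inl rfl), ha⟩, ?_⟩
          rintro C ⟨hC, haC⟩
          rcases (hmem C).1 hC with h | ⟨h1, h2, h3⟩
          · exact h
          · rcases hnot C h3 a haC ha with h | h
            · exact absurd h h2
            · exact absurd h h1
        · obtain ⟨C, hC, haC⟩ := P.exists_mem (Finset.mem_univ a)
          refine ⟨C, ⟨(hmem _).2 (Or.inr ⟨?_, ?_, hC⟩), haC⟩, ?_⟩
          · rintro rfl; exact ha (Finset.mem_union_right _ haC)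
          · rintro rfl; exact ha (Finset.mem_union_left _ haC)
          · rintro D ⟨hD, haD⟩
            rcases (hmem D).1 hD with h | ⟨h1, h2, h3⟩
            · exact absurd (h ▸ haD) ha
            · exact P.eq_of_mem_parts h3 hC haD haC)
      (by
        intro h
        rcases (hmem ∅).1 h with h | ⟨_, _, h⟩
        · obtain ⟨a, ha⟩ := P.nonempty_of_mem_parts hA
          have : a ∈ (∅ : Finset (Fin n)) := h ▸ Finset.mem_union_left B ha
          simp at this
        · exact P.empty_notMem_parts h)
  have hM : ∀ C, C ∈ M.parts ↔ C = A ∪ B ∨ (C ≠ B ∧ C ≠ A ∧ C ∈ P.parts) := hmem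
  refine ⟨M, ?_, ?_, (hM _).2 (Or.inl rfl), ?_⟩
  · intro C hC
    by_cases h1 : C = A
    · exact ⟨A ∪ B, (hM _).2 (Or.inl rfl), h1 ▸ Finset.subset_union_left⟩
    · by_cases h2 : C = B
      · exact ⟨A ∪ B, (hM _).2 (Or.inl rfl), h2 ▸ Finset.subset_union_right⟩
      · exact ⟨C, (hM _).2 (Or.inr ⟨h2, h1, hC⟩), le_rfl⟩
  · have h1 : A ∪ B ∉ (P.parts.erase A).erase B := by
      intro h
      simp only [Finset.mem_erase] at h
      obtain ⟨h1, h2, h3⟩ := h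
      obtain ⟨a, ha⟩ := P.nonempty_of_mem_parts hA
      exact h2 (P.eq_of_mem_parts h3 hA (Finset.mem_union_left _ ha) ha)
    have h2 : M.parts.card = ((P.parts.erase A).erase B).card + 1 :=
      Finset.card_insert_of_notMem h1
    have h3 : B ∈ P.parts.erase A := Finset.mem_erase.2 ⟨hAB.symm, hB⟩
    have h4 := Finset.card_erase_add_one h3
    have h5 := Finset.card_erase_add_one hA
    omega
  · rintro Q hPQ ⟨C, hC, hAC, hBC⟩ D hD
    rcases (hM D).1 hD with rfl | ⟨_, _, h⟩
    · exact ⟨C, hC, Finset.union_subset hAC hBC⟩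
    · exact hPQ h

theorem fp_exists_pair {P Q : Finpartition (Finset.univ : Finset (Fin n))} (h : P < Q) :
    ∃ A ∈ P.parts, ∃ B ∈ P.parts, A ≠ B ∧ ∃ C ∈ Q.parts, A ⊆ C ∧ B ⊆ C := by
  by_contra hcon
  push Not at hcon
  apply h.not_ge
  intro C hC
  obtain ⟨c, hc⟩ := Q.nonempty_of_mem_parts hC
  have key : ∀ y ∈ C, ∃ A ∈ P.parts, y ∈ A ∧ A ⊆ C := by
    intro y hy
    obtain ⟨A, hA, hyA⟩ := P.exists_mem (Finset.mem_univ y)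
    obtain ⟨C', hC', hAC'⟩ := h.le hA
    have : C' = C := Q.eq_of_mem_parts hC' hC (hAC' hyA) hy
    exact ⟨A, hA, hyA, this ▸ hAC'⟩
  obtain ⟨A, hA, hcA, hAC⟩ := key c hc
  refine ⟨A, hA, fun y hy => ?_⟩
  obtain ⟨B, hB, hyB, hBC⟩ := key y hy
  by_cases hAB : A = B
  · exact hAB ▸ hyB
  · exact absurd hBC (hcon A hA B hB hAB C hC hAC)

theorem fp_card_lt {P Q : Finpartition (Finset.univ : Finset (Fin n))} (h : P < Q) :
    Q.parts.card < P.parts.card := by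
  obtain ⟨A, hA, B, hB, hAB, C, hC, hAC, hBC⟩ := fp_exists_pair h
  obtain ⟨M, hPM, hMc, -, hM⟩ := fp_merge P A B hA hB hAB
  have := Finpartition.card_mono (hM Q h.le ⟨C, hC, hAC, hBC⟩)
  omega

theorem fp_eq_of_le {P Q : Finpartition (Finset.univ : Finset (Fin n))} (h : P ≤ Q)
    (hc : P.parts.card ≤ Q.parts.card) : P = Q := by
  by_contra hne
  have := fp_card_lt (lt_of_le_of_ne h hne)
  omega

theorem fp_semimod (a z z' x : Finpartition (Finset.univ : Finset (Fin n))) (haz : a < z)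
    (haz' : a < z') (hz : z.parts.card + 1 = a.parts.card) (hz' : z'.parts.card + 1 = a.parts.card)
    (hne : z ≠ z') (hzx : z ≤ x) (hzx' : z' ≤ x) :
    ∃ j, z' < j ∧ j.parts.card + 1 = z'.parts.card ∧ z ≤ j ∧ j ≤ x := by
  obtain ⟨A1, hA1, A2, hA2, hA12, C, hC, hA1C, hA2C⟩ := fp_exists_pair haz
  obtain ⟨M, haM, hMc, hMu, hM⟩ := fp_merge a A1 A2 hA1 hA2 hA12
  have hMz : M = z := fp_eq_of_le (hM z haz.le ⟨C, hC, hA1C, hA2C⟩) (by omega)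
  obtain ⟨B1, hB1, hAB1⟩ := haz'.le hA1
  obtain ⟨B2, hB2, hAB2⟩ := haz'.le hA2
  by_cases hB12 : B1 = B2
  · exfalso
    subst hB12
    have : M = z' := fp_eq_of_le (hM z' haz'.le ⟨B1, hB1, hAB1, hAB2⟩) (by omega)
    exact hne (hMz.symm.trans this)
  · obtain ⟨J, hJ, hJc, hJu, hJM⟩ := fp_merge z' B1 B2 hB1 hB2 hB12
    refine ⟨J, lt_of_le_of_ne hJ ?_, hJc, ?_, ?_⟩
    · rintro rfl; omega
    · rw [← hMz]
      exact hM J (haz'.le.trans hJ) ⟨B1 ∪ B2, hJu, hAB1.trans Finset.subset_union_left,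
        hAB2.trans Finset.subset_union_right⟩
    · apply hJM x hzx'
      obtain ⟨D, hD, hCD⟩ := hzx hC
      obtain ⟨D1, hD1, hBD1⟩ := hzx' hB1
      obtain ⟨D2, hD2, hBD2⟩ := hzx' hB2
      obtain ⟨a1, ha1⟩ := a.nonempty_of_mem_parts hA1
      obtain ⟨a2, ha2⟩ := a.nonempty_of_mem_parts hA2
      have h1 : D1 = D := x.eq_of_mem_parts hD1 hD (hBD1 (hAB1 ha1)) (hCD (hA1C ha1))
      have h2 : D2 = D := x.eq_of_mem_parts hD2 hD (hBD2 (hAB2 ha2)) (hCD (hA2C ha2))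
      exact ⟨D, hD, h1 ▸ hBD1, h2 ▸ hBD2⟩

end FinpartitionMerge

namespace VPart

variable {n s : ℕ}

theorem finite_vpart : Finite (VPart n s) := by
  apply Finite.of_injective (fun x : VPart n s => (x.P, x.w))
  intro x y h
  simp only [Prod.mk.injEq] at h
  exact ext' h.1 h.2

/-- the vector partition with underlying partition `P` and labels given by permutations -/
def ofPE (P : Finpartition (Finset.univ : Finset (Fin n))) (e : Fin s → Equiv.Perm (Fin n)) :
    VPart n s where
  P := P
  w i B := if B ∈ P.parts then B.image (e i) else ∅
  card_w i B hB := by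
    simp only [hB, if_true]
    exact Finset.card_image_of_injective _ (e i).injective
  part_w i x := by
    obtain ⟨B, hB, hBu⟩ := P.existsUnique_mem (Finset.mem_univ ((e i).symm x))
    refine ⟨B, ⟨hB.1, ?_⟩, ?_⟩
    · simp only [hB.1, if_true, Finset.mem_image]
      exact ⟨_, hB.2, by simp⟩
    · rintro C ⟨hC, hxC⟩
      simp only [hC, if_true, Finset.mem_image] at hxC
      obtain ⟨a, ha, rfl⟩ := hxC
      exact hBu C ⟨hC, by simpa using ha⟩
  w_junk i B hB := by simp [hB]

theorem ofPE_mono {P Q : Finpartition (Finset.univ : Finset (Fin n))}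
    (e : Fin s → Equiv.Perm (Fin n)) (h : P ≤ Q) : ofPE P e ≤ ofPE Q e := by
  refine ⟨h, fun i B hB B' hB' hBB' => ?_⟩
  have h1 : B ∈ P.parts := hB
  have h2 : B' ∈ Q.parts := hB'
  simp only [ofPE, h1, h2, if_true]
  exact Finset.image_subset_image hBB'

def atomOf (e : Fin s → Equiv.Perm (Fin n)) : VPart n s := ofPE ⊥ e

theorem singleton_mem_bot (k : Fin n) :
    ({k} : Finset (Fin n)) ∈ (⊥ : Finpartition (Finset.univ : Finset (Fin n))).parts := by
  rw [Finpartition.mem_bot_iff]; exact ⟨k, Finset.mem_univ _, rfl⟩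

theorem atomOf_le_iff (e : Fin s → Equiv.Perm (Fin n)) (y : VPart n s) :
    atomOf e ≤ y ↔ ∀ i k, e i k ∈ y.w i (y.P.part k) := by
  constructor
  · intro h i k
    have h1 := h.2 i {k} (singleton_mem_bot k) (y.P.part k)
      (y.P.part_mem.2 (Finset.mem_univ k))
      (Finset.singleton_subset_iff.2 (y.P.mem_part (Finset.mem_univ k)))
    apply h1
    simp [atomOf, ofPE]
  · intro h
    refine ⟨bot_le, ?_⟩
    intro i B hB B' hB' hBB'
    obtain ⟨k, -, rfl⟩ := Finpartition.mem_bot_iff.1 hB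
    have hk : y.P.part k = B' :=
      y.P.part_eq_of_mem hB' (hBB' (Finset.mem_singleton_self k))
    have h1 := h i k
    rw [hk] at h1
    simpa [atomOf, ofPE] using h1

theorem eq_ofPE_of_atomOf_le {e : Fin s → Equiv.Perm (Fin n)} {y : VPart n s}
    (h : atomOf e ≤ y) : y = ofPE y.P e := by
  rw [atomOf_le_iff] at h
  refine ext' rfl ?_
  funext i B
  by_cases hB : B ∈ y.P.parts
  · simp only [ofPE, hB, if_true]
    symm
    apply Finset.eq_of_subset_of_card_le
    · intro v hv
      obtain ⟨k, hk, rfl⟩ := Finset.mem_image.1 hv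
      have h1 := h i k
      rwa [y.P.part_eq_of_mem hB hk] at h1
    · rw [y.card_w i B hB, Finset.card_image_of_injective _ (e i).injective]
  · simp only [ofPE, hB, if_false]
    exact y.w_junk i B hB

theorem exists_atomOf_le (x : VPart n s) : ∃ e, atomOf e ≤ x := by
  have hg : ∀ (i : Fin s) (k : Fin n), k ∈ x.P.part k := fun _ k => x.P.mem_part (Finset.mem_univ k)
  have hpm : ∀ k : Fin n, x.P.part k ∈ x.P.parts := fun k => x.P.part_mem.2 (Finset.mem_univ k)
  have key : ∀ i : Fin s, ∃ e : Equiv.Perm (Fin n), ∀ k, e k ∈ x.w i (x.P.part k) := by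
    intro i
    have hE : ∀ B : Finset (Fin n), ∃ g : Fin n → Fin n, B ∈ x.P.parts →
        Set.InjOn g B ∧ ∀ k ∈ B, g k ∈ x.w i B := by
      intro B
      by_cases hB : B ∈ x.P.parts
      · let q : B ≃ x.w i B := Finset.equivOfCardEq (x.card_w i B hB).symm
        refine ⟨fun k => if hk : k ∈ B then (q ⟨k, hk⟩ : Fin n) else k, fun _ => ⟨?_, ?_⟩⟩
        · intro k hk l hl hkl
          have hk' : k ∈ B := hk
          have hl' : l ∈ B := hl
          simp only [hk', hl', dif_pos] at hkl
          have := q.injective (Subtype.ext hkl)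
          simpa using this
        · intro k hk
          simp only [hk, dif_pos]
          exact (q ⟨k, hk⟩).2
      · exact ⟨id, fun h => absurd h hB⟩
    choose g hg' using hE
    let f : Fin n → Fin n := fun k => g (x.P.part k) k
    have hf : ∀ k, f k ∈ x.w i (x.P.part k) := fun k =>
      (hg' _ (hpm k)).2 k (x.P.mem_part (Finset.mem_univ k))
    have hinj : Function.Injective f := by
      intro k l hkl
      have h1 := hf k
      have h2 := hf l
      rw [← hkl] at h2
      have h3 : x.P.part k = x.P.part l :=
        (x.part_w i (f k)).unique ⟨hpm k, h1⟩ ⟨hpm l, h2⟩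
      have h4 : g (x.P.part k) k = g (x.P.part k) l := by
        have : f l = g (x.P.part k) l := by rw [h3]
        rw [← this]; exact hkl
      refine (hg' _ (hpm k)).1 (x.P.mem_part (Finset.mem_univ k)) ?_ h4
      rw [h3]; exact x.P.mem_part (Finset.mem_univ l)
    exact ⟨Equiv.ofBijective f (Finite.injective_iff_bijective.1 hinj), hf⟩
  choose e he using key
  exact ⟨e, (atomOf_le_iff e x).2 he⟩

/-- rank: number of blocks -/
def rk (x : VPart n s) : ℕ := x.P.parts.card

theorem P_lt_of_lt {x y : VPart n s} (h : x < y) : x.P < y.P := by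
  refine lt_of_le_of_ne h.le.1 (fun hP => h.ne ?_)
  obtain ⟨e, he⟩ := exists_atomOf_le x
  rw [eq_ofPE_of_atomOf_le he, eq_ofPE_of_atomOf_le (he.trans h.le), hP]

theorem rk_lt {x y : VPart n s} (h : x < y) : rk y < rk x := fp_card_lt (P_lt_of_lt h)

theorem rk_semimod (a z z' x : VPart n s) (haz : a < z) (haz' : a < z') (hz : rk z + 1 = rk a)
    (hz' : rk z' + 1 = rk a) (hne : z ≠ z') (hzx : z ≤ x) (hzx' : z' ≤ x) :
    ∃ j, z' < j ∧ rk j + 1 = rk z' ∧ z ≤ j ∧ j ≤ x := by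
  obtain ⟨e, he⟩ := exists_atomOf_le a
  have ez := eq_ofPE_of_atomOf_le (he.trans haz.le)
  have ez' := eq_ofPE_of_atomOf_le (he.trans haz'.le)
  have ex := eq_ofPE_of_atomOf_le (he.trans (haz.le.trans hzx))
  have hne' : z.P ≠ z'.P := by
    intro h
    apply hne
    rw [ez, ez', h]
  obtain ⟨J, h1, h2, h3, h4⟩ := fp_semimod a.P z.P z'.P x.P (P_lt_of_lt haz) (P_lt_of_lt haz')
    hz hz' hne' hzx.1 hzx'.1
  have hle : z' ≤ ofPE J e := by rw [ez']; exact ofPE_mono e h1.le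
  refine ⟨ofPE J e, lt_of_le_of_ne hle ?_, h2, ?_, ?_⟩
  · intro h
    have : z'.P = J := congrArg VPart.P h
    exact h1.ne this
  · rw [ez]; exact ofPE_mono e h3
  · rw [ex]; exact ofPE_mono e h4

theorem rk_atomOf (e : Fin s → Equiv.Perm (Fin n)) : rk (atomOf e) = n := by
  have : rk (atomOf e) = (⊥ : Finpartition (Finset.univ : Finset (Fin n))).parts.card := rfl
  rw [this, Finpartition.card_bot]; simp

theorem atomOf_injective : Function.Injective (atomOf : (Fin s → Equiv.Perm (Fin n)) → VPart n s) := by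
  intro e e' h
  funext i
  ext k : 1
  have h1 : (atomOf e).w i {k} = (atomOf e').w i {k} := by rw [h]
  simpa [atomOf, ofPE] using h1

/-- lexicographic key -/
def key (e : Fin s → Equiv.Perm (Fin n)) : Lex (Fin s → Lex (Fin n → Fin n)) :=
  toLex (fun i => toLex (fun k => e i k))

theorem key_injective : Function.Injective (key : (Fin s → Equiv.Perm (Fin n)) → _) := by
  intro e e' h
  funext i
  ext k : 1
  exact congrFun (congrFun h i) k

theorem key_lt_iff (e e' : Fin s → Equiv.Perm (Fin n)) :
    key e < key e' ↔ ∃ i, (∀ i' < i, e i' = e' i') ∧ ∃ k, (∀ k' < k, e i k' = e' i k') ∧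
      e i k < e' i k := by
  constructor
  · rintro ⟨i, hi, k, hk, hlt⟩
    refine ⟨i, fun i' hi' => ?_, k, hk, hlt⟩
    ext k' : 1
    exact congrFun (hi i' hi') k'
  · rintro ⟨i, hi, k, hk, hlt⟩
    refine ⟨i, fun i' hi' => ?_, k, hk, hlt⟩
    funext k'
    exact congrArg (fun p : Equiv.Perm (Fin n) => p k') (hi i' hi')

theorem atom_exchange (σ τ : Fin s → Equiv.Perm (Fin n)) (y : VPart n s) (hlt : key σ < key τ)
    (hσ : atomOf σ ≤ y) (hτ : atomOf τ ≤ y) :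
    ∃ ρ z, key ρ < key τ ∧ atomOf τ < z ∧ rk z + 1 = n ∧ atomOf ρ ≤ z ∧ z ≤ y := by
  obtain ⟨i, hi, k, hk, hik⟩ := (key_lt_iff σ τ).1 hlt
  set l := (τ i).symm (σ i k) with hl
  have hτl : τ i l = σ i k := by simp [hl]
  have hkl : k ≠ l := by
    intro h
    rw [← h] at hτl
    exact hik.ne hτl.symm
  have hklt : k < l := by
    by_contra h
    have hlk : l < k := lt_of_le_of_ne (not_lt.1 h) (Ne.symm hkl)
    have h1 := hk l hlk
    rw [hτl] at h1
    exact hkl ((σ i).injective h1).symm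
  have hpart : y.P.part k = y.P.part l := by
    have h1 := (atomOf_le_iff σ y).1 hσ i k
    have h2 := (atomOf_le_iff τ y).1 hτ i l
    rw [hτl] at h2
    exact (y.part_w i (σ i k)).unique ⟨y.P.part_mem.2 (Finset.mem_univ k), h1⟩
      ⟨y.P.part_mem.2 (Finset.mem_univ l), h2⟩
  obtain ⟨M, -, hMc, hMu, hM⟩ := fp_merge ⊥ {k} {l} (singleton_mem_bot k) (singleton_mem_bot l)
    (by simpa using hkl)
  have hMc' : M.parts.card + 1 = n := by
    rw [hMc, Finpartition.card_bot]; simp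
  have hMy : M ≤ y.P := by
    apply hM _ bot_le
    refine ⟨y.P.part k, y.P.part_mem.2 (Finset.mem_univ k), ?_, ?_⟩
    · exact Finset.singleton_subset_iff.2 (y.P.mem_part (Finset.mem_univ k))
    · rw [hpart]; exact Finset.singleton_subset_iff.2 (y.P.mem_part (Finset.mem_univ l))
  let ρ' : Fin s → Equiv.Perm (Fin n) := Function.update τ i (τ i * Equiv.swap k l)
  refine ⟨ρ', ofPE M τ, ?_, ?_, hMc', ?_, ?_⟩
  · rw [key_lt_iff]
    refine ⟨i, fun i' hi' => by simp [ρ', hi'.ne], k, fun k' hk' => ?_, ?_⟩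
    · simp [ρ', Equiv.swap_apply_of_ne_of_ne hk'.ne (hk'.trans hklt).ne]
    · simp [ρ', hτl, hik]
  · refine lt_of_le_of_ne (ofPE_mono τ bot_le) (fun h => ?_)
    have h1 : rk (atomOf τ) = rk (ofPE M τ) := congrArg rk h
    rw [rk_atomOf] at h1
    have h2 : rk (ofPE M τ) + 1 = n := hMc'
    omega
  · rw [atomOf_le_iff]
    intro i' k'
    have hmem : M.part k' ∈ M.parts := M.part_mem.2 (Finset.mem_univ k')
    show ρ' i' k' ∈ (if M.part k' ∈ M.parts then (M.part k').image (τ i') else ∅)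
    rw [if_pos hmem]
    have hkM : ∀ a ∈ ({k, l} : Finset (Fin n)), M.part a = {k} ∪ {l} := by
      intro a ha
      apply M.part_eq_of_mem hMu
      simpa using ha
    by_cases hi' : i' = i
    · subst hi'
      by_cases h1 : k' = k
      · subst h1
        rw [hkM k' (by simp)]
        exact Finset.mem_image.2 ⟨l, by simp, by simp [ρ']⟩
      · by_cases h2 : k' = l
        · rw [h2, hkM l (by simp)]
          exact Finset.mem_image.2 ⟨k, by simp, by simp [ρ']⟩
        · exact Finset.mem_image.2 ⟨k', M.mem_part (Finset.mem_univ k'),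
            by simp [ρ', Equiv.swap_apply_of_ne_of_ne h1 h2]⟩
    · exact Finset.mem_image.2 ⟨k', M.mem_part (Finset.mem_univ k'), by simp [ρ', hi']⟩
  · rw [eq_ofPE_of_atomOf_le hτ]
    exact ofPE_mono τ hMy

theorem proper_iff (hn : 2 ≤ n) :
    ∃ T : VPart n s, (∀ x, x ≤ T) ∧
      ∀ x : VPart n s, (¬ IsTop (x : WithBot (VPart n s))) ↔ 2 ≤ rk x := by
  have hne : (Finset.univ : Finset (Fin n)) ≠ ⊥ := by
    have : Nonempty (Fin n) := ⟨⟨0, by omega⟩⟩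
    exact Finset.univ_nonempty.ne_empty
  let T : VPart n s := ofPE (Finpartition.indiscrete hne) (fun _ => 1)
  have hT : ∀ x, x ≤ T := by
    intro x
    refine ⟨fun B _ => ⟨Finset.univ, by simp [T, ofPE], Finset.subset_univ B⟩, ?_⟩
    intro i B hB B' hB' _
    have h1 : B' ∈ (Finpartition.indiscrete hne).parts := hB'
    have h2 : B' = Finset.univ := by simpa using h1
    intro v _
    show v ∈ (if B' ∈ (Finpartition.indiscrete hne).parts then
      B'.image (1 : Equiv.Perm (Fin n)) else ∅)
    rw [if_pos h1, h2]
    simp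
  have hrT : rk T = 1 := by simp [T, rk, ofPE]
  refine ⟨T, hT, fun x => ?_⟩
  constructor
  · intro h
    have hpos : 0 < rk x := Finset.card_pos.2 (x.P.parts_nonempty hne)
    by_contra hlt
    have hxT : x = T := by
      by_contra hxT
      have := rk_lt (lt_of_le_of_ne (hT x) hxT)
      omega
    apply h
    rw [hxT]
    intro b
    induction b using WithBot.recBotCoe with
    | bot => exact bot_le
    | coe b => exact WithBot.coe_le_coe.2 (hT b)
  · intro h htop
    have h1 : T ≤ x := WithBot.coe_le_coe.1 (htop (T : WithBot (VPart n s)))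
    have h2 : x = T := le_antisymm (hT x) h1
    rw [h2, hrT] at h
    omega

end VPart
section Psi

variable {m : ℕ}

/-- minimum coordinate -/
noncomputable def mu (x : Fin (m + 1) → ℝ) : ℝ := Finset.univ.inf' ⟨0, Finset.mem_univ _⟩ x

theorem mu_le (x : Fin (m + 1) → ℝ) (i : Fin (m + 1)) : mu x ≤ x i :=
  Finset.inf'_le _ (Finset.mem_univ i)

theorem exists_mu (x : Fin (m + 1) → ℝ) : ∃ i, mu x = x i := by
  obtain ⟨i, _, hi⟩ := Finset.exists_mem_eq_inf' (⟨0, Finset.mem_univ _⟩) x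
  exact ⟨i, hi⟩

theorem mu_nonneg (x : Fin (m + 1) → ℝ) (h : ∀ i, 0 ≤ x i) : 0 ≤ mu x := by
  obtain ⟨i, hi⟩ := exists_mu x
  rw [hi]; exact h i

theorem mu_eq {x : Fin (m + 1) → ℝ} {c : ℝ} (h : ∀ i, c ≤ x i) (h' : ∃ i, x i = c) : mu x = c := by
  obtain ⟨i, hi⟩ := h'
  obtain ⟨j, hj⟩ := exists_mu x
  apply le_antisymm
  · rw [← hi]; exact mu_le x i
  · rw [hj]; exact h j

theorem continuous_mu : Continuous (mu : (Fin (m + 1) → ℝ) → ℝ) := by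
  unfold mu
  apply Continuous.finset_inf'_apply
  intro i _
  exact continuous_apply i

noncomputable def psiZ (x : Fin (m + 1) → ℝ) : ℝ := ∑ i : Fin m, (x i.succ - x 0) ^ 2
noncomputable def psiD (x : Fin (m + 1) → ℝ) : ℝ := psiZ x + mu x ^ 2 + (1 - ∑ i, x i) ^ 2

theorem psiZ_nonneg (x : Fin (m + 1) → ℝ) : 0 ≤ psiZ x :=
  Finset.sum_nonneg (fun _ _ => sq_nonneg _)

theorem psiD_pos (x : Fin (m + 1) → ℝ) : 0 < psiD x := by
  have h1 := psiZ_nonneg x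
  have h2 := sq_nonneg (mu x)
  have h3 := sq_nonneg (1 - ∑ i, x i)
  have h0 : 0 ≤ psiD x := by unfold psiD; positivity
  refine lt_of_le_of_ne h0 (fun h => ?_)
  have hD : psiZ x + mu x ^ 2 + (1 - ∑ i, x i) ^ 2 = 0 := h.symm
  have hZ : psiZ x = 0 := by linarith
  have hm : mu x = 0 := by
    have : mu x ^ 2 = 0 := by linarith
    exact pow_eq_zero_iff (two_ne_zero) |>.1 this
  have hs : 1 - ∑ i, x i = 0 := by
    have : (1 - ∑ i, x i) ^ 2 = 0 := by linarith
    exact pow_eq_zero_iff (two_ne_zero) |>.1 this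
  have hz : ∀ i : Fin m, x i.succ = x 0 := by
    intro i
    have := (Finset.sum_eq_zero_iff_of_nonneg (fun i _ => sq_nonneg (x (Fin.succ i) - x 0))).1 hZ i
      (Finset.mem_univ i)
    have := pow_eq_zero_iff (two_ne_zero) |>.1 this
    linarith
  have hall : ∀ i, x i = x 0 := fun i => Fin.cases rfl hz i
  obtain ⟨j, hj⟩ := exists_mu x
  rw [hm, hall j] at hj
  have : ∑ i, x i = 0 := Finset.sum_eq_zero (fun i _ => by rw [hall i, ← hj])
  rw [this] at hs
  norm_num at hs

/-- collapse of the boundary of the simplex onto the base point of the sphere -/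
noncomputable def psi (x : Fin (m + 1) → ℝ) : EuclideanSpace ℝ (Fin (m + 1)) :=
  WithLp.toLp 2 (Fin.cons ((psiZ x + (1 - ∑ i, x i) ^ 2 - mu x ^ 2) / psiD x)
    (fun i : Fin m => 2 * mu x * (x i.succ - x 0) / psiD x) : Fin (m + 1) → ℝ)

theorem psi_zero (x : Fin (m + 1) → ℝ) :
    psi x 0 = (psiZ x + (1 - ∑ i, x i) ^ 2 - mu x ^ 2) / psiD x := rfl
theorem psi_succ (x : Fin (m + 1) → ℝ) (i : Fin m) :
    psi x i.succ = 2 * mu x * (x i.succ - x 0) / psiD x := rfl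

theorem psi_zero' (x : Fin (m + 1) → ℝ) : 1 - psi x 0 = 2 * mu x ^ 2 / psiD x := by
  have h := (psiD_pos x).ne'
  rw [psi_zero]
  field_simp
  unfold psiD
  ring

theorem continuous_psi : Continuous (psi : (Fin (m + 1) → ℝ) → _) := by
  have hm := continuous_mu (m := m)
  have hZ : Continuous (psiZ : (Fin (m + 1) → ℝ) → ℝ) := by unfold psiZ; fun_prop
  have hD : Continuous (psiD : (Fin (m + 1) → ℝ) → ℝ) := by unfold psiD; fun_prop
  have hD0 : ∀ x : Fin (m + 1) → ℝ, psiD x ≠ 0 := fun x => (psiD_pos x).ne'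
  apply (PiLp.continuous_toLp 2 _).comp
  apply continuous_pi
  intro i
  refine Fin.cases ?_ (fun i => ?_) i
  · simp only [Fin.cons_zero]
    exact Continuous.div (by fun_prop) hD hD0
  · simp only [Fin.cons_succ]
    exact Continuous.div (by fun_prop) hD hD0

theorem psi_mem (x : Fin (m + 1) → ℝ) (h : mu x = 0 ∨ ∑ i, x i = 1) :
    psi x ∈ Metric.sphere (0 : EuclideanSpace ℝ (Fin (m + 1))) 1 := by
  have hD := (psiD_pos x).ne'
  rw [mem_sphere_zero_iff_norm, EuclideanSpace.norm_eq, Real.sqrt_eq_one]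
  simp only [Real.norm_eq_abs, sq_abs]
  rw [Fin.sum_univ_succ, psi_zero]
  simp only [psi_succ]
  have : ∑ i : Fin m, (2 * mu x * (x i.succ - x 0) / psiD x) ^ 2 =
      4 * mu x ^ 2 * psiZ x / psiD x ^ 2 := by
    unfold psiZ
    rw [Finset.mul_sum, Finset.sum_div]
    apply Finset.sum_congr rfl
    intro i _
    ring
  rw [this, div_pow, ← add_div, div_eq_one_iff_eq (pow_ne_zero 2 hD)]
  unfold psiD
  rcases h with h | h
  · rw [h]; ring
  · rw [h]; ring

theorem psi_base_of_mu {x : Fin (m + 1) → ℝ} (h : mu x = 0) :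
    psi x = EuclideanSpace.single 0 1 := by
  have h0 := psi_zero' x
  rw [h] at h0
  ext i
  refine Fin.cases ?_ (fun i => ?_) i
  · simp only [PiLp.single_apply, if_true]
    have : 1 - psi x 0 = 0 := by rw [h0]; simp
    linarith
  · rw [psi_succ, h]
    simp [PiLp.single_apply]

theorem mu_of_psi_base {x : Fin (m + 1) → ℝ} (h : psi x = EuclideanSpace.single 0 1) :
    mu x = 0 := by
  have h0 := psi_zero' x
  rw [h] at h0
  have hD := (psiD_pos x)
  simp only [PiLp.single_apply, if_true, sub_self] at h0
  have h1 := (div_eq_zero_iff.1 h0.symm).resolve_right hD.ne'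
  have : mu x ^ 2 = 0 := by linarith
  exact pow_eq_zero_iff (two_ne_zero) |>.1 this

theorem psi_inj {x y : Fin (m + 1) → ℝ} (hx : 0 < mu x) (hy : 0 < mu y) (hxs : ∑ i, x i = 1)
    (hys : ∑ i, y i = 1) (h : psi x = psi y) : x = y := by
  have hDx := psiD_pos x
  have hDy := psiD_pos y
  have h0 : 2 * mu x ^ 2 / psiD x = 2 * mu y ^ 2 / psiD y := by
    rw [← psi_zero', ← psi_zero', h]
  have h1 : ∀ i : Fin m, (x i.succ - x 0) * mu y = (y i.succ - y 0) * mu x := by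
    intro i
    have h2 : 2 * mu x * (x i.succ - x 0) / psiD x = 2 * mu y * (y i.succ - y 0) / psiD y := by
      rw [← psi_succ, ← psi_succ, h]
    rw [div_eq_div_iff hDx.ne' hDy.ne'] at h0 h2
    have h3 : mu y * psiD x * ((x i.succ - x 0) * mu y - (y i.succ - y 0) * mu x) = 0 := by
      linear_combination (-(x i.succ - x 0) / 2) * h0 + (mu x / 2) * h2
    have h4 : mu y * psiD x ≠ 0 := by positivity
    have := (mul_eq_zero.1 h3).resolve_left h4
    linarith
  have h2 : ∀ i, x i * mu y - y i * mu x = x 0 * mu y - y 0 * mu x := by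
    intro i
    refine Fin.cases rfl (fun i => ?_) i
    linarith [h1 i]
  have hc : x 0 * mu y - y 0 * mu x = 0 := by
    obtain ⟨i, hi⟩ := exists_mu x
    obtain ⟨j, hj⟩ := exists_mu y
    have hi2 := h2 i
    have hj2 := h2 j
    rw [← hi] at hi2
    rw [← hj] at hj2
    have ha := mul_le_mul_of_nonneg_right (mu_le y i) hx.le
    have hb := mul_le_mul_of_nonneg_right (mu_le x j) hy.le
    nlinarith
  have h3 : ∀ i, x i * mu y = y i * mu x := fun i => by linarith [h2 i]
  have h4 : mu y = mu x := by
    have h5 : (∑ i, x i) * mu y = (∑ i, y i) * mu x := by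
      rw [Finset.sum_mul, Finset.sum_mul]
      exact Finset.sum_congr rfl (fun i _ => h3 i)
    rw [hxs, hys] at h5
    linarith
  funext i
  have := h3 i
  rw [h4] at this
  exact mul_right_cancel₀ hx.ne' this

theorem psi_surj (p : EuclideanSpace ℝ (Fin (m + 1)))
    (hp : p ∈ Metric.sphere (0 : EuclideanSpace ℝ (Fin (m + 1))) 1)
    (hne : p ≠ EuclideanSpace.single 0 1) :
    ∃ x : Fin (m + 1) → ℝ, 0 < mu x ∧ ∑ i, x i = 1 ∧ psi x = p := by
  rw [mem_sphere_zero_iff_norm, EuclideanSpace.norm_eq, Real.sqrt_eq_one] at hp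
  simp only [Real.norm_eq_abs, sq_abs] at hp
  rw [Fin.sum_univ_succ] at hp
  have hS0 : 0 ≤ ∑ i : Fin m, p i.succ ^ 2 := Finset.sum_nonneg (fun _ _ => sq_nonneg _)
  have hp0 : p 0 < 1 := by
    refine lt_of_le_of_ne (by nlinarith) (fun h => hne ?_)
    rw [h] at hp
    have hS : ∑ i : Fin m, p i.succ ^ 2 = 0 := by linarith
    have := (Finset.sum_eq_zero_iff_of_nonneg (fun i _ => sq_nonneg (p (Fin.succ i)))).1 hS
    ext i
    refine Fin.cases ?_ (fun i => ?_) i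
    · simp [h]
    · have h2 := pow_eq_zero_iff (two_ne_zero) |>.1 (this i (Finset.mem_univ i))
      simp [h2]
  have hd : 0 < 1 - p 0 := by linarith
  let a : Fin (m + 1) → ℝ := Fin.cons 0 (fun i => p i.succ / (1 - p 0))
  let b : Fin (m + 1) → ℝ := fun i => a i - mu a + 1
  have hb1 : ∀ i, 1 ≤ b i := fun i => by have := mu_le a i; simp only [b]; linarith
  have hbs : 0 < ∑ i, b i := Finset.sum_pos (fun i _ => by linarith [hb1 i])
    ⟨0, Finset.mem_univ _⟩
  set S := ∑ i, b i with hS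
  let x : Fin (m + 1) → ℝ := fun i => b i / S
  have hmu : mu x = 1 / S := by
    apply mu_eq
    · intro i
      exact div_le_div_of_nonneg_right (hb1 i) hbs.le
    · obtain ⟨i, hi⟩ := exists_mu a
      refine ⟨i, ?_⟩
      simp only [x, b, hi]
      ring
  have hsum : ∑ i, x i = 1 := by
    simp only [x]
    rw [← Finset.sum_div, ← hS]
    exact div_self hbs.ne'
  have hz : ∀ i : Fin m, x i.succ - x 0 = p i.succ / (1 - p 0) / S := by
    intro i
    simp only [x, b, a, Fin.cons_succ, Fin.cons_zero]
    ring
  have hZ : psiZ x = (∑ i : Fin m, p i.succ ^ 2) / ((1 - p 0) ^ 2 * S ^ 2) := by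
    unfold psiZ
    rw [Finset.sum_div]
    apply Finset.sum_congr rfl
    intro i _
    rw [hz]
    field_simp
  have hD : psiD x = 2 / ((1 - p 0) * S ^ 2) := by
    unfold psiD
    rw [hZ, hsum, hmu]
    have : ∑ i : Fin m, p i.succ ^ 2 = 1 - p 0 ^ 2 := by linarith
    rw [this]
    field_simp
    ring
  refine ⟨x, by rw [hmu]; positivity, hsum, ?_⟩
  ext i
  refine Fin.cases ?_ (fun i => ?_) i
  · have h1 := psi_zero' x
    rw [hD, hmu] at h1
    have : 2 * (1 / S) ^ 2 / (2 / ((1 - p 0) * S ^ 2)) = 1 - p 0 := by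
      field_simp
    linarith
  · rw [psi_succ, hD, hmu, hz]
    field_simp

end Psi
section Collapse

open unitInterval

theorem homotopyEquiv_of_collapse {X W : Type*} [TopologicalSpace X] [TopologicalSpace W]
    [CompactSpace X] [T2Space W] (q : C(X, W)) (hq : Function.Surjective q) (A : Set X)
    (hqA : ∀ x y, q x = q y → x = y ∨ (x ∈ A ∧ y ∈ A))
    (hqA' : ∀ x y, x ∈ A → y ∈ A → q x = q y)
    (G : C(I × X, X)) (h0 : ∀ x, G (0, x) = x) (hA : ∀ t, ∀ x ∈ A, G (t, x) ∈ A)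
    (h1 : ∀ x ∈ A, ∀ y ∈ A, G (1, x) = G (1, y)) :
    Nonempty (ContinuousMap.HomotopyEquiv X W) := by
  have hqq : Topology.IsQuotientMap q :=
    q.continuous.isClosedMap.isQuotientMap q.continuous hq
  let q2 : C(I × X, I × W) := (ContinuousMap.id I).prodMap q
  have hq2s : Function.Surjective q2 := by
    rintro ⟨t, w⟩
    obtain ⟨x, rfl⟩ := hq w
    exact ⟨(t, x), rfl⟩
  have hqq2 : Topology.IsQuotientMap q2 :=
    q2.continuous.isClosedMap.isQuotientMap q2.continuous hq2s
  let G1 : C(X, X) := G.comp ⟨fun x => (1, x), by fun_prop⟩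
  have hG1 : ∀ x y, q x = q y → G1 x = G1 y := by
    intro x y h
    rcases hqA x y h with rfl | ⟨hx, hy⟩
    · rfl
    · exact h1 x hx y hy
  let g : C(W, X) := hqq.lift G1 (fun x y h => hG1 x y h)
  have hg : ∀ x, g (q x) = G (1, x) := fun x =>
    DFunLike.congr_fun (hqq.lift_comp G1 (fun x y h => hG1 x y h)) x
  have hqG : ∀ a b : I × X, q2 a = q2 b → (q.comp G) a = (q.comp G) b := by
    rintro ⟨t, x⟩ ⟨u, y⟩ h
    have ht : t = u := congrArg Prod.fst h
    have hx : q x = q y := congrArg Prod.snd h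
    subst ht
    rcases hqA x y hx with rfl | ⟨hx, hy⟩
    · rfl
    · exact hqA' _ _ (hA t x hx) (hA t y hy)
  let L : C(I × W, W) := hqq2.lift (q.comp G) (fun x y h => hqG x y h)
  have hL : ∀ t x, L (t, q x) = q (G (t, x)) := fun t x =>
    DFunLike.congr_fun (hqq2.lift_comp (q.comp G) (fun x y h => hqG x y h)) (t, x)
  refine ⟨⟨q, g, ?_, ?_⟩⟩
  · refine ContinuousMap.Homotopic.symm ⟨⟨G, ?_, ?_⟩⟩
    · intro x; exact h0 x
    · intro x; exact (hg x).symm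
  · refine ContinuousMap.Homotopic.symm ⟨⟨L, ?_, ?_⟩⟩
    · intro w
      obtain ⟨x, rfl⟩ := hq w
      change L (0, q x) = q x
      rw [hL, h0]
    · intro w
      obtain ⟨x, rfl⟩ := hq w
      change L (1, q x) = q (g (q x))
      rw [hL, hg]

variable {N m : ℕ}

/-- coordinates of the embedding of the wedge in a product of spheres -/
noncomputable def iotaPre : Unit ⊕ (Fin N × Sph m) → (Fin N → Sph m)
  | .inl _ => fun _ => basePt m
  | .inr x => fun i => if i = x.1 then x.2 else basePt m

theorem iotaPre_base {p : Unit ⊕ (Fin N × Sph m)} (h : isBase p) :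
    iotaPre p = fun _ => basePt m := by
  rcases p with p | ⟨j, x⟩
  · rfl
  · have h' : x = basePt m := h
    subst h'
    funext i
    simp [iotaPre]

noncomputable def iota : Wedge N m → (Fin N → Sph m) :=
  Quotient.lift iotaPre (by
    intro a b h
    rcases h with rfl | ⟨h1, h2⟩
    · rfl
    · rw [iotaPre_base h1, iotaPre_base h2])

theorem continuous_iota : Continuous (iota : Wedge N m → _) := by
  apply Continuous.quotient_lift
  apply continuous_sum_dom.2
  constructor
  · exact continuous_const
  · apply continuous_pi
    intro i
    change Continuous (fun x : Fin N × Sph m => if i = x.1 then x.2 else basePt m)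
    rw [continuous_iff_continuousAt]
    rintro ⟨j, x⟩
    have hU : IsOpen {y : Fin N × Sph m | y.1 = j} :=
      (isOpen_discrete {j}).preimage continuous_fst
    have hmem : {y : Fin N × Sph m | y.1 = j} ∈ nhds (j, x) := hU.mem_nhds rfl
    by_cases hij : i = j
    · have h1 : ContinuousAt (fun y : Fin N × Sph m => y.2) (j, x) := continuous_snd.continuousAt
      refine h1.congr ?_
      filter_upwards [hmem] with y hy
      rw [if_pos (hij.trans hy.symm)]
    · have h1 : ContinuousAt (fun y : Fin N × Sph m => basePt m) (j, x) := continuousAt_const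
      refine h1.congr ?_
      filter_upwards [hmem] with y hy
      rw [if_neg]
      intro h
      exact hij (h.trans hy)

theorem isBase_of_iotaPre {p : Unit ⊕ (Fin N × Sph m)} (h : iotaPre p = fun _ => basePt m) :
    isBase p := by
  rcases p with p | ⟨j, x⟩
  · trivial
  · have := congrFun h j
    have h2 : x = basePt m := by simpa [iotaPre] using this
    exact h2

theorem iota_injective : Function.Injective (iota : Wedge N m → _) := by
  intro a b
  induction a using Quotient.inductionOn with | _ a
  induction b using Quotient.inductionOn with | _ b
  intro h
  have h : iotaPre a = iotaPre b := h
  apply Quotient.sound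
  by_cases ha : isBase a
  · right
    rw [iotaPre_base ha] at h
    exact ⟨ha, isBase_of_iotaPre h.symm⟩
  · left
    have hb : ¬ isBase b := fun hb => ha (isBase_of_iotaPre (h.trans (iotaPre_base hb)))
    rcases a with a | ⟨j, x⟩
    · exact absurd trivial ha
    rcases b with b | ⟨k, y⟩
    · exact absurd trivial hb
    have hj := congrFun h j
    simp only [iotaPre, if_true] at hj
    split_ifs at hj with hjk
    · subst hjk; rw [hj]
    · exact absurd hj ha

instance : CompactSpace (Wedge N m) := by
  unfold Wedge
  exact Quotient.compactSpace

theorem isClosedEmbedding_iota : Topology.IsClosedEmbedding (iota : Wedge N m → _) :=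
  continuous_iota.isClosedEmbedding iota_injective

theorem t2_wedge : T2Space (Wedge N m) := isClosedEmbedding_iota.isEmbedding.t2Space

end Collapse
section Facets

set_option linter.unusedSectionVars false

open unitInterval

variable {V : Type*} [Fintype V] [DecidableEq V]

theorem compact_realization {K : Set (Finset V)} (hK : DownCl K) :
    CompactSpace (realization K) := by
  have key : IsCompact {f : V → ℝ | (∀ v, 0 ≤ f v) ∧
      ∃ F ∈ K, (∀ v, f v ≠ 0 ↔ v ∈ F) ∧ ∑ v ∈ F, f v = 1} := by
    have e : {f : V → ℝ | (∀ v, 0 ≤ f v) ∧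
        ∃ F ∈ K, (∀ v, f v ≠ 0 ↔ v ∈ F) ∧ ∑ v ∈ F, f v = 1} =
        ⋃ F ∈ K, {f : V → ℝ | (∀ v, 0 ≤ f v) ∧ (∀ v, v ∉ F → f v = 0) ∧ ∑ v, f v = 1} := by
      ext f
      rw [Set.mem_ofPred_eq, realization_iff]
      simp only [Set.mem_iUnion, Set.mem_ofPred_eq]
      constructor
      · rintro ⟨h0, hs, h1⟩
        refine ⟨fsupp f, hs, h0, fun v hv => ?_, h1⟩
        by_contra h
        exact hv (mem_fsupp.2 h)
      · rintro ⟨F, hF, h0, hs, h1⟩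
        refine ⟨h0, hK F hF _ ?_, h1⟩
        intro v hv
        by_contra h
        exact (mem_fsupp.1 hv) (hs v h)
    rw [e]
    apply (Set.toFinite K).isCompact_biUnion
    intro F _
    apply IsCompact.of_isClosed_subset (isCompact_Icc (a := (0 : V → ℝ)) (b := 1))
    · simp only [Set.ofPred_and, Set.ofPred_forall]
      refine IsClosed.inter ?_ (IsClosed.inter ?_ ?_)
      · exact isClosed_iInter fun v => isClosed_le continuous_const (continuous_apply v)
      · exact isClosed_iInter fun v => isClosed_iInter fun _ =>
          isClosed_eq (continuous_apply v) continuous_const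
      · exact isClosed_eq (by fun_prop) continuous_const
    · rintro f ⟨h0, _, h1⟩
      refine ⟨fun v => h0 v, fun v => ?_⟩
      change f v ≤ 1
      rw [← h1]
      exact Finset.single_le_sum (fun w _ => h0 w) (Finset.mem_univ v)
  exact isCompact_iff_compactSpace.1 key

/-- an enumeration of a set `C` of `m`-dimensional facets of `K` -/
structure Facets (K C : Set (Finset V)) (N m : ℕ) where
  F : Fin N → Fin (m + 1) → V
  inj : ∀ j, Function.Injective (F j)
  mem : ∀ j, Finset.univ.image (F j) ∈ C
  surj : ∀ c ∈ C, ∃ j, Finset.univ.image (F j) = c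
  dist : ∀ j j', Finset.univ.image (F j) = Finset.univ.image (F j') → j = j'
  hmax : ∀ c ∈ K, c.card ≤ m + 1
  hK : DownCl K
  hCK : ∀ c ∈ C, c ∈ K

namespace Facets

variable {K C : Set (Finset V)} {N m : ℕ} (Z : Facets K C N m)

/-- coordinates on the j-th facet -/
def co (j : Fin N) (f : V → ℝ) : Fin (m + 1) → ℝ := fun i => f (Z.F j i)

noncomputable def nu (j : Fin N) (f : V → ℝ) : ℝ := mu (Z.co j f)

theorem continuous_co (j : Fin N) : Continuous (Z.co j) := by unfold co; fun_prop
theorem continuous_nu (j : Fin N) : Continuous (Z.nu j) :=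
  continuous_mu.comp (Z.continuous_co j)

theorem nu_nonneg (j : Fin N) (f : realization K) : 0 ≤ Z.nu j f.1 :=
  mu_nonneg _ (fun _ => f.nonneg _)

theorem card_image (j : Fin N) : (Finset.univ.image (Z.F j)).card = m + 1 := by
  rw [Finset.card_image_of_injective _ (Z.inj j)]; simp

theorem supp_of_pos {j : Fin N} {f : realization K} (h : 0 < Z.nu j f.1) :
    Finset.univ.image (Z.F j) = fsupp f.1 := by
  apply Finset.eq_of_subset_of_card_le
  · intro v hv
    obtain ⟨i, _, rfl⟩ := Finset.mem_image.1 hv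
    have := mu_le (Z.co j f.1) i
    exact mem_fsupp.2 (ne_of_gt (lt_of_lt_of_le h this))
  · rw [Z.card_image]
    exact Z.hmax _ f.supp

theorem sum_of_pos {j : Fin N} {f : realization K} (h : 0 < Z.nu j f.1) :
    ∑ i, Z.co j f.1 i = 1 := by
  have h1 : ∑ v ∈ Finset.univ.image (Z.F j), f.1 v = 1 := by
    rw [Z.supp_of_pos h]
    refine Eq.trans ?_ f.sum
    apply Finset.sum_subset (Finset.subset_univ _)
    intro v _ hv
    by_contra h
    exact hv (mem_fsupp.2 h)
  rw [Finset.sum_image (fun _ _ _ _ h => Z.inj j h)] at h1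
  exact h1

theorem pos_unique {j j' : Fin N} {f : realization K} (h : 0 < Z.nu j f.1)
    (h' : 0 < Z.nu j' f.1) : j = j' :=
  Z.dist _ _ ((Z.supp_of_pos h).trans (Z.supp_of_pos h').symm)

theorem cases (f : realization K) : (∀ j, Z.nu j f.1 = 0) ∨
    ∃ j, 0 < Z.nu j f.1 ∧ ∀ j', j' ≠ j → Z.nu j' f.1 = 0 := by
  by_cases h : ∀ j, Z.nu j f.1 = 0
  · exact Or.inl h
  · right
    push Not at h
    obtain ⟨j, hj⟩ := h
    have hj' := lt_of_le_of_ne (Z.nu_nonneg j f) (Ne.symm hj)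
    refine ⟨j, hj', fun j' hne => ?_⟩
    by_contra h
    exact hne (Z.pos_unique (lt_of_le_of_ne (Z.nu_nonneg j' f) (Ne.symm h)) hj')

theorem zero_iff (f : realization K) : (∀ j, Z.nu j f.1 = 0) ↔ fsupp f.1 ∈ K \ C := by
  constructor
  · intro h
    refine ⟨f.supp, fun hC => ?_⟩
    obtain ⟨j, hj⟩ := Z.surj _ hC
    obtain ⟨i, hi⟩ := exists_mu (Z.co j f.1)
    have h1 : f.1 (Z.F j i) = 0 := hi.symm.trans (h j)
    have h2 : Z.F j i ∈ fsupp f.1 := by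
      rw [← hj]; exact Finset.mem_image_of_mem _ (Finset.mem_univ i)
    exact mem_fsupp.1 h2 h1
  · rintro ⟨_, hC⟩ j
    by_contra h
    have hj := lt_of_le_of_ne (Z.nu_nonneg j f) (Ne.symm h)
    exact hC (Z.supp_of_pos hj ▸ Z.mem j)

/-- the map to the product of spheres -/
noncomputable def Phi (f : realization K) : Fin N → Sph m := fun j =>
  ⟨psi (Z.co j f.1), psi_mem _ (by
    by_cases h : Z.nu j f.1 = 0
    · exact Or.inl h
    · exact Or.inr (Z.sum_of_pos (lt_of_le_of_ne (Z.nu_nonneg j f) (Ne.symm h))))⟩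

theorem continuous_Phi : Continuous Z.Phi := by
  apply continuous_pi
  intro j
  exact (continuous_psi.comp ((Z.continuous_co j).comp (continuous_val K))).subtype_mk _

theorem Phi_base {f : realization K} {j : Fin N} : Z.Phi f j = basePt m ↔ Z.nu j f.1 = 0 := by
  constructor
  · intro h
    exact mu_of_psi_base (congrArg Subtype.val h)
  · intro h
    exact Subtype.ext (psi_base_of_mu h)

theorem exists_q (f : realization K) : ∃ w : Wedge N m, iota w = Z.Phi f := by
  rcases Z.cases f with h | ⟨j, hj, h⟩
  · refine ⟨Quotient.mk _ (.inl ()), ?_⟩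
    funext j
    exact (Z.Phi_base.2 (h j)).symm
  · refine ⟨Quotient.mk _ (.inr (j, Z.Phi f j)), ?_⟩
    funext j'
    change (if j' = j then Z.Phi f j else basePt m) = Z.Phi f j'
    split_ifs with e
    · rw [e]
    · exact (Z.Phi_base.2 (h j' e)).symm

noncomputable def qf (f : realization K) : Wedge N m := (Z.exists_q f).choose
theorem iota_qf (f : realization K) : iota (Z.qf f) = Z.Phi f := (Z.exists_q f).choose_spec

noncomputable def q : C(realization K, Wedge N m) :=
  ⟨Z.qf, by
    rw [isClosedEmbedding_iota.isEmbedding.continuous_iff]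
    have : iota ∘ Z.qf = Z.Phi := funext Z.iota_qf
    rw [this]
    exact Z.continuous_Phi⟩

theorem iota_q (f : realization K) : iota (Z.q f) = Z.Phi f := Z.iota_qf f

/-- the points not in the interior of a distinguished facet -/
def A : Set (realization K) := {f | ∀ j, Z.nu j f.1 = 0}

theorem q_A (f g : realization K) (hf : f ∈ Z.A) (hg : g ∈ Z.A) : Z.q f = Z.q g := by
  apply iota_injective
  rw [iota_q, iota_q]
  funext j
  rw [Z.Phi_base.2 (hf j), Z.Phi_base.2 (hg j)]

theorem q_eq (f g : realization K) (h : Z.q f = Z.q g) : f = g ∨ (f ∈ Z.A ∧ g ∈ Z.A) := by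
  have h1 : Z.Phi f = Z.Phi g := by rw [← iota_q, ← iota_q, h]
  have h2 : ∀ j, Z.nu j f.1 = 0 ↔ Z.nu j g.1 = 0 := fun j => by
    rw [← Z.Phi_base, ← Z.Phi_base, h1]
  rcases Z.cases f with hf | ⟨j, hj, _⟩
  · exact Or.inr ⟨hf, fun j => (h2 j).1 (hf j)⟩
  · left
    have hg : 0 < Z.nu j g.1 :=
      lt_of_le_of_ne (Z.nu_nonneg j g) (fun e => hj.ne' ((h2 j).2 e.symm))
    have h3 : Z.co j f.1 = Z.co j g.1 :=
      psi_inj hj hg (Z.sum_of_pos hj) (Z.sum_of_pos hg) (congrArg Subtype.val (congrFun h1 j))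
    have hs := Z.supp_of_pos hj
    have hs' := Z.supp_of_pos hg
    apply Subtype.ext
    funext v
    by_cases hv : v ∈ Finset.univ.image (Z.F j)
    · obtain ⟨i, _, rfl⟩ := Finset.mem_image.1 hv
      exact congrFun h3 i
    · have e1 : f.1 v = 0 := by
        by_contra h; exact hv (hs ▸ mem_fsupp.2 h)
      have e2 : g.1 v = 0 := by
        by_contra h; exact hv (hs' ▸ mem_fsupp.2 h)
      rw [e1, e2]

theorem q_surj (a : realization K) (ha : a ∈ Z.A) : Function.Surjective Z.q := by
  intro w
  have hbase : ∀ w : Wedge N m, (iota w = fun _ => basePt m) → ∃ f, Z.q f = w := by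
    intro w hw
    refine ⟨a, iota_injective ?_⟩
    rw [iota_q, hw]
    funext j
    exact Z.Phi_base.2 (ha j)
  induction w using Quotient.inductionOn with | _ p
  by_cases hb : isBase p
  · exact hbase _ (iotaPre_base hb)
  · rcases p with p | ⟨j, x⟩
    · exact absurd trivial hb
    · obtain ⟨y, hy0, hy1, hy⟩ := psi_surj x.1 x.2 (fun h => hb (Subtype.ext h))
      let f : V → ℝ := fun v => ∑ i, if Z.F j i = v then y i else 0
      have hypos : ∀ i, 0 < y i := fun i => lt_of_lt_of_le hy0 (mu_le y i)
      have hfi : ∀ i, f (Z.F j i) = y i := by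
        intro i
        simp only [f]
        rw [Finset.sum_eq_single i]
        · simp
        · intro k _ hk
          rw [if_neg]
          exact fun e => hk (Z.inj j e)
        · simp
      have hf0 : ∀ v, v ∉ Finset.univ.image (Z.F j) → f v = 0 := by
        intro v hv
        apply Finset.sum_eq_zero
        intro i _
        rw [if_neg]
        rintro rfl
        exact hv (Finset.mem_image_of_mem _ (Finset.mem_univ i))
      have hsupp : fsupp f = Finset.univ.image (Z.F j) := by
        ext v
        rw [mem_fsupp]
        constructor
        · intro h
          by_contra h'
          exact h (hf0 v h')
        · intro hv
          obtain ⟨i, _, rfl⟩ := Finset.mem_image.1 hv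
          rw [hfi]
          exact (hypos i).ne'
      let g : realization K := mkR K f
        (fun v => Finset.sum_nonneg fun i _ => by split_ifs; exacts [(hypos i).le, le_rfl])
        (hsupp ▸ Z.hCK _ (Z.mem j))
        (by
          simp only [f]
          rw [Finset.sum_comm]
          simpa using hy1)
      have hco : Z.co j g.1 = y := funext hfi
      have hnu : 0 < Z.nu j g.1 := by unfold nu; rw [hco]; exact hy0
      refine ⟨g, iota_injective ?_⟩
      rw [iota_q]
      funext j'
      change _ = (if j' = j then x else basePt m)
      split_ifs with e
      · subst e
        apply Subtype.ext
        change psi (Z.co j' g.1) = x.1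
        rw [hco, hy]
      · rw [Phi_base]
        by_contra h
        exact e (Z.pos_unique (lt_of_le_of_ne (Z.nu_nonneg j' g) (Ne.symm h)) hnu)

end Facets

end Facets
section Hep

set_option linter.unusedSectionVars false

open unitInterval

variable {V : Type*} [Fintype V] [DecidableEq V]

namespace Facets

variable {K C : Set (Finset V)} {N m : ℕ} (Z : Facets K C N m)

/-- amount to be removed from the facet `j` -/
noncomputable def dd (t : ℝ) (f : V → ℝ) (j : Fin N) : ℝ :=
  min (Z.nu j f) (1 / (2 * ((m : ℝ) + 1)) * t)

noncomputable def Rf (t : ℝ) (f : V → ℝ) : V → ℝ := fun v =>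
  (f v - ∑ j, Z.dd t f j * (if v ∈ Finset.univ.image (Z.F j) then 1 else 0)) /
    (1 - ((m : ℝ) + 1) * ∑ j, Z.dd t f j)

noncomputable def SS (f : V → ℝ) : ℝ := ∑ j, Z.nu j f

theorem continuous_SS : Continuous Z.SS :=
  continuous_finsetSum _ (fun j _ => Z.continuous_nu j)

theorem dd_zero {t : ℝ} (ht : 0 ≤ t) {f : V → ℝ} {j : Fin N} (h : Z.nu j f = 0) :
    Z.dd t f j = 0 := by
  unfold dd
  rw [h]
  exact min_eq_left (by positivity)

theorem Rf_of_zero {t : ℝ} (ht : 0 ≤ t) {f : V → ℝ} (h : ∀ j, Z.nu j f = 0) :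
    Z.Rf t f = f := by
  funext v
  simp [Rf, Z.dd_zero ht (h _)]

theorem Rf_of_pos {t : ℝ} (ht : 0 ≤ t) {f : V → ℝ} {j : Fin N}
    (h : ∀ j', j' ≠ j → Z.nu j' f = 0) (v : V) :
    Z.Rf t f v = (f v - Z.dd t f j * (if v ∈ Finset.univ.image (Z.F j) then 1 else 0)) /
      (1 - ((m : ℝ) + 1) * Z.dd t f j) := by
  unfold Rf
  rw [Finset.sum_eq_single j, Finset.sum_eq_single j]
  · intro k _ hk
    exact Z.dd_zero ht (h k hk)
  · simp
  · intro k _ hk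
    rw [Z.dd_zero ht (h k hk), zero_mul]
  · simp

theorem SS_of_pos {f : V → ℝ} {j : Fin N} (h : ∀ j', j' ≠ j → Z.nu j' f = 0) :
    Z.SS f = Z.nu j f := by
  unfold SS
  rw [Finset.sum_eq_single j]
  · intro k _ hk
    exact h k hk
  · simp

theorem dd_le {t : ℝ} (ht1 : t ≤ 1) (f : V → ℝ) (j : Fin N) :
    ((m : ℝ) + 1) * Z.dd t f j ≤ 1 / 2 := by
  have h : Z.dd t f j ≤ 1 / (2 * ((m : ℝ) + 1)) * t := min_le_right _ _
  have h2 : 1 / (2 * ((m : ℝ) + 1)) * t ≤ 1 / (2 * ((m : ℝ) + 1)) :=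
    mul_le_of_le_one_right (by positivity) ht1
  calc ((m : ℝ) + 1) * Z.dd t f j ≤ ((m : ℝ) + 1) * (1 / (2 * ((m : ℝ) + 1))) :=
        mul_le_mul_of_nonneg_left (h.trans h2) (by positivity)
    _ = 1 / 2 := by field_simp

theorem den_pos {t : ℝ} (ht : 0 ≤ t) (ht1 : t ≤ 1) (f : realization K) :
    0 < 1 - ((m : ℝ) + 1) * ∑ j, Z.dd t f.1 j := by
  rcases Z.cases f with h | ⟨j, hj, h⟩
  · rw [Finset.sum_eq_zero (fun j _ => Z.dd_zero ht (h j))]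
    norm_num
  · rw [Finset.sum_eq_single j (fun k _ hk => Z.dd_zero ht (h k hk)) (by simp)]
    linarith [Z.dd_le ht1 f.1 j]

theorem Rf_supp {t : ℝ} (ht : 0 ≤ t) (f : realization K) :
    fsupp (Z.Rf t f.1) ⊆ fsupp f.1 := by
  rcases Z.cases f with h | ⟨j, hj, h⟩
  · rw [Z.Rf_of_zero ht h]
  · intro v hv
    rw [mem_fsupp, Z.Rf_of_pos ht h] at hv
    by_contra hv'
    have h2 := hv'
    rw [← Z.supp_of_pos hj] at h2
    have h3 : f.1 v = 0 := by
      by_contra h; exact hv' (mem_fsupp.2 h)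
    apply hv
    rw [if_neg h2, h3]
    simp

theorem Rf_nonneg {t : ℝ} (ht : 0 ≤ t) (ht1 : t ≤ 1) (f : realization K) (v : V) :
    0 ≤ Z.Rf t f.1 v := by
  rcases Z.cases f with h | ⟨j, hj, h⟩
  · rw [Z.Rf_of_zero ht h]; exact f.nonneg v
  · rw [Z.Rf_of_pos ht h]
    apply div_nonneg _ (by linarith [Z.dd_le ht1 f.1 j])
    split_ifs with hv
    · obtain ⟨i, _, rfl⟩ := Finset.mem_image.1 hv
      have h1 : Z.dd t f.1 j ≤ Z.nu j f.1 := min_le_left _ _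
      have h2 : Z.nu j f.1 ≤ f.1 (Z.F j i) := mu_le (Z.co j f.1) i
      linarith
    · have := f.nonneg v
      linarith

theorem Rf_sum {t : ℝ} (ht : 0 ≤ t) (ht1 : t ≤ 1) (f : realization K) :
    ∑ v, Z.Rf t f.1 v = 1 := by
  rcases Z.cases f with h | ⟨j, hj, h⟩
  · rw [Z.Rf_of_zero ht h]; exact f.sum
  · simp_rw [Z.Rf_of_pos ht h]
    have hsum := f.sum
    generalize f.1 = g at *
    rw [← Finset.sum_div, Finset.sum_sub_distrib, ← Finset.mul_sum, hsum]
    have h1 : ∑ v, (if v ∈ Finset.univ.image (Z.F j) then (1 : ℝ) else 0) = (m : ℝ) + 1 := by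
      rw [Finset.sum_ite_mem, Finset.univ_inter, Finset.sum_const, Z.card_image]
      simp
    rw [h1, mul_comm]
    apply div_self
    have := Z.dd_le ht1 g j
    linarith

theorem Rf_mem {t : ℝ} (ht : 0 ≤ t) (f : realization K)
    (hS : Z.SS f.1 ≤ 1 / (2 * ((m : ℝ) + 1)) * t) : fsupp (Z.Rf t f.1) ∈ K \ C := by
  rcases Z.cases f with h | ⟨j, hj, h⟩
  · rw [Z.Rf_of_zero ht h]; exact (Z.zero_iff f).1 h
  · rw [Z.SS_of_pos h] at hS
    have hd : Z.dd t f.1 j = Z.nu j f.1 := min_eq_left hS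
    refine ⟨Z.hK _ f.supp _ (Z.Rf_supp ht f), fun hC => ?_⟩
    obtain ⟨k, hk⟩ := Z.surj _ hC
    have h1 := Z.Rf_supp ht f
    have h2 : fsupp (Z.Rf t f.1) = fsupp f.1 := by
      apply Finset.eq_of_subset_of_card_le h1
      rw [← hk, Z.card_image]
      exact Z.hmax _ f.supp
    obtain ⟨i, hi⟩ := exists_mu (Z.co j f.1)
    have hi' : Z.nu j f.1 = f.1 (Z.F j i) := hi
    have h3 : Z.F j i ∈ Finset.univ.image (Z.F j) :=
      Finset.mem_image_of_mem _ (Finset.mem_univ i)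
    have h4 : Z.F j i ∈ fsupp (Z.Rf t f.1) := by
      rw [h2, ← Z.supp_of_pos hj]; exact h3
    rw [mem_fsupp, Z.Rf_of_pos ht h, if_pos h3, hd, hi'] at h4
    simp at h4

noncomputable def RK (p : I × realization K) : realization K :=
  mkR K (Z.Rf p.1 p.2.1) (Z.Rf_nonneg p.1.2.1 p.1.2.2 p.2)
    (Z.hK _ p.2.supp _ (Z.Rf_supp p.1.2.1 p.2)) (Z.Rf_sum p.1.2.1 p.1.2.2 p.2)

noncomputable def RA (p : I × realization K)
    (h : Z.SS p.2.1 ≤ 1 / (2 * ((m : ℝ) + 1)) * p.1) : realization (K \ C) :=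
  mkR (K \ C) (Z.Rf p.1 p.2.1) (Z.Rf_nonneg p.1.2.1 p.1.2.2 p.2)
    (Z.Rf_mem p.1.2.1 p.2 h) (Z.Rf_sum p.1.2.1 p.1.2.2 p.2)

theorem continuous_Rf :
    Continuous (fun p : I × realization K => Z.Rf p.1 p.2.1) := by
  have hv : Continuous (fun p : I × realization K => p.2.1) :=
    (continuous_val K).comp continuous_snd
  have hd : ∀ j, Continuous (fun p : I × realization K => Z.dd p.1 p.2.1 j) := by
    intro j
    unfold dd
    exact ((Z.continuous_nu j).comp hv).min (by fun_prop)
  apply continuous_pi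
  intro v
  unfold Rf
  apply Continuous.div
  · apply Continuous.sub
    · exact (continuous_apply v).comp hv
    · exact continuous_finsetSum _ (fun j _ => (hd j).mul continuous_const)
  · exact continuous_const.sub (continuous_const.mul (continuous_finsetSum _ (fun j _ => hd j)))
  · intro p
    exact (Z.den_pos p.1.2.1 p.1.2.2 p.2).ne'

def incl (f : realization (K \ C)) : realization K :=
  mkR K f.1 f.nonneg f.supp.1 f.sum

theorem continuous_incl : Continuous (incl : realization (K \ C) → realization K) :=
  (continuous_val _).subtype_mk _

open Classical in
noncomputable def GG (H : C(I × realization (K \ C), realization (K \ C)))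
    (p : I × realization K) : realization K :=
  if h : Z.SS p.2.1 ≤ 1 / (2 * ((m : ℝ) + 1)) * p.1 then
    incl (H (Set.projIcc (0 : ℝ) 1 zero_le_one (p.1 - Z.SS p.2.1 * (2 * ((m : ℝ) + 1))),
      Z.RA p h))
  else Z.RK p

theorem continuous_GG (H : C(I × realization (K \ C), realization (K \ C)))
    (hH : ∀ x, H (0, x) = x) : Continuous (Z.GG H) := by
  have hv : Continuous (fun p : I × realization K => p.2.1) :=
    (continuous_val K).comp continuous_snd
  have hS : Continuous (fun p : I × realization K => Z.SS p.2.1) := Z.continuous_SS.comp hv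
  have ht : Continuous (fun p : I × realization K => 1 / (2 * ((m : ℝ) + 1)) * (p.1 : ℝ)) := by
    fun_prop
  let s : Set (I × realization K) := {p | Z.SS p.2.1 ≤ 1 / (2 * ((m : ℝ) + 1)) * p.1}
  let u : Set (I × realization K) := {p | 1 / (2 * ((m : ℝ) + 1)) * p.1 ≤ Z.SS p.2.1}
  have hs : IsClosed s := isClosed_le hS ht
  have hu : IsClosed u := isClosed_le ht hS
  have h1 : ContinuousOn (Z.GG H) s := by
    rw [continuousOn_iff_continuous_domRestrict]
    have e : s.domRestrict (Z.GG H) = fun p : s => incl (H (Set.projIcc (0 : ℝ) 1 zero_le_one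
        (p.1.1 - Z.SS p.1.2.1 * (2 * ((m : ℝ) + 1))), Z.RA p.1 p.2)) := by
      funext p
      exact dif_pos p.2
    rw [e]
    apply continuous_incl.comp
    apply H.continuous.comp
    apply Continuous.prodMk
    · apply continuous_projIcc.comp
      apply Continuous.sub
      · fun_prop
      · exact (hS.comp continuous_subtype_val).mul continuous_const
    · exact (Z.continuous_Rf.comp continuous_subtype_val).subtype_mk _
  have h2 : ContinuousOn (Z.GG H) u := by
    have hR : Continuous Z.RK := Z.continuous_Rf.subtype_mk _
    refine hR.continuousOn.congr ?_
    intro p hp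
    have hp : 1 / (2 * ((m : ℝ) + 1)) * p.1 ≤ Z.SS p.2.1 := hp
    unfold GG
    split_ifs with h
    · have e : (p.1 : ℝ) - Z.SS p.2.1 * (2 * ((m : ℝ) + 1)) = 0 := by
        rw [le_antisymm h hp]
        field_simp
        ring
      rw [e, Set.projIcc_left]
      change incl (H (0, _)) = _
      rw [hH]
      rfl
    · rfl
  rw [← continuousOn_univ]
  have e : (Set.univ : Set (I × realization K)) = s ∪ u := by
    ext p
    have h3 : p ∈ s ∪ u := le_total (Z.SS p.2.1) (1 / (2 * ((m : ℝ) + 1)) * (p.1 : ℝ))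
    exact ⟨fun _ => h3, fun _ => Set.mem_univ p⟩
  rw [e]
  exact h1.union_of_isClosed h2 hs hu

theorem SS_A {f : realization K} (hf : f ∈ Z.A) : Z.SS f.1 = 0 :=
  Finset.sum_eq_zero (fun j _ => hf j)

theorem equiv_wedge (Z : Facets K C N m) [ContractibleSpace (realization (K \ C))] :
    Nonempty (ContinuousMap.HomotopyEquiv (realization K) (Wedge N m)) := by
  have := compact_realization Z.hK
  have := t2_wedge (N := N) (m := m)
  obtain ⟨y, ⟨H⟩⟩ := id_nullhomotopic (realization (K \ C))
  have hH0 : ∀ x, H.toContinuousMap (0, x) = x := fun x => H.map_zero_left x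
  have hH1 : ∀ x, H.toContinuousMap (1, x) = y := fun x => H.map_one_left x
  have hincl : ∀ x : realization (K \ C), incl x ∈ Z.A := fun x => (Z.zero_iff _).2 x.supp
  refine homotopyEquiv_of_collapse Z.q (Z.q_surj _ (hincl y)) Z.A Z.q_eq Z.q_A
    ⟨Z.GG H.toContinuousMap, Z.continuous_GG _ hH0⟩ ?_ ?_ ?_
  · intro f
    change Z.GG H.toContinuousMap (0, f) = f
    have hR : Z.Rf ((0 : I) : ℝ) f.1 = f.1 := by
      have hd : ∀ j, Z.dd ((0 : I) : ℝ) f.1 j = 0 := by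
        intro j
        unfold dd
        simp only [Set.Icc.coe_zero, mul_zero]
        exact min_eq_right (Z.nu_nonneg j f)
      funext v
      simp only [Rf, hd]
      simp
    unfold GG
    split_ifs with h
    · have h0 : 0 ≤ Z.SS f.1 := Finset.sum_nonneg (fun j _ => Z.nu_nonneg j f)
      have h' : Z.SS f.1 = 0 := by
        apply le_antisymm _ h0
        simpa using h
      have e : (((0 : I), f).1 : ℝ) - Z.SS ((0 : I), f).2.1 * (2 * ((m : ℝ) + 1)) = 0 := by
        change ((0 : I) : ℝ) - Z.SS f.1 * _ = 0
        rw [h']; simp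
      rw [e, Set.projIcc_left]
      change incl (H.toContinuousMap (0, _)) = _
      rw [hH0]
      exact Subtype.ext hR
    · exact Subtype.ext hR
  · intro t f hf
    change Z.GG H.toContinuousMap (t, f) ∈ Z.A
    have h : Z.SS f.1 ≤ 1 / (2 * ((m : ℝ) + 1)) * (t : ℝ) := by
      rw [Z.SS_A hf]
      have := t.2.1
      positivity
    unfold GG
    rw [dif_pos h]
    exact hincl _
  · have key : ∀ f ∈ Z.A, Z.GG H.toContinuousMap (1, f) = incl y := by
      intro f hf
      have h : Z.SS f.1 ≤ 1 / (2 * ((m : ℝ) + 1)) * ((1 : I) : ℝ) := by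
        rw [Z.SS_A hf]
        simp only [Set.Icc.coe_one]
        positivity
      unfold GG
      rw [dif_pos h]
      have e : (((1 : I), f).1 : ℝ) - Z.SS ((1 : I), f).2.1 * (2 * ((m : ℝ) + 1)) = 1 := by
        change ((1 : I) : ℝ) - Z.SS f.1 * _ = 1
        rw [Z.SS_A hf]; simp
      rw [e, Set.projIcc_right]
      change incl (H.toContinuousMap (1, _)) = _
      rw [hH1]
    intro f hf g hg
    exact (key f hf).trans (key g hg).symm

end Facets

theorem wedge_main {K C : Set (Finset V)} {m : ℕ} (hK : DownCl K)
    (hmax : ∀ c ∈ K, c.card ≤ m + 1) (hC : ∀ c ∈ C, c ∈ K ∧ c.card = m + 1)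
    [ContractibleSpace (realization (K \ C))] :
    ∃ N : ℕ, Nonempty (ContinuousMap.HomotopyEquiv (realization K) (Wedge N m)) := by
  let e : C ≃ Fin (Nat.card C) := Finite.equivFin C
  have hF : ∀ j : Fin (Nat.card C), ∃ F : Fin (m + 1) → V, Function.Injective F ∧
      Finset.univ.image F = (e.symm j).1 := by
    intro j
    have hc := (hC _ (e.symm j).2).2
    let g := (Finset.equivFinOfCardEq hc).symm
    refine ⟨fun i => (g i).1, fun a b h => g.injective (Subtype.ext h), ?_⟩
    ext v
    simp only [Finset.mem_image, Finset.mem_univ, true_and]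
    constructor
    · rintro ⟨i, rfl⟩; exact (g i).2
    · intro hv
      exact ⟨g.symm ⟨v, hv⟩, by simp⟩
  choose F hFi hFim using hF
  have Z : Facets K C (Nat.card C) m :=
    { F := F
      inj := hFi
      mem := fun j => by rw [hFim]; exact (e.symm j).2
      surj := fun c hc => ⟨e ⟨c, hc⟩, by rw [hFim, Equiv.symm_apply_apply]⟩
      dist := fun j j' h => by
        rw [hFim, hFim] at h
        exact e.symm.injective (Subtype.ext h)
      hmax := hmax
      hK := hK
      hCK := fun c hc => (hC c hc).1 }
  exact ⟨_, Z.equiv_wedge⟩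

end Hep
/-- the order complex of the proper part of `Π_{n,s+1}` is homotopy
equivalent to a wedge of spheres of dimension `n - 2`. -/
theorem statement7 (n s : ℕ) (hn : 2 ≤ n) :
    ∃ N : ℕ, Nonempty (ContinuousMap.HomotopyEquiv
      (realization (orderComplex {x : VPart n s // ¬ IsTop (x : WithBot (VPart n s))}))
      (Wedge N (n - 2))) := by
  classical
  have := VPart.finite_vpart (n := n) (s := s)
  have : Fintype (VPart n s) := Fintype.ofFinite _
  obtain ⟨k, rfl⟩ : ∃ k, n = k + 2 := ⟨n - 2, by omega⟩
  have : Fintype {x : VPart (k + 2) s // ¬ IsTop (x : WithBot (VPart (k + 2) s))} :=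
    Fintype.ofFinite _
  obtain ⟨T, hT, hp⟩ := VPart.proper_iff (s := s) hn
  obtain ⟨hmax, C, hC, hcoll⟩ := good_univ
    (fun x : VPart (k + 2) s => ¬ IsTop (x : WithBot (VPart (k + 2) s))) VPart.rk
    (fun x y h => VPart.rk_lt h) hp T hT VPart.rk_semimod k VPart.key VPart.key_injective
    VPart.atomOf VPart.atomOf_injective VPart.rk_atomOf VPart.atom_exchange
    VPart.exists_atomOf_le
  have hOC : orderComplex {x : VPart (k + 2) s // ¬ IsTop (x : WithBot (VPart (k + 2) s))} =
      Ch Set.univ := by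
    ext c
    exact ⟨fun h => ⟨h, Set.subset_univ _⟩, fun h => h.1⟩
  rw [hOC]
  have : ContractibleSpace (realization (Ch Set.univ \ C)) := by
    refine Coll.contractible hcoll (diff_downCl hmax hC) ⟨empty_mem_Ch _, fun h => ?_⟩
    have := (hC _ h).2
    simp at this
  exact wedge_main (m := k) (Ch_downCl _) hmax hC
end
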